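/- Let (R,m,k) be a regular local ring, let I be an ideal of height d such that R/I satisfies Serre's condition S_2, and let z_1,…,z_d ∈ I be an R-regular sequence with (z_1,…,z_d) ≠ I. Then the natural map K_d(z;R) ⊗_R k → Tor_d^R(R/I, k), induced by a chain map from the Koszul complex K_•(z;R) to a projective resolution of R/I lifting the natural surjection R/(z_1,…,z_d) → R/I, is the zero map. -/

import Mathlib

open IsLocalRing

universe u

variable (R : Type u) [CommRing R]

/-- Index type for the degree-`n` part of the Koszul complex on `s` generators:
`n`-element subsets of `Fin s` (i.e. strictly increasing `n`-tuples). -/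
abbrev KIdx (s n : ℕ) : Type := {T : Finset (Fin s) // T.card = n}

/-- The degree-`n` part of the Koszul complex `K_•(x₁,…,x_s; R)`:
the free `R`-module on `KIdx s n`. -/
abbrev KMod (s n : ℕ) : Type u := KIdx s n →₀ R

/-- The Koszul differential `K_{n+1}(x;R) → K_n(x;R)`,
`e_T ↦ ∑_{j ∈ T} (-1)^{#{i ∈ T : i < j}} x_j e_{T∖{j}}`. -/
noncomputable def koszulD {s : ℕ} (x : Fin s → R) (n : ℕ) :
    KMod R s (n + 1) →ₗ[R] KMod R s n :=
  Finsupp.lsum R fun T => LinearMap.toSpanSingleton R (KMod R s n)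
    (∑ j ∈ T.1.attach,
      ((-1 : R) ^ (T.1.filter (fun i => i < j.1)).card * x j.1) •
        Finsupp.single ⟨T.1.erase j.1, by
          simp [Finset.card_erase_of_mem j.2, T.2]⟩ (1 : R))

/-- A projective resolution `⋯ → F 1 → F 0 → M → 0` of an `R`-module `M`. -/
structure ProjRes (M : Type u) [AddCommGroup M] [Module R M] where
  F : ℕ → ModuleCat.{u} R
  d : ∀ n, F (n + 1) →ₗ[R] F n
  ε : F 0 →ₗ[R] M
  projective : ∀ n, Module.Projective R (F n)
  surj : Function.Surjective ε
  exact0 : LinearMap.ker ε = LinearMap.range (d 0)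
  exact : ∀ n, LinearMap.ker (d n) = LinearMap.range (d (n + 1))

/-- A chain map `ψ : K_•(x;R) → F_•` lifting the natural surjection
`R/(x₁,…,x_s) → R/I` (for `(x) ⊆ I`), where `F_•` is a projective resolution of
`R/I`.  The condition `aug` says that on `K_0 = R·e_∅` the augmentations are
compatible: `ε(ψ₀(r·e_∅)) = r mod I`. -/
structure KoszulLift {s : ℕ} (x : Fin s → R) (I : Ideal R)
    (P : ProjRes R (R ⧸ I)) where
  ψ : ∀ n, KMod R s n →ₗ[R] P.F n
  comm : ∀ n, (ψ n).comp (koszulD R x n) = (P.d n).comp (ψ (n + 1))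
  aug : ∀ v : KMod R s 0, P.ε (ψ 0 v) = Ideal.Quotient.mk I (v ⟨∅, rfl⟩)

/-- The natural map `K_i(x;R) ⊗ k → Tor_i^R(R/I, k)` is the zero map: for every
projective resolution `F_•` of `R/I` and every chain map `ψ : K_•(x;R) → F_•`
lifting the natural surjection `R/(x) → R/I`, every element of `ψ_i(K_i)` lies in
`im(d_{i+1}) + m·F_i`.  (As every element of `K_i ⊗ k` is a cycle, the induced
map on `i`-th homology `K_i ⊗ k → H_i(F_• ⊗ k) = Tor_i^R(R/I,k)` is zero exactly
when `ψ_i(K_i) ⊆ im(d_{i+1}) + m·F_i`.) -/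
def KoszulTorMapZero [IsLocalRing R] {s : ℕ} (x : Fin s → R) (I : Ideal R)
    (i : ℕ) : Prop :=
  ∀ (P : ProjRes R (R ⧸ I)) (L : KoszulLift R x I P) (v : KMod R s i),
    L.ψ i v ∈ LinearMap.range (P.d i) ⊔ (maximalIdeal R) • (⊤ : Submodule R (P.F i))

/-- `R` is a regular local ring: a Noetherian local ring whose maximal ideal is
generated by `dim R` elements. -/
def IsRegularLocal [IsLocalRing R] : Prop :=
  IsNoetherianRing R ∧ ∃ (n : ℕ) (x : Fin n → R),
    Ideal.span (Set.range x) = maximalIdeal R ∧ ringKrullDim R = n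

/-- The ideal `I` has height `d`: `d` is the minimum of the heights of the primes
containing `I`, the height of a prime `P` being `dim R_P`. -/
def HeightEq (I : Ideal R) (d : ℕ) : Prop :=
  (∃ (P : Ideal R) (h : P.IsPrime), I ≤ P ∧
      ringKrullDim (@Localization.AtPrime R _ P h) = d) ∧
    ∀ (P : Ideal R) (h : P.IsPrime), I ≤ P →
      (d : WithBot ℕ∞) ≤ ringKrullDim (@Localization.AtPrime R _ P h)

/-- Serre's condition `S_n` for the ring `A`: for every prime `P` of `A`,
`depth A_P ≥ min(n, dim A_P)`, expressed by the existence of regular sequences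
in the maximal ideal of `A_P` of every length `j ≤ min(n, dim A_P)`. -/
def SerreS (A : Type u) [CommRing A] (n : ℕ) : Prop :=
  ∀ (P : Ideal A) (h : P.IsPrime) (j : ℕ), j ≤ n →
    (j : WithBot ℕ∞) ≤ ringKrullDim (@Localization.AtPrime A _ P h) →
      ∃ rs : List (@Localization.AtPrime A _ P h), rs.length = j ∧
        (∀ r ∈ rs, r ∈ maximalIdeal (@Localization.AtPrime A _ P h)) ∧
        RingTheory.Sequence.IsWeaklyRegular (@Localization.AtPrime A _ P h) rs

section Chase

open CategoryTheory Abelian Limits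

variable {B : Type u} [CommRing B]

lemma ext_smul_eq_zero_of_factor {M N F : ModuleCat.{u} B} {j : ℕ} (f : N ⟶ F) (g : F ⟶ N)
    (a : B) (hfg : f ≫ g = a • 𝟙 N) (hF : Subsingleton (Ext M F j)) (e : Ext M N j) :
    a • e = 0 := by
  have h1 : a • e = e.comp (Ext.mk₀ (a • 𝟙 N)) (add_zero j) := by
    rw [Ext.mk₀_smul, Ext.comp_smul, Ext.comp_mk₀_id]
  rw [h1, ← hfg, ← Ext.mk₀_comp_mk₀, ← Ext.comp_assoc_of_third_deg_zero,
    Subsingleton.elim (e.comp (Ext.mk₀ f) (add_zero j)) 0, Ext.zero_comp]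

lemma ext_smul_eq_zero_of_shortExact {M : ModuleCat.{u} B} {S : ShortComplex (ModuleCat.{u} B)}
    (hS : S.ShortExact) {j : ℕ} (a : B) (hF : Subsingleton (Ext M S.X₂ j))
    (h : ∀ e : Ext M S.X₁ (j + 1), a • e = 0) (e : Ext M S.X₃ j) : a • e = 0 := by
  have h1 : (a • e).comp hS.extClass rfl = 0 := by
    rw [Ext.smul_comp]; exact h _
  obtain ⟨x, hx⟩ := Ext.covariant_sequence_exact₃ M hS (a • e) rfl h1
  rw [← hx, Subsingleton.elim x 0, Ext.zero_comp]


lemma smul_apply_eq_zero_of_ext_zero {M N : ModuleCat.{u} B} (a : B) (h : ∀ e : Ext M N 0, a • e = 0)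
    (f : M →ₗ[B] N) (v : M) : a • f v = 0 := by
  have h1 := h (Ext.mk₀ (ModuleCat.ofHom f))
  rw [← Ext.mk₀_smul, Ext.mk₀_eq_zero_iff] at h1
  exact congrArg (fun t => t.hom v) h1

variable (C : ℕ → ModuleCat.{u} B) (d : ∀ l, C (l + 1) →ₗ[B] C l)

/-- The cokernel of the differential ending in degree `l`. -/
abbrev Coker (l : ℕ) : ModuleCat.{u} B := ModuleCat.of B (C l ⧸ LinearMap.range (d l))

lemma coker_smul_ext_eq_zero (dd : ∀ l, (d l) ∘ₗ (d (l + 1)) = 0) {M : ModuleCat.{u} B} (m j : ℕ)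
    (hM : Subsingleton (Ext M (C m) j)) (a : B) (h : C (m + 1) →ₗ[B] C (m + 2))
    (g : C m →ₗ[B] C (m + 1))
    (hg : ∀ v, a • v = d (m + 1) (h v) + g (d m v)) (e : Ext M (Coker C d m) j) : a • e = 0 := by
  let f' : C m →ₗ[B] C m := a • LinearMap.id - (d m) ∘ₗ g
  have hf : LinearMap.range (d m) ≤ LinearMap.ker f' := by
    rintro _ ⟨u, rfl⟩
    have h1 := congrArg (d m) (hg u)
    have h2 := LinearMap.congr_fun (dd m) (h u)
    simp only [LinearMap.comp_apply, LinearMap.zero_apply] at h2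
    rw [map_add, map_smul, h2, zero_add] at h1
    simp [f', h1]
  refine ext_smul_eq_zero_of_factor (F := C m)
    (ModuleCat.ofHom ((LinearMap.range (d m)).liftQ f' hf))
    (ModuleCat.ofHom (LinearMap.range (d m)).mkQ) a ?_ hM e
  ext v
  have : (LinearMap.range (d m)).mkQ (d m (g v)) = 0 := by simp
  change (LinearMap.range (d m)).mkQ (f' v) = a • (LinearMap.range (d m)).mkQ v
  simp only [f', LinearMap.sub_apply, LinearMap.smul_apply, LinearMap.id_apply,
    LinearMap.comp_apply, map_sub, this, sub_zero, map_smul]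

lemma coker_smul_ext_descend (dd : ∀ l, (d l) ∘ₗ (d (l + 1)) = 0) {M : ModuleCat.{u} B} (m j : ℕ)
    (hM : Subsingleton (Ext M (C m) j)) (a : B)
    (hex : ∀ v, d m v = 0 → ∃ u, d (m + 1) u = v)
    (h : ∀ e : Ext M (Coker C d (m + 1)) (j + 1), a • e = 0) (e : Ext M (Coker C d m) j) :
    a • e = 0 := by
  let f' : (C (m + 1) ⧸ LinearMap.range (d (m + 1))) →ₗ[B] C m :=
    (LinearMap.range (d (m + 1))).liftQ (d m) (by
      rintro _ ⟨u, rfl⟩; exact LinearMap.congr_fun (dd m) u)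
  have hr : LinearMap.range f' = LinearMap.range (d m) := Submodule.range_liftQ _ _ _
  have hE : Function.Exact f' (LinearMap.range (d m)).mkQ := by
    rw [LinearMap.exact_iff, Submodule.ker_mkQ, hr]
  let S := ModuleCat.shortComplexOfCompEqZero f' (LinearMap.range (d m)).mkQ
    hE.linearMap_comp_eq_zero
  have hS : S.ShortExact := ModuleCat.shortComplex_shortExact S hE (by
    change Function.Injective f'
    rw [← LinearMap.ker_eq_bot, Submodule.ker_liftQ_eq_bot]
    intro v hv
    obtain ⟨u, hu⟩ := hex v hv
    exact ⟨u, hu⟩) (Submodule.mkQ_surjective _)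
  exact ext_smul_eq_zero_of_shortExact hS a hM h e

variable (r : ℕ) (x : ℕ → B)

/-- The ideal generated by the first `i` terms of a sequence. -/
def initIdeal (x : ℕ → B) (i : ℕ) : Ideal B := Ideal.span (x '' {j | j < i})

lemma initIdeal_le_iff {x : ℕ → B} {i : ℕ} {J : Ideal B} :
    initIdeal x i ≤ J ↔ ∀ j < i, x j ∈ J := by
  rw [initIdeal, Ideal.span_le]
  constructor
  · intro h j hj
    exact h ⟨j, hj, rfl⟩
  · rintro h _ ⟨j, hj, rfl⟩
    exact h j hj

variable {r x C d} in
lemma coker_eq_zero_of_exact_above (dd : ∀ l, (d l) ∘ₗ (d (l + 1)) = 0) (hr : x r = 1)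
    (hom : ∀ m < r, ∀ i ≤ m + 1, ∃ (h : C (m + 1) →ₗ[B] C (m + 2)) (g : C m →ₗ[B] C (m + 1)),
      ∀ v, x i • v = d (m + 1) (h v) + g (d m v))
    (hext : ∀ m, ∀ i ≤ r, ∀ j < i,
      Subsingleton (Ext (ModuleCat.of B (B ⧸ initIdeal x i)) (C m) j))
    (m : ℕ) (hex : ∀ l, m ≤ l → l + 1 < r → ∀ v, d l v = 0 → ∃ u, d (l + 1) u = v)
    (v : C m) (hv : ∀ i ≤ m, x i • v ∈ LinearMap.range (d m)) : v ∈ LinearMap.range (d m) := by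
  have key : ∀ i, i ≤ r → x i • v ∈ LinearMap.range (d m) := by
    intro i
    induction i using Nat.strong_induction_on with
    | _ i ih =>
      intro hi
      by_cases him : i ≤ m
      · exact hv i him
      push Not at him
      obtain ⟨t, rfl⟩ : ∃ t, i = m + 1 + t := ⟨i - (m + 1), by omega⟩
      have desc : ∀ s ≤ t, ∀ e : Ext (ModuleCat.of B (B ⧸ initIdeal x (m + 1 + t)))
          (Coker C d (m + (t - s))) (t - s), x (m + 1 + t) • e = 0 := by
        intro s
        induction s with
        | zero =>
          intro _ e
          obtain ⟨h, g, hg⟩ := hom (m + t) (by omega) (m + 1 + t) (by omega)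
          exact coker_smul_ext_eq_zero C d dd (m + t) t (hext _ _ hi _ (by omega)) _ h g hg e
        | succ s ihs =>
          intro hs e
          obtain ⟨w, hw⟩ : ∃ w, t - s = w + 1 := ⟨t - s - 1, by omega⟩
          have hw' : t - (s + 1) = w := by omega
          revert e
          have ihs' := ihs (by omega)
          rw [hw] at ihs'
          rw [hw']
          intro e
          exact coker_smul_ext_descend C d dd (m + w) w (hext _ _ hi _ (by omega)) _
            (hex _ (by omega) (by omega)) ihs' e
      have h0 := desc t le_rfl
      rw [Nat.sub_self] at h0
      have hle : initIdeal x (m + 1 + t) ≤ LinearMap.ker (LinearMap.toSpanSingleton B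
          (C m ⧸ LinearMap.range (d m)) ((LinearMap.range (d m)).mkQ v)) := by
        rw [initIdeal_le_iff]
        intro j hj
        have := ih j hj (by omega)
        rw [LinearMap.mem_ker, LinearMap.toSpanSingleton_apply, ← map_smul]
        exact (Submodule.Quotient.mk_eq_zero _).mpr this
      have h1 := smul_apply_eq_zero_of_ext_zero _ h0
        ((initIdeal x (m + 1 + t)).liftQ _ hle) ((initIdeal x (m + 1 + t)).mkQ 1)
      change x (m + 1 + t) • ((1 : B) • (LinearMap.range (d m)).mkQ v) = 0 at h1
      rw [one_smul, ← map_smul] at h1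
      exact (Submodule.Quotient.mk_eq_zero _).mp h1
  simpa [hr] using key r le_rfl

variable {r x C d} in
theorem mem_range_of_smul_mem_range (dd : ∀ l, (d l) ∘ₗ (d (l + 1)) = 0) (hr : x r = 1)
    (hom : ∀ m < r, ∀ i ≤ m + 1, ∃ (h : C (m + 1) →ₗ[B] C (m + 2)) (g : C m →ₗ[B] C (m + 1)),
      ∀ v, x i • v = d (m + 1) (h v) + g (d m v))
    (hext : ∀ m, ∀ i ≤ r, ∀ j < i,
      Subsingleton (Ext (ModuleCat.of B (B ⧸ initIdeal x i)) (C m) j))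
    (v : C 0) (hv : x 0 • v ∈ LinearMap.range (d 0)) : v ∈ LinearMap.range (d 0) := by
  rcases Nat.eq_zero_or_pos r with rfl | hr0
  · simpa [hr] using hv
  have hex : ∀ s l, r ≤ l + 1 + s → l + 1 < r → ∀ v, d l v = 0 → ∃ u, d (l + 1) u = v := by
    intro s
    induction s with
    | zero => intro l h1 h2; omega
    | succ s ih =>
      intro l h1 h2 v hv
      refine coker_eq_zero_of_exact_above dd hr hom hext (l + 1)
        (fun l' h1' h2' => ih l' (by omega) h2') v ?_
      intro i hi
      obtain ⟨h, g, hg⟩ := hom l (by omega) i hi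
      exact ⟨h v, by rw [hg, hv, map_zero, add_zero]⟩
  refine coker_eq_zero_of_exact_above dd hr hom hext 0
    (fun l _ h2 => hex r l (by omega) h2) v ?_
  intro i hi
  obtain rfl : i = 0 := by omega
  exact hv

end Chase

section InitIdeal

open CategoryTheory Abelian Limits RingTheory.Sequence

variable {B : Type u} [CommRing B]

lemma initIdeal_zero (x : ℕ → B) : initIdeal x 0 = ⊥ := by
  simp [initIdeal]

lemma initIdeal_succ (x : ℕ → B) (i : ℕ) :
    initIdeal x (i + 1) = initIdeal x i ⊔ Ideal.span {x i} := by
  rw [initIdeal, initIdeal, ← Ideal.span_union]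
  congr 1
  ext b
  simp only [Set.mem_image, Set.mem_ofPred_eq, Set.union_singleton, Set.mem_insert_iff]
  constructor
  · rintro ⟨j, hj, rfl⟩
    rcases Nat.lt_succ_iff_lt_or_eq.mp hj with h | rfl
    · exact Or.inr ⟨j, h, rfl⟩
    · exact Or.inl rfl
  · rintro (rfl | ⟨j, hj, rfl⟩)
    · exact ⟨i, by omega, rfl⟩
    · exact ⟨j, by omega, rfl⟩

lemma mem_initIdeal {x : ℕ → B} {i j : ℕ} (h : j < i) : x j ∈ initIdeal x i :=
  Ideal.subset_span ⟨j, h, rfl⟩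

lemma initIdeal_mono (x : ℕ → B) {i j : ℕ} (h : i ≤ j) : initIdeal x i ≤ initIdeal x j :=
  initIdeal_le_iff.mpr fun _ hk => mem_initIdeal (hk.trans_le h)

lemma initIdeal_congr {x y : ℕ → B} {i : ℕ} (h : ∀ j < i, x j = y j) :
    initIdeal x i = initIdeal y i := by
  apply le_antisymm <;> rw [initIdeal_le_iff] <;> intro j hj
  · rw [h j hj]; exact mem_initIdeal hj
  · rw [← h j hj]; exact mem_initIdeal hj

lemma initIdeal_map {B' : Type*} [CommRing B'] (f : B →+* B') (x : ℕ → B) (i : ℕ) :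
    (initIdeal x i).map f = initIdeal (fun j => f (x j)) i := by
  rw [initIdeal, Ideal.map_span, initIdeal, Set.image_image]

lemma ofList_range_map (x : ℕ → B) (i : ℕ) :
    Ideal.ofList ((List.range i).map x) = initIdeal x i := by
  rw [Ideal.ofList, initIdeal]
  congr 1
  ext b
  simp

lemma height_le_of_mem_minimalPrimes_initIdeal [IsNoetherianRing B] {x : ℕ → B} {i : ℕ}
    {P : Ideal B} (h : P ∈ (initIdeal x i).minimalPrimes) : P.height ≤ i := by
  have h1 := Ideal.height_le_card_of_mem_minimalPrimes_span
    ((Set.finite_lt_nat i).image x) h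
  refine h1.trans ?_
  have := Set.ncard_image_le (f := x) (Set.finite_lt_nat i)
  have h2 : {j | j < i}.ncard = i := by
    have h3 : {j | j < i} = (Finset.range i : Set ℕ) := by ext; simp
    rw [h3, Set.ncard_coe_finset, Finset.card_range]
  rw [h2] at this
  exact_mod_cast this

lemma initIdeal_height_le [IsNoetherianRing B] {x : ℕ → B} {i : ℕ} (h : initIdeal x i ≠ ⊤) :
    (initIdeal x i).height ≤ i := by
  obtain ⟨P, hP⟩ := Ideal.nonempty_minimalPrimes h
  exact (Ideal.height_mono hP.1.2).trans (height_le_of_mem_minimalPrimes_initIdeal hP)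

lemma initIdeal_ne_top [IsLocalRing B] {x : ℕ → B} {i : ℕ} (h : ∀ j < i, x j ∈ maximalIdeal B) :
    initIdeal x i ≠ ⊤ := fun ht =>
  (maximalIdeal.isMaximal B).ne_top (top_le_iff.mp (ht ▸ initIdeal_le_iff.mpr h))

lemma maximalIdeal_mem_minimalPrimes [IsLocalRing B] {I : Ideal B} (hI : I ≠ ⊤)
    (h : maximalIdeal B ≤ I.radical) : maximalIdeal B ∈ I.minimalPrimes := by
  refine ⟨⟨inferInstance, le_maximalIdeal hI⟩, fun Q hQ _ => ?_⟩
  have := hQ.1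
  exact h.trans ((Ideal.radical_mono hQ.2).trans this.radical.le)

lemma ringKrullDim_le_of_maximalIdeal_le_radical [IsNoetherianRing B] [IsLocalRing B]
    {x : ℕ → B} {i : ℕ} (hx : ∀ j < i, x j ∈ maximalIdeal B)
    (h : maximalIdeal B ≤ (initIdeal x i).radical) : ringKrullDim B ≤ i := by
  rw [← IsLocalRing.maximalIdeal_height_eq_ringKrullDim]
  exact_mod_cast height_le_of_mem_minimalPrimes_initIdeal
    (maximalIdeal_mem_minimalPrimes (initIdeal_ne_top hx) h)

end InitIdeal

section RegularLocal

open CategoryTheory Abelian Limits RingTheory.Sequence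

/-- A regular local ring of dimension `n`. -/
structure RegLoc (R : Type u) [CommRing R] [IsLocalRing R] (n : ℕ) : Prop where
  noeth : IsNoetherianRing R
  gen : ∃ y : ℕ → R, initIdeal y n = maximalIdeal R
  dim : ringKrullDim R = n

lemma maximalIdeal_quotient {R : Type u} [CommRing R] [IsLocalRing R] (I : Ideal R)
    [IsLocalRing (R ⧸ I)] :
    maximalIdeal (R ⧸ I) = (maximalIdeal R).map (Ideal.Quotient.mk I) := by
  have := IsLocalRing.of_surjective' (Ideal.Quotient.mk I) Ideal.Quotient.mk_surjective
  exact ((IsLocalRing.map_maximalIdeal_of_surjective (Ideal.Quotient.mk I)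
    Ideal.Quotient.mk_surjective)).symm

lemma isLocalRing_quotient {R : Type u} [CommRing R] [IsLocalRing R] {I : Ideal R} (h : I ≠ ⊤) :
    IsLocalRing (R ⧸ I) :=
  have := Ideal.Quotient.nontrivial_iff.mpr h
  IsLocalRing.of_surjective' (Ideal.Quotient.mk I) Ideal.Quotient.mk_surjective

lemma initIdeal_sub {R : Type u} [CommRing R] (y : ℕ → R) (i n : ℕ) (h : i ≤ n) :
    (initIdeal y n).map (Ideal.Quotient.mk (initIdeal y i)) =
      initIdeal (fun j => Ideal.Quotient.mk (initIdeal y i) (y (i + j))) (n - i) := by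
  rw [initIdeal_map]
  apply le_antisymm <;> rw [initIdeal_le_iff] <;> intro j hj
  · by_cases hji : j < i
    · rw [Ideal.Quotient.eq_zero_iff_mem.mpr (mem_initIdeal hji)]; exact zero_mem _
    · have := mem_initIdeal (x := fun j => Ideal.Quotient.mk (initIdeal y i) (y (i + j)))
        (i := n - i) (j := j - i) (by omega)
      simpa [show i + (j - i) = j by omega] using this
  · exact mem_initIdeal (x := fun j => Ideal.Quotient.mk (initIdeal y i) (y j))
      (show i + j < n by omega)

lemma RegLoc.quotient {R : Type u} [CommRing R] [IsLocalRing R] {n i : ℕ} (hR : RegLoc R n)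
    {y : ℕ → R} (hy : initIdeal y n = maximalIdeal R) (hi : i ≤ n)
    [IsLocalRing (R ⧸ initIdeal y i)] : RegLoc (R ⧸ initIdeal y i) (n - i) := by
  have := hR.noeth
  have hym : ∀ j < n, y j ∈ maximalIdeal R := fun j hj => hy ▸ mem_initIdeal hj
  have hgen : initIdeal (fun j => Ideal.Quotient.mk (initIdeal y i) (y (i + j))) (n - i) =
      maximalIdeal (R ⧸ initIdeal y i) := by
    rw [maximalIdeal_quotient, ← hy, initIdeal_sub _ _ _ hi]
  refine ⟨inferInstance, ⟨_, hgen⟩, le_antisymm ?_ ?_⟩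
  · refine ringKrullDim_le_of_maximalIdeal_le_radical (fun j hj => ?_)
      (by rw [hgen]; exact Ideal.le_radical)
    rw [← hgen]; exact mem_initIdeal hj
  · have h1 := ringKrullDim_le_ringKrullDim_quotient_add_encard (y '' {j | j < i}) (by
      rw [IsLocalRing.ringJacobson_eq_maximalIdeal]
      rintro _ ⟨j, hj, rfl⟩
      exact hym j (lt_of_lt_of_le hj hi))
    rw [hR.dim] at h1
    change (n : WithBot ℕ∞) ≤ ringKrullDim (R ⧸ initIdeal y i) + _ at h1
    have h2 : (y '' {j | j < i}).encard ≤ i := by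
      refine (Set.encard_image_le _ _).trans ?_
      have h3 : {j | j < i} = (Finset.range i : Set ℕ) := by ext; simp
      rw [h3, Set.encard_coe_eq_coe_finsetCard, Finset.card_range]
    obtain ⟨e, he⟩ : ∃ e : ℕ∞, ringKrullDim (R ⧸ initIdeal y i) = e := by
      have := ringKrullDim_nonneg_of_nontrivial (R := R ⧸ initIdeal y i)
      rcases h : ringKrullDim (R ⧸ initIdeal y i) with _ | e
      · rw [h] at this
        exact absurd (le_bot_iff.mp this) (WithBot.coe_ne_bot (a := (0 : ℕ∞)))
      · exact ⟨e, rfl⟩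
    rw [he] at h1 ⊢
    have h4 : (n : ℕ∞) ≤ e + (y '' {j | j < i}).encard := by exact_mod_cast h1
    have h5 : (n : ℕ∞) ≤ e + i := h4.trans (by gcongr)
    have h6 : ((n - i : ℕ) : ℕ∞) ≤ e := by
      induction e using ENat.recTopCoe with
      | top => exact le_top
      | coe e =>
        have : n ≤ e + i := by exact_mod_cast h5
        have : n - i ≤ e := by omega
        exact_mod_cast this
    exact WithBot.coe_le_coe.mpr h6

end RegularLocal

section Depth

open CategoryTheory Abelian Limits RingTheory.Sequence
open scoped Pointwise

/-- `P` is prime and is the annihilator of an element of `M`. -/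
def AssP {A : Type u} [CommRing A] (P : Ideal A) (M : Type u) [AddCommGroup M] [Module A M] :
    Prop :=
  P.IsPrime ∧ ∃ v : M, ∀ a, a ∈ P ↔ a • v = 0

variable {A : Type u} [CommRing A]

lemma assP_iff [IsNoetherianRing A] {P : Ideal A} {M : Type u} [AddCommGroup M] [Module A M] :
    AssP P M ↔ P ∈ associatedPrimes A M := by
  rw [AssociatedPrimes.mem_iff, isAssociatedPrime_iff, AssP]
  refine and_congr Iff.rfl (exists_congr fun v => ?_)
  rw [SetLike.ext_iff]
  simp [Submodule.mem_colon_singleton]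

lemma exists_assP [IsNoetherianRing A] {M : Type u} [AddCommGroup M] [Module A M] {v : M}
    (hv : v ≠ 0) : ∃ P : Ideal A, AssP P M ∧ ∀ a : A, a • v = 0 → a ∈ P := by
  obtain ⟨P, hP, h⟩ := exists_le_isAssociatedPrime_of_isNoetherianRing A v hv
  exact ⟨P, assP_iff.mpr hP, fun a ha => h (by simpa [Submodule.mem_colon_singleton] using ha)⟩

lemma isSMulRegular_of_forall_assP [IsNoetherianRing A] {M : Type u} [AddCommGroup M] [Module A M]
    {x : A} (h : ∀ P : Ideal A, AssP P M → x ∉ P) : IsSMulRegular M x := by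
  rw [isSMulRegular_iff_right_eq_zero_of_smul]
  intro v hv
  by_contra hne
  obtain ⟨P, hP, hann⟩ := exists_assP (A := A) hne
  exact h P hP (hann x hv)

lemma AssP.notMem {P : Ideal A} {M : Type u} [AddCommGroup M] [Module A M] (h : AssP P M) {x : A}
    (hx : IsSMulRegular M x) : x ∉ P := by
  obtain ⟨hP, v, hv⟩ := h
  intro hxP
  have hv0 : v = 0 := (isSMulRegular_iff_right_eq_zero_of_smul.mp hx) _ ((hv x).mp hxP)
  exact hP.ne_top ((Ideal.eq_top_iff_one P).mpr ((hv 1).mpr (by rw [hv0, smul_zero])))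

variable [IsLocalRing A]

/-- There is a weakly regular sequence on `M` of length `t` in the maximal ideal. -/
def DepthGE (A : Type u) [CommRing A] [IsLocalRing A] (t : ℕ) (M : Type u) [AddCommGroup M]
    [Module A M] : Prop :=
  ∃ rs : List A, rs.length = t ∧ (∀ r ∈ rs, r ∈ maximalIdeal A) ∧ IsWeaklyRegular M rs

variable {M : Type u} [AddCommGroup M] [Module A M]

lemma depthGE_succ_iff {t : ℕ} : DepthGE A (t + 1) M ↔
    ∃ x ∈ maximalIdeal A, IsSMulRegular M x ∧ DepthGE A t (QuotSMulTop x M) := by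
  constructor
  · rintro ⟨_ | ⟨x, rs⟩, hl, hm, hr⟩
    · simp at hl
    · rw [isWeaklyRegular_cons_iff] at hr
      exact ⟨x, hm x (by simp), hr.1, rs, by simpa using hl, fun r h => hm r (by simp [h]), hr.2⟩
  · rintro ⟨x, hx, hr, rs, hl, hm, hrs⟩
    exact ⟨x :: rs, by simp [hl], by
      rintro r (_ | ⟨_, h⟩)
      exacts [hx, hm r h],
      (isWeaklyRegular_cons_iff M x rs).mpr ⟨hr, hrs⟩⟩

lemma maximalIdeal_smul_top_lt [Nontrivial M] [Module.Finite A M] :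
    maximalIdeal A • (⊤ : Submodule A M) < ⊤ := by
  refine lt_top_iff_ne_top.mpr fun h => ?_
  have := Submodule.eq_bot_of_le_smul_of_le_jacobson_bot (maximalIdeal A) (⊤ : Submodule A M)
    Module.Finite.fg_top h.ge (IsLocalRing.maximalIdeal_le_jacobson _)
  exact bot_ne_top this.symm

lemma isRegular_of_isWeaklyRegular [Nontrivial M] [Module.Finite A M] {rs : List A}
    (hm : ∀ r ∈ rs, r ∈ maximalIdeal A) (h : IsWeaklyRegular M rs) : IsRegular M rs := by
  refine ⟨h, fun ht => ?_⟩
  have h1 : Ideal.ofList rs ≤ maximalIdeal A := Ideal.span_le.mpr hm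
  exact (maximalIdeal_smul_top_lt (A := A) (M := M)).ne
    (top_le_iff.mp (ht.le.trans (Submodule.smul_mono_left h1)))

lemma depthGE_iff_ext [IsNoetherianRing A] [Nontrivial M] [Module.Finite A M] {t : ℕ} :
    DepthGE A t M ↔
    ∀ j < t, Subsingleton (Ext (ModuleCat.of A (A ⧸ maximalIdeal A)) (ModuleCat.of A M) j) := by
  have hsupp : Module.support A (ModuleCat.of A (A ⧸ maximalIdeal A)) =
      PrimeSpectrum.zeroLocus (maximalIdeal A : Set A) := by
    rw [Module.support_eq_zeroLocus]
    congr 2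
    exact Ideal.annihilator_quotient
  constructor
  · rintro ⟨rs, rfl, hm, hr⟩
    exact ModuleCat.subsingleton_ext_of_exists_isRegular (maximalIdeal A) _ hsupp.le
      (ModuleCat.of A M) maximalIdeal_smul_top_lt rs hm (isRegular_of_isWeaklyRegular hm hr)
  · intro h
    obtain ⟨rs, h1, h2, h3⟩ := ModuleCat.exists_isRegular_of_exists_subsingleton_ext
      (maximalIdeal A) t (ModuleCat.of A M) maximalIdeal_smul_top_lt
      (ModuleCat.of A (A ⧸ maximalIdeal A)) hsupp h
    exact ⟨rs, h1, h2, h3.toIsWeaklyRegular⟩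

lemma nontrivial_quotSMulTop [Nontrivial M] [Module.Finite A M] {x : A}
    (hx : x ∈ maximalIdeal A) : Nontrivial (QuotSMulTop x M) := by
  refine Submodule.Quotient.nontrivial_iff.mpr fun h => ?_
  refine (maximalIdeal_smul_top_lt (A := A) (M := M)).ne (top_le_iff.mp (h.ge.trans ?_))
  rw [← Submodule.ideal_span_singleton_smul]
  exact Submodule.smul_mono_left ((Ideal.span_singleton_le_iff_mem _).mpr hx)

lemma DepthGE.quotSMulTop [IsNoetherianRing A] [Nontrivial M] [Module.Finite A M] {t : ℕ}
    (h : DepthGE A (t + 1) M) {x : A} (hx : x ∈ maximalIdeal A) (hr : IsSMulRegular M x) :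
    DepthGE A t (QuotSMulTop x M) := by
  have := nontrivial_quotSMulTop (M := M) hx
  rw [depthGE_iff_ext] at h ⊢
  intro i hi
  have zero1 := AddCommGrpCat.isZero_of_iff_subsingleton.mpr (h i (by omega))
  have zero2 := AddCommGrpCat.isZero_of_iff_subsingleton.mpr (h (i + 1) (by omega))
  have hr' : IsSMulRegular (ModuleCat.of A M) x := hr
  exact AddCommGrpCat.subsingleton_of_isZero <| ShortComplex.Exact.isZero_of_both_zeros
    ((Ext.covariant_sequence_exact₃' (ModuleCat.of A (A ⧸ maximalIdeal A))
      hr'.smulShortComplex_shortExact) i (i + 1) rfl)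
    (zero1.eq_zero_of_src _) (zero2.eq_zero_of_tgt _)

lemma DepthGE.assP_lt [IsNoetherianRing A] [Module.Finite A M] {x : A} (hx : x ∈ maximalIdeal A)
    (hr : IsSMulRegular M x) {P : Ideal A} (hP : AssP P M) :
    ∃ P' : Ideal A, AssP P' (QuotSMulTop x M) ∧ P < P' := by
  obtain ⟨hPp, v, hv⟩ := id hP
  let N : Submodule A M :=
    { carrier := {w | ∀ a ∈ P, a • w = 0}
      add_mem' := fun {a b} ha hb c hc => by rw [smul_add, ha c hc, hb c hc, add_zero]
      zero_mem' := fun c _ => smul_zero c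
      smul_mem' := fun r w hw c hc => by rw [smul_comm, hw c hc, smul_zero] }
  have hvN : v ∈ N := fun a ha => (hv a).mp ha
  obtain ⟨w, hwN, hw⟩ : ∃ w ∈ N, w ∉ x • (⊤ : Submodule A M) := by
    by_contra! hcon
    have hle : N ≤ Ideal.span {x} • N := by
      intro w hw
      obtain ⟨w', -, hw'⟩ := Submodule.mem_smul_pointwise_iff_exists _ _ _ |>.mp (hcon w hw)
      rw [← hw']
      refine Submodule.smul_mem_smul (Ideal.mem_span_singleton_self x) fun a ha => ?_
      refine isSMulRegular_iff_right_eq_zero_of_smul.mp hr _ ?_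
      rw [smul_comm, hw']; exact hw a ha
    have hbot := Submodule.eq_bot_of_le_smul_of_le_jacobson_bot _ N (IsNoetherian.noetherian N) hle
      (((Ideal.span_singleton_le_iff_mem _).mpr hx).trans (IsLocalRing.maximalIdeal_le_jacobson _))
    have hv0 : v = 0 := by rw [hbot] at hvN; exact (Submodule.mem_bot A).mp hvN
    exact hPp.ne_top ((Ideal.eq_top_iff_one P).mpr ((hv 1).mpr (by rw [hv0, smul_zero])))
  have hne : (Submodule.Quotient.mk w : QuotSMulTop x M) ≠ 0 :=
    fun h => hw ((Submodule.Quotient.mk_eq_zero _).mp h)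
  obtain ⟨P', hP', hann⟩ := exists_assP (A := A) hne
  refine ⟨P', hP', lt_of_le_of_ne (fun a ha => hann a ?_) fun h => ?_⟩
  · rw [← Submodule.Quotient.mk_smul, hwN a ha, Submodule.Quotient.mk_zero]
  · refine hP.notMem hr (h ▸ hann x ?_)
    rw [← Submodule.Quotient.mk_smul, Submodule.Quotient.mk_eq_zero]
    exact Submodule.smul_mem_pointwise_smul _ _ _ trivial

lemma DepthGE.height_and_dim [IsNoetherianRing A] {t : ℕ} : ∀ {M : Type u} [AddCommGroup M]
    [Module A M] [Module.Finite A M], DepthGE A t M → ∀ {P : Ideal A}, AssP P M →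
    P.height + t ≤ (maximalIdeal A).height ∧ (t : WithBot ℕ∞) ≤ ringKrullDim (A ⧸ P) := by
  induction t with
  | zero =>
    intro M _ _ _ _ P hP
    have := Ideal.Quotient.nontrivial_iff.mpr hP.1.ne_top
    exact ⟨by simpa using Ideal.height_mono (le_maximalIdeal hP.1.ne_top),
      by simpa using ringKrullDim_nonneg_of_nontrivial (R := A ⧸ P)⟩
  | succ t ih =>
    intro M _ _ _ hM P hP
    obtain ⟨x, hx, hr, hq⟩ := depthGE_succ_iff.mp hM
    obtain ⟨P', hP', hlt⟩ := DepthGE.assP_lt hx hr hP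
    obtain ⟨h1, h2⟩ := ih hq hP'
    have := hP.1
    have := hP'.1
    constructor
    · have h3 := Ideal.height_add_one_le_of_lt_of_isPrime hlt
      calc P.height + ((t + 1 : ℕ) : ℕ∞) = P.height + 1 + t := by push_cast; ring
        _ ≤ P'.height + t := by gcongr
        _ ≤ _ := h1
    · obtain ⟨y, hy, hyP⟩ := SetLike.exists_of_lt hlt
      have h3 : ringKrullDim (A ⧸ P') + 1 ≤ ringKrullDim (A ⧸ P) :=
        ringKrullDim_succ_le_of_surjective (Ideal.Quotient.factor hlt.le)
          (Ideal.Quotient.factor_surjective hlt.le) (r := Ideal.Quotient.mk P y)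
          (mem_nonZeroDivisors_of_ne_zero fun h => hyP (Ideal.Quotient.eq_zero_iff_mem.mp h))
          (by simpa [Ideal.Quotient.eq_zero_iff_mem] using hy)
      refine le_trans ?_ h3
      push_cast
      gcongr

end Depth

section FullParameters

open CategoryTheory Abelian Limits RingTheory.Sequence
open scoped Pointwise

variable {A : Type u} [CommRing A]

/-- `R / J R = R / J` for the submodule `J • ⊤`. -/
noncomputable def quotSmulTopEquiv (J : Ideal A) : (A ⧸ (J • (⊤ : Submodule A A))) ≃ₗ[A] A ⧸ J :=
  Submodule.quotEquivOfEq _ _ (by simp)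

lemma isWeaklyRegular_range_iff {x : ℕ → A} {n : ℕ} :
    IsWeaklyRegular A ((List.range n).map x) ↔
      ∀ j < n, IsSMulRegular (A ⧸ initIdeal x j) (x j) := by
  have key : ∀ i (h : i < ((List.range n).map x).length),
      IsSMulRegular (A ⧸ (Ideal.ofList (((List.range n).map x).take i) • ⊤ : Submodule A A))
        (((List.range n).map x)[i]) ↔ IsSMulRegular (A ⧸ initIdeal x i) (x i) := by
    intro i h
    have hi : i < n := by simpa using h
    rw [← List.map_take, List.take_range, min_eq_left hi.le, ofList_range_map]
    simp only [List.getElem_map, List.getElem_range]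
    exact (quotSmulTopEquiv (initIdeal x i)).isSMulRegular_congr _
  constructor
  · intro h j hj
    have hj' : j < ((List.range n).map x).length := by simpa using hj
    exact (key j hj').mp (h.regular_mod_prev j hj')
  · intro h
    exact ⟨fun i hi => (key i hi).mpr (h i (by simpa using hi))⟩

/-- `(R/x_{<i}) / x_i = R/x_{≤ i}`. -/
noncomputable def quotInitSucc (x : ℕ → A) (i : ℕ) :
    QuotSMulTop (x i) (A ⧸ initIdeal x i) ≃ₗ[A] A ⧸ initIdeal x (i + 1) :=
  (Submodule.quotEquivOfEq _ _ (by
      rw [← Submodule.ideal_span_singleton_smul]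
      have : (⊤ : Submodule A (A ⧸ initIdeal x i)) = Submodule.map (initIdeal x i).mkQ ⊤ := by
        simp
      rw [this, ← Submodule.map_smul'', initIdeal_succ, Submodule.map_sup]
      simp)).trans
    (Submodule.quotientQuotientEquivQuotient (initIdeal x i) (initIdeal x (i + 1))
      (initIdeal_mono x (Nat.le_succ i)))

variable [IsLocalRing A]

lemma DepthGE.congr {t : ℕ} {M N : Type u} [AddCommGroup M] [Module A M] [AddCommGroup N]
    [Module A N] (e : M ≃ₗ[A] N) (h : DepthGE A t M) : DepthGE A t N := by
  obtain ⟨rs, h1, h2, h3⟩ := h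
  exact ⟨rs, h1, h2, (e.isWeaklyRegular_congr rs).mp h3⟩

/-- A Cohen–Macaulay local ring of dimension `n`. -/
structure CMLoc (A : Type u) [CommRing A] [IsLocalRing A] (n : ℕ) : Prop where
  noeth : IsNoetherianRing A
  depth : DepthGE A n A
  dim : ringKrullDim A = n

lemma CMLoc.height {n : ℕ} (hA : CMLoc A n) : (maximalIdeal A).height = n := by
  have h := IsLocalRing.maximalIdeal_height_eq_ringKrullDim (R := A)
  rw [hA.dim] at h
  exact_mod_cast h

lemma CMLoc.params_aux {n : ℕ} (hA : CMLoc A n) {w : ℕ → A} (hw : ∀ j < n, w j ∈ maximalIdeal A)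
    (hrad : maximalIdeal A ≤ (initIdeal w n).radical) (i : ℕ) (hi : i ≤ n) :
    DepthGE A (n - i) (A ⧸ initIdeal w i) ∧
      ∀ j < i, IsSMulRegular (A ⧸ initIdeal w j) (w j) := by
  have := hA.noeth
  induction i with
  | zero =>
    refine ⟨hA.depth.congr ?_, by simp⟩
    exact (Submodule.quotEquivOfEqBot _ (initIdeal_zero w)).symm
  | succ i ih =>
    obtain ⟨h1, h2⟩ := ih (by omega)
    have hreg : IsSMulRegular (A ⧸ initIdeal w i) (w i) := by
      refine isSMulRegular_of_forall_assP fun P hP hwP => ?_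
      obtain ⟨-, hdim⟩ := DepthGE.height_and_dim h1 hP
      have hPp := hP.1
      have hle : initIdeal w i ≤ P := fun a ha => by
        obtain ⟨v, hv⟩ := hP.2
        rw [hv]
        obtain ⟨b, rfl⟩ := Ideal.Quotient.mk_surjective v
        exact Ideal.Quotient.eq_zero_iff_mem.mpr (Ideal.mul_mem_right b _ ha)
      have : IsLocalRing (A ⧸ P) := isLocalRing_quotient hPp.ne_top
      let y : ℕ → A ⧸ P := fun j => Ideal.Quotient.mk P (w (i + 1 + j))
      have hb : ringKrullDim (A ⧸ P) ≤ (n - (i + 1) : ℕ) := by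
        refine ringKrullDim_le_of_maximalIdeal_le_radical (x := y) (fun j hj => ?_) ?_
        · rw [maximalIdeal_quotient]
          exact Ideal.mem_map_of_mem _ (hw _ (by omega))
        · rw [maximalIdeal_quotient]
          refine (Ideal.map_mono hrad).trans ((Ideal.map_radical_le _).trans ?_)
          refine Ideal.radical_mono ?_
          rw [initIdeal_map, initIdeal_le_iff]
          intro j hj
          rcases lt_trichotomy j i with h | rfl | h
          · rw [Ideal.Quotient.eq_zero_iff_mem.mpr (hle (mem_initIdeal h))]
            exact zero_mem _
          · rw [Ideal.Quotient.eq_zero_iff_mem.mpr hwP]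
            exact zero_mem _
          · have := mem_initIdeal (x := y) (i := n - (i + 1)) (j := j - (i + 1)) (by omega)
            simpa [y, show i + 1 + (j - (i + 1)) = j by omega] using this
      have h3 := hdim.trans hb
      have h4 : n - i ≤ n - (i + 1) := by exact_mod_cast h3
      omega
    have := Ideal.Quotient.nontrivial_iff.mpr
      (initIdeal_ne_top (x := w) (i := i) fun j hj => hw j (by omega))
    have h3 : n - i = n - (i + 1) + 1 := by omega
    rw [h3] at h1
    refine ⟨(h1.quotSMulTop (hw i (by omega)) hreg).congr (quotInitSucc w i), fun j hj => ?_⟩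
    rcases Nat.lt_succ_iff_lt_or_eq.mp hj with h | rfl
    exacts [h2 j h, hreg]

lemma CMLoc.isWeaklyRegular {n : ℕ} (hA : CMLoc A n) {w : ℕ → A}
    (hw : ∀ j < n, w j ∈ maximalIdeal A)
    (hrad : maximalIdeal A ≤ (initIdeal w n).radical) :
    IsWeaklyRegular A ((List.range n).map w) :=
  isWeaklyRegular_range_iff.mpr (hA.params_aux hw hrad n le_rfl).2

/-- Associated primes of parameter quotients of a Cohen–Macaulay ring. -/
lemma CMLoc.assP {n : ℕ} (hA : CMLoc A n) {w : ℕ → A} (hw : ∀ j < n, w j ∈ maximalIdeal A)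
    (hrad : maximalIdeal A ≤ (initIdeal w n).radical) {i : ℕ} (hi : i ≤ n) {P : Ideal A}
    (hP : AssP P (A ⧸ initIdeal w i)) :
    P.height ≤ i ∧ ((n - i : ℕ) : WithBot ℕ∞) ≤ ringKrullDim (A ⧸ P) := by
  have := hA.noeth
  obtain ⟨h1, h2⟩ := DepthGE.height_and_dim (hA.params_aux hw hrad i hi).1 hP
  refine ⟨?_, h2⟩
  rw [hA.height] at h1
  generalize P.height = e at *
  induction e using ENat.recTopCoe with
  | top => simp at h1
  | coe e =>
    have : e + (n - i) ≤ n := by exact_mod_cast h1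
    exact_mod_cast (by omega : e ≤ i)

end FullParameters

section RegularDomain

open CategoryTheory Abelian Limits RingTheory.Sequence
open scoped Pointwise

lemma mem_initIdeal_iff {R : Type u} [CommRing R] {y : ℕ → R} {n : ℕ} {b : R} :
    b ∈ initIdeal y n ↔ ∃ a : ℕ → R, b = ∑ j ∈ Finset.range n, a j * y j := by
  constructor
  · induction n generalizing b with
    | zero => intro h; exact ⟨0, by simpa [initIdeal_zero] using h⟩
    | succ n ih =>
      rw [initIdeal_succ]
      intro h
      obtain ⟨u, hu, v, hv, rfl⟩ := Submodule.mem_sup.mp h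
      obtain ⟨a, rfl⟩ := ih hu
      obtain ⟨c, rfl⟩ := Ideal.mem_span_singleton'.mp hv
      refine ⟨Function.update a n c, ?_⟩
      rw [Finset.sum_range_succ, Function.update_self]
      congr 1
      refine Finset.sum_congr rfl fun j hj => ?_
      rw [Function.update_of_ne (Finset.mem_range.mp hj).ne]
  · rintro ⟨a, rfl⟩
    exact sum_mem fun j hj => Ideal.mul_mem_left _ _ (mem_initIdeal (Finset.mem_range.mp hj))

lemma RegLoc.swap {R : Type u} [CommRing R] [IsLocalRing R] {n : ℕ} {y : ℕ → R}
    (hy : initIdeal y (n + 1) = maximalIdeal R) {b : R} (hb : b ∈ maximalIdeal R)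
    (hb2 : b ∉ maximalIdeal R ^ 2) :
    ∃ y' : ℕ → R, initIdeal y' (n + 1) = maximalIdeal R ∧ y' 0 = b := by
  obtain ⟨a, ha⟩ := mem_initIdeal_iff.mp (hy ▸ hb)
  obtain ⟨i, hi, hu⟩ : ∃ i < n + 1, IsUnit (a i) := by
    by_contra! hcon
    refine hb2 (ha ▸ Ideal.sum_mem _ fun j hj => ?_)
    rw [pow_two]
    exact Ideal.mul_mem_mul (hcon j (by simpa using hj))
      (hy ▸ mem_initIdeal (by simpa using hj))
  let y' : ℕ → R := Function.update (y ∘ Equiv.swap 0 i) 0 b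
  have hy'0 : y' 0 = b := by simp [y']
  have hmem : ∀ j < n + 1, j ≠ i → y j ∈ initIdeal y' (n + 1) := by
    intro j hj hji
    by_cases hj0 : j = 0
    · have hi0 : i ≠ 0 := fun h => hji (hj0.trans h.symm)
      have := mem_initIdeal (x := y') hi
      simpa [y', Function.update_of_ne hi0, hj0] using this
    · have := mem_initIdeal (x := y') hj
      simpa [y', Function.update_of_ne hj0, Equiv.swap_apply_of_ne_of_ne hj0 hji] using this
  refine ⟨y', le_antisymm ?_ ?_, hy'0⟩
  · rw [initIdeal_le_iff]
    intro j hj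
    by_cases hj0 : j = 0
    · rw [hj0, hy'0]; exact hb
    · rw [← hy]
      simp only [y', Function.update_of_ne hj0, Function.comp]
      by_cases hji : j = i
      · rw [hji, Equiv.swap_apply_right]; exact mem_initIdeal (by omega)
      · rw [Equiv.swap_apply_of_ne_of_ne hj0 hji]; exact mem_initIdeal hj
  · rw [← hy, initIdeal_le_iff]
    intro j hj
    by_cases hji : j = i
    · subst hji
      have h1 : a j * y j = b - ∑ l ∈ (Finset.range (n + 1)).erase j, a l * y l := by
        rw [ha, ← Finset.add_sum_erase _ _ (Finset.mem_range.mpr hj)]; ring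
      have h2 : a j * y j ∈ initIdeal y' (n + 1) := by
        rw [h1]
        refine sub_mem (hy'0 ▸ mem_initIdeal (by omega)) (sum_mem fun l hl => ?_)
        rw [Finset.mem_erase, Finset.mem_range] at hl
        exact Ideal.mul_mem_left _ _ (hmem l hl.2 hl.1)
      exact (Ideal.unit_mul_mem_iff_mem _ hu).mp h2
    · exact hmem j hj hji

lemma RegLoc.height {R : Type u} [CommRing R] [IsLocalRing R] {n : ℕ} (hR : RegLoc R n) :
    (maximalIdeal R).height = n := by
  have h := IsLocalRing.maximalIdeal_height_eq_ringKrullDim (R := R)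
  rw [hR.dim] at h
  exact_mod_cast h

lemma RegLoc.isDomain {n : ℕ} : ∀ {R : Type u} [CommRing R] [IsLocalRing R], RegLoc R n →
    IsDomain R := by
  induction n with
  | zero =>
    intro R _ _ hR
    obtain ⟨y, hy⟩ := hR.gen
    rw [initIdeal_zero] at hy
    have : (⊥ : Ideal R).IsMaximal := hy ▸ maximalIdeal.isMaximal R
    have := this.isPrime
    exact IsDomain.of_bot_isPrime R
  | succ n ih =>
    intro R _ _ hR
    have := hR.noeth
    obtain ⟨y, hy⟩ := hR.gen
    have hnb : maximalIdeal R ≠ ⊥ := fun h => by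
      have := hR.height
      rw [h, Ideal.height_bot] at this
      exact_mod_cast this
    obtain ⟨b, hb, hb2, hbP⟩ : ∃ b ∈ maximalIdeal R, b ∉ maximalIdeal R ^ 2 ∧
        ∀ P ∈ minimalPrimes R, b ∉ P := by
      have hfin : (minimalPrimes R).Finite := minimalPrimes.finite_of_isNoetherianRing R
      by_contra! hcon
      have := (Ideal.subset_union_prime (s := insert (maximalIdeal R ^ 2) hfin.toFinset)
        (f := id) (maximalIdeal R ^ 2) (maximalIdeal R ^ 2) (fun P hP h _ => ?_)
        (I := maximalIdeal R)).mp (fun b hb => ?_)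
      · obtain ⟨P, hP, hle⟩ := this
        rw [Finset.mem_insert] at hP
        rcases hP with rfl | hP
        · rw [id, pow_two] at hle
          exact hnb (Submodule.eq_bot_of_le_smul_of_le_jacobson_bot _ _
            (IsNoetherian.noetherian _) hle (IsLocalRing.maximalIdeal_le_jacobson _))
        · have hPm : P ∈ minimalPrimes R := by simpa using hP
          have hPp : P.IsPrime := hPm.1.1
          have h1 : maximalIdeal R = P := le_antisymm hle (le_maximalIdeal hPp.ne_top)
          have h2 := hR.height
          rw [h1, Ideal.height_eq_zero_iff.mpr hPm] at h2
          exact_mod_cast h2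
      · rw [Finset.mem_insert] at hP
        rcases hP with hP | hP
        · exact absurd hP h
        · have hPm : P ∈ minimalPrimes R := by simpa using hP
          exact hPm.1.1
      · by_cases h2 : b ∈ maximalIdeal R ^ 2
        · exact Set.mem_biUnion (Finset.mem_coe.mpr (Finset.mem_insert_self _ _)) h2
        · obtain ⟨P, hP, hbP⟩ := hcon b hb h2
          exact Set.mem_biUnion (Finset.mem_coe.mpr (Finset.mem_insert_of_mem
            (by simpa using hP))) hbP
    obtain ⟨y', hy', h0⟩ := RegLoc.swap hy hb hb2
    have h1 : initIdeal y' 1 = Ideal.span {b} := by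
      rw [initIdeal_succ, initIdeal_zero, h0, bot_sup_eq]
    have hloc : IsLocalRing (R ⧸ initIdeal y' 1) := isLocalRing_quotient (initIdeal_ne_top
      fun j hj => hy' ▸ mem_initIdeal (by omega))
    have hdom := ih (hR.quotient hy' (show 1 ≤ n + 1 by omega))
    have hprime : (initIdeal y' 1).IsPrime := (Ideal.Quotient.isDomain_iff_prime _).mp hdom
    rw [h1] at hprime
    obtain ⟨P, hP, hle⟩ := Ideal.exists_minimalPrimes_le (bot_le (a := Ideal.span {b}))
    have hPp : P.IsPrime := hP.1.1
    have hPb : P = ⊥ := by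
      refine Submodule.eq_bot_of_le_smul_of_le_jacobson_bot (maximalIdeal R) P
        (IsNoetherian.noetherian _) (fun p hp => ?_) (IsLocalRing.maximalIdeal_le_jacobson _)
      obtain ⟨a, rfl⟩ := Ideal.mem_span_singleton.mp (hle hp)
      have ha : a ∈ P := (hPp.mem_or_mem hp).resolve_left (hbP P hP)
      exact Submodule.smul_mem_smul hb ha
    have : (⊥ : Ideal R).IsPrime := hPb ▸ hPp
    exact IsDomain.of_bot_isPrime R

lemma RegLoc.isSMulRegular {R : Type u} [CommRing R] [IsLocalRing R] {n : ℕ} (hR : RegLoc R n)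
    {y : ℕ → R} (hy : initIdeal y n = maximalIdeal R) {i : ℕ} (hi : i < n) :
    IsSMulRegular (R ⧸ initIdeal y i) (y i) := by
  have hne : ∀ i ≤ n, initIdeal y i ≠ ⊤ := fun i hi => initIdeal_ne_top
      fun j hj => hy ▸ mem_initIdeal (by omega)
  have h1 : IsLocalRing (R ⧸ initIdeal y i) := isLocalRing_quotient (hne i hi.le)
  have h2 : IsLocalRing (R ⧸ initIdeal y (i + 1)) := isLocalRing_quotient (hne (i + 1) hi)
  have hq1 := hR.quotient hy hi.le
  have hq2 := hR.quotient hy (show i + 1 ≤ n from hi)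
  have hdom := hq1.isDomain
  have hyi : y i ∉ initIdeal y i := fun h => by
    have heq : initIdeal y (i + 1) = initIdeal y i := by
      rw [initIdeal_succ, sup_eq_left, Ideal.span_singleton_le_iff_mem]; exact h
    have h3 := hq2.dim
    rw [heq, hq1.dim] at h3
    have : n - i = n - (i + 1) := by exact_mod_cast h3
    omega
  rw [isSMulRegular_iff_right_eq_zero_of_smul]
  intro v hv
  obtain ⟨b, rfl⟩ := Ideal.Quotient.mk_surjective v
  have hm : Ideal.Quotient.mk (initIdeal y i) (y i) * Ideal.Quotient.mk (initIdeal y i) b = 0 := hv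
  exact (mul_eq_zero.mp hm).resolve_left fun h => hyi (Ideal.Quotient.eq_zero_iff_mem.mp h)

lemma RegLoc.cmLoc {R : Type u} [CommRing R] [IsLocalRing R] {n : ℕ} (hR : RegLoc R n) :
    CMLoc R n := by
  obtain ⟨y, hy⟩ := hR.gen
  refine ⟨hR.noeth, ⟨(List.range n).map y, by simp, ?_, ?_⟩, hR.dim⟩
  · intro r hr
    obtain ⟨j, hj, rfl⟩ := List.mem_map.mp hr
    exact hy ▸ mem_initIdeal (by simpa using hj)
  · exact isWeaklyRegular_range_iff.mpr fun j hj => hR.isSMulRegular hy hj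

end RegularDomain

section HeightAvoidance

open CategoryTheory Abelian Limits RingTheory.Sequence
open scoped Pointwise

variable {A : Type u} [CommRing A]

lemma le_height_iff {I : Ideal A} {h : ℕ∞} :
    h ≤ I.height ↔ ∀ P : Ideal A, P.IsPrime → I ≤ P → h ≤ P.height := by
  constructor
  · exact fun H P _ hle => H.trans (Ideal.height_mono hle)
  · intro H
    rw [Ideal.height_eq_inf_minimalPrimes]
    exact le_iInf₂ fun P hP => H P hP.1.1 hP.1.2

lemma add_one_le_height_sup {I : Ideal A} {h : ℕ∞} (hI : h ≤ I.height) {b : A}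
    (hb : ∀ P ∈ I.minimalPrimes, b ∉ P) : h + 1 ≤ (I ⊔ Ideal.span {b}).height := by
  rw [le_height_iff]
  intro Q hQ hle
  obtain ⟨P, hP, hPQ⟩ := Ideal.exists_minimalPrimes_le (le_sup_left.trans hle)
  have hPp : P.IsPrime := hP.1.1
  have hlt : P < Q := lt_of_le_of_ne hPQ fun h => hb P hP (h ▸ hle
    (Ideal.mem_sup_right (Ideal.mem_span_singleton_self b)))
  calc h + 1 ≤ P.height + 1 := by gcongr; exact le_height_iff.mp hI P hPp hP.1.2
    _ ≤ Q.height := Ideal.height_add_one_le_of_lt_of_isPrime hlt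

lemma mem_of_assP_quotient {I P : Ideal A} (hP : AssP P (A ⧸ I)) : I ≤ P := fun a ha => by
  obtain ⟨v, hv⟩ := hP.2
  rw [hv]
  obtain ⟨b, rfl⟩ := Ideal.Quotient.mk_surjective v
  exact Ideal.Quotient.eq_zero_iff_mem.mpr (Ideal.mul_mem_right b _ ha)

variable [IsNoetherianRing A]

lemma assP_of_mem_minimalPrimes {I P : Ideal A} (hP : P ∈ I.minimalPrimes) : AssP P (A ⧸ I) := by
  refine assP_iff.mpr (Module.associatedPrimes.minimalPrimes_annihilator_subset_associatedPrimes A (A ⧸ I) ?_)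
  rwa [Ideal.annihilator_quotient]

lemma exists_add_one_le_height {w : ℕ → A} {h : ℕ} (hw : (h : ℕ∞) ≤ (initIdeal w h).height)
    {𝔟 : Ideal A} (hb : ((h + 1 : ℕ) : ℕ∞) ≤ 𝔟.height) :
    ∃ b ∈ 𝔟, ∀ w' : ℕ → A, (∀ j < h, w' j = w j) → w' h = b →
      ((h + 1 : ℕ) : ℕ∞) ≤ (initIdeal w' (h + 1)).height := by
  have hfin : (initIdeal w h).minimalPrimes.Finite := Ideal.finite_minimalPrimes_of_isNoetherianRing A _
  obtain ⟨b, hb, hbP⟩ : ∃ b ∈ 𝔟, ∀ P ∈ (initIdeal w h).minimalPrimes, b ∉ P := by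
    by_contra! hcon
    obtain ⟨P, hP, hle⟩ := (Ideal.subset_union_prime (s := hfin.toFinset) (f := id) ⊥ ⊥
      (fun P hP _ _ => ((Set.Finite.mem_toFinset _).mp hP).1.1) (I := 𝔟)).mp fun b hb => by
        obtain ⟨P, hP, hbP⟩ := hcon b hb
        exact Set.mem_biUnion (by simpa using hP) hbP
    have hP' : P ∈ (initIdeal w h).minimalPrimes := by simpa using hP
    have h1 := (hb.trans (Ideal.height_mono hle)).trans (height_le_of_mem_minimalPrimes_initIdeal hP')
    have : h + 1 ≤ h := by exact_mod_cast h1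
    omega
  refine ⟨b, hb, fun w' h1 h2 => ?_⟩
  rw [initIdeal_succ, initIdeal_congr h1, h2]
  exact_mod_cast add_one_le_height_sup hw hbP

lemma exists_extend_le_height {𝔟 : Ideal A} {h₀ h : ℕ} (hle : h₀ ≤ h) (hb : (h : ℕ∞) ≤ 𝔟.height)
    {w : ℕ → A} (hw : (h₀ : ℕ∞) ≤ (initIdeal w h₀).height) :
    ∃ w' : ℕ → A, (∀ j < h₀, w' j = w j) ∧ (∀ j, h₀ ≤ j → j < h → w' j ∈ 𝔟) ∧
      (h : ℕ∞) ≤ (initIdeal w' h).height := by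
  induction h, hle using Nat.le_induction with
  | base => exact ⟨w, fun _ _ => rfl, fun j h1 h2 => absurd h2 (by omega), hw⟩
  | succ h hle ih =>
    obtain ⟨w', h1, h2, h3⟩ := ih (le_trans (by exact_mod_cast Nat.le_succ h) hb)
    obtain ⟨b, hbb, hH⟩ := exists_add_one_le_height h3 hb
    refine ⟨Function.update w' h b, fun j hj => ?_, fun j hj hj' => ?_,
      hH _ (fun j hj => ?_) ?_⟩
    · rw [Function.update_of_ne (by omega), h1 j hj]
    · by_cases hjh : j = h
      · rw [hjh, Function.update_self]; exact hbb
      · rw [Function.update_of_ne hjh]; exact h2 j hj (by omega)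
    · rw [Function.update_of_ne (by omega)]
    · rw [Function.update_self]

lemma exists_le_height {𝔟 : Ideal A} {h : ℕ} (hb : (h : ℕ∞) ≤ 𝔟.height) :
    ∃ w : ℕ → A, (∀ j < h, w j ∈ 𝔟) ∧ (h : ℕ∞) ≤ (initIdeal w h).height := by
  obtain ⟨w, -, h2, h3⟩ := exists_extend_le_height (Nat.zero_le h) hb (w := fun _ => 0) (by simp)
  exact ⟨w, fun j hj => h2 j (Nat.zero_le j) hj, h3⟩

lemma le_height_of_isSMulRegular {w : ℕ → A} {h : ℕ}
    (hw : ∀ j < h, IsSMulRegular (A ⧸ initIdeal w j) (w j)) : (h : ℕ∞) ≤ (initIdeal w h).height := by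
  induction h with
  | zero => simp
  | succ h ih =>
    rw [initIdeal_succ]
    push_cast
    refine add_one_le_height_sup (ih fun j hj => hw j (by omega)) fun P hP => ?_
    exact (assP_of_mem_minimalPrimes hP).notMem (hw h (by omega))

end HeightAvoidance

section LocalHeights

open CategoryTheory Abelian Limits RingTheory.Sequence
open scoped Pointwise

variable {A : Type u} [CommRing A] [IsLocalRing A]

lemma CMLoc.maximalIdeal_le_radical {n : ℕ} (hA : CMLoc A n) {w : ℕ → A}
    (hw : (n : ℕ∞) ≤ (initIdeal w n).height) :
    maximalIdeal A ≤ (initIdeal w n).radical := by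
  have := hA.noeth
  rw [Ideal.radical_eq_sInf]
  refine le_sInf fun P ⟨hle, hP⟩ => ?_
  have h1 := hw.trans (Ideal.height_mono hle)
  rw [← hA.height] at h1
  by_contra hcon
  have hlt : P < maximalIdeal A := lt_of_le_not_ge (le_maximalIdeal hP.ne_top) hcon
  have h2 := (Ideal.height_add_one_le_of_lt_of_isPrime hlt).trans h1
  have h3 := h1.antisymm (Ideal.height_mono hlt.le)
  rw [← h3, hA.height] at h2
  have : n + 1 ≤ n := by exact_mod_cast h2
  omega

/-- Sequences of the right height extend to full systems of parameters. -/
lemma CMLoc.exists_full {n h : ℕ} (hA : CMLoc A n) {w : ℕ → A} (hh : h ≤ n)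
    (hwm : ∀ j < h, w j ∈ maximalIdeal A) (hw : (h : ℕ∞) ≤ (initIdeal w h).height) :
    ∃ w' : ℕ → A, (∀ j < h, w' j = w j) ∧ (∀ j < n, w' j ∈ maximalIdeal A) ∧
      maximalIdeal A ≤ (initIdeal w' n).radical := by
  have := hA.noeth
  obtain ⟨w', h1, h2, h3⟩ := exists_extend_le_height hh hA.height.ge hw
  refine ⟨w', h1, fun j hj => ?_, hA.maximalIdeal_le_radical h3⟩
  by_cases hjh : j < h
  · rw [h1 j hjh]; exact hwm j hjh
  · exact h2 j (by omega) hj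

lemma CMLoc.le_of_le_height {n h : ℕ} (hA : CMLoc A n) {P : Ideal A} (hP : P ≠ ⊤)
    (hh : (h : ℕ∞) ≤ P.height) : h ≤ n := by
  have := hh.trans (Ideal.height_mono (le_maximalIdeal hP))
  rw [hA.height] at this
  exact_mod_cast this

lemma CMLoc.isWeaklyRegular_of_height {n h : ℕ} (hA : CMLoc A n) {w : ℕ → A}
    (hwm : ∀ j < h, w j ∈ maximalIdeal A) (hw : (h : ℕ∞) ≤ (initIdeal w h).height) :
    ∀ j < h, IsSMulRegular (A ⧸ initIdeal w j) (w j) := by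
  have hh : h ≤ n := hA.le_of_le_height (initIdeal_ne_top hwm) hw
  obtain ⟨w', h1, h2, h3⟩ := hA.exists_full hh hwm hw
  intro j hj
  have := isWeaklyRegular_range_iff.mp (hA.isWeaklyRegular h2 h3) j (by omega)
  rwa [h1 j hj, initIdeal_congr fun i hi => h1 i (by omega)] at this

lemma CMLoc.assP_of_height {n h : ℕ} (hA : CMLoc A n) {w : ℕ → A}
    (hwm : ∀ j < h, w j ∈ maximalIdeal A) (hw : (h : ℕ∞) ≤ (initIdeal w h).height) {P : Ideal A}
    (hP : AssP P (A ⧸ initIdeal w h)) :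
    P.height = h ∧ ((n - h : ℕ) : WithBot ℕ∞) ≤ ringKrullDim (A ⧸ P) := by
  have := hA.noeth
  have hh : h ≤ n := hA.le_of_le_height (initIdeal_ne_top hwm) hw
  obtain ⟨w', h1, h2, h3⟩ := hA.exists_full hh hwm hw
  rw [← initIdeal_congr h1] at hP
  obtain ⟨h4, h5⟩ := hA.assP h2 h3 hh hP
  refine ⟨le_antisymm h4 (hw.trans (Ideal.height_mono ?_)), h5⟩
  rw [← initIdeal_congr h1]
  exact mem_of_assP_quotient hP

/-- `depth (A / P) ≥ …`: a prime of height `h` has coheight at least `n - h`. -/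
lemma CMLoc.le_dim_quotient {n h : ℕ} (hA : CMLoc A n) {P : Ideal A} (hP : P.IsPrime)
    (hh : P.height = h) : ((n - h : ℕ) : WithBot ℕ∞) ≤ ringKrullDim (A ⧸ P) := by
  have := hA.noeth
  obtain ⟨w, h1, h2⟩ := exists_le_height hh.ge
  refine (hA.assP_of_height (fun j hj => le_maximalIdeal hP.ne_top (h1 j hj)) h2
    (assP_of_mem_minimalPrimes ?_)).2
  have hle : initIdeal w h ≤ P := initIdeal_le_iff.mpr h1
  exact Ideal.mem_minimalPrimes_of_height_le hle (hh ▸ h2)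

lemma CMLoc.localization {n h : ℕ} (hA : CMLoc A n) (P : Ideal A) [hP : P.IsPrime]
    (hh : P.height = h) : CMLoc (Localization.AtPrime P) h := by
  have := hA.noeth
  obtain ⟨w, h1, h2⟩ := exists_le_height hh.ge
  have hreg := isWeaklyRegular_range_iff.mpr
    (hA.isWeaklyRegular_of_height (fun j hj => le_maximalIdeal hP.ne_top (h1 j hj)) h2)
  refine ⟨inferInstance, ⟨((List.range h).map w).map (algebraMap A (Localization.AtPrime P)),
    by simp, ?_, ?_⟩, ?_⟩
  · intro r hr
    obtain ⟨a, ha, rfl⟩ := List.mem_map.mp hr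
    obtain ⟨j, hj, rfl⟩ := List.mem_map.mp ha
    exact (IsLocalization.AtPrime.to_map_mem_maximal_iff _ P _).mpr (h1 j (by simpa using hj))
  · exact hreg.of_isLocalization (Localization.AtPrime P) P.primeCompl
  · rw [IsLocalization.AtPrime.ringKrullDim_eq_height P, hh]; rfl

end LocalHeights

section FlatExt

open CategoryTheory Abelian Limits RingTheory.Sequence
open scoped Pointwise

variable {A : Type u} [CommRing A]

lemma isWeaklyRegular_of_flat (M : Type u) [AddCommGroup M] [Module A M] [Module.Flat A M]
    {rs : List A} (h : IsWeaklyRegular A rs) : IsWeaklyRegular M rs :=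
  ((TensorProduct.rid A M).isWeaklyRegular_congr rs).mp (h.isWeaklyRegular_lTensor)

lemma ext_subsingleton_of_subsingleton {N M : ModuleCat.{u} A} [Subsingleton M] (j : ℕ) :
    Subsingleton (Ext N M j) := by
  have hz : IsZero M := ModuleCat.isZero_of_subsingleton M
  have h0 : ∀ a : Ext N M j, a = 0 := fun a => by
    rw [← a.comp_mk₀_id, hz.eq_of_src (𝟙 M) 0, Ext.mk₀_zero, Ext.comp_zero]
  exact ⟨fun a b => (h0 a).trans (h0 b).symm⟩

lemma subsingleton_ext_of_isWeaklyRegular [IsLocalRing A] [IsNoetherianRing A] {x : ℕ → A} {i : ℕ}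
    (hx : ∀ j < i, x j ∈ maximalIdeal A) (hr : IsWeaklyRegular A ((List.range i).map x))
    (M : ModuleCat.{u} A) [Module.Flat A M] [Module.Finite A M] {j : ℕ} (hj : j < i) :
    Subsingleton (Ext (ModuleCat.of A (A ⧸ initIdeal x i)) M j) := by
  rcases subsingleton_or_nontrivial M with h | h
  · exact ext_subsingleton_of_subsingleton j
  have hmem : ∀ r ∈ (List.range i).map x, r ∈ initIdeal x i := by
    intro r hr
    obtain ⟨j, hj, rfl⟩ := List.mem_map.mp hr
    exact mem_initIdeal (List.mem_range.mp hj)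
  have hle : initIdeal x i ≤ maximalIdeal A := initIdeal_le_iff.mpr hx
  have hsupp : Module.support A (ModuleCat.of A (A ⧸ initIdeal x i)) =
      PrimeSpectrum.zeroLocus (initIdeal x i : Set A) := by
    rw [Module.support_eq_zeroLocus]
    congr 2
    exact Ideal.annihilator_quotient
  refine ModuleCat.subsingleton_ext_of_exists_isRegular (initIdeal x i) _ hsupp.le M
    (lt_of_le_of_lt (Submodule.smul_mono_left hle) maximalIdeal_smul_top_lt)
    ((List.range i).map x) hmem
    (isRegular_of_isWeaklyRegular (fun r hr => hle (hmem r hr)) (isWeaklyRegular_of_flat M hr)) j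
    (by simpa using hj)

end FlatExt

section Frobenius

open CategoryTheory Abelian Limits RingTheory.Sequence
open scoped Pointwise

variable {Q : Type u} [CommRing Q] [IsLocalRing Q] [IsNoetherianRing Q]

theorem matrix_chase {b : ℕ → ℕ} {D : ∀ l, Matrix (Fin (b l)) (Fin (b (l + 1))) Q}
    (dd : ∀ l, D l * D (l + 1) = 0) {r : ℕ} {x : ℕ → Q} (hr : x r = 1)
    (hxm : ∀ i < r, x i ∈ maximalIdeal Q)
    (hreg : IsWeaklyRegular Q ((List.range r).map x))
    {H : ∀ m (_ : ℕ), Matrix (Fin (b (m + 2))) (Fin (b (m + 1))) Q}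
    {G : ∀ m (_ : ℕ), Matrix (Fin (b (m + 1))) (Fin (b m)) Q}
    (hom : ∀ m < r, ∀ i ≤ m + 1, x i • (1 : Matrix (Fin (b (m + 1))) (Fin (b (m + 1))) Q) =
      D (m + 1) * H m i + G m i * D m)
    (v : Fin (b 0) → Q) (u : Fin (b 1) → Q) (hv : x 0 • v = (D 0).mulVec u) :
    ∃ u', v = (D 0).mulVec u' := by
  have hreg' : ∀ i ≤ r, IsWeaklyRegular Q ((List.range i).map x) := by
    intro i hi
    rw [isWeaklyRegular_range_iff] at hreg ⊢
    exact fun j hj => hreg j (by omega)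
  have hom' : ∀ m < r, ∀ i ≤ m + 1, ∃ (h : (Fin (b (m + 1)) → Q) →ₗ[Q] (Fin (b (m + 2)) → Q))
      (g : (Fin (b m) → Q) →ₗ[Q] (Fin (b (m + 1)) → Q)),
      ∀ w, x i • w = (D (m + 1)).mulVecLin (h w) + g ((D m).mulVecLin w) := by
    intro m hm i hi
    refine ⟨(H m i).mulVecLin, (G m i).mulVecLin, fun w => ?_⟩
    simp only [Matrix.mulVecLin_apply]
    rw [Matrix.mulVec_mulVec, Matrix.mulVec_mulVec, ← Matrix.add_mulVec, ← hom m hm i hi,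
      Matrix.smul_mulVec, Matrix.one_mulVec]
  obtain ⟨u', hu'⟩ := mem_range_of_smul_mem_range (B := Q) (r := r) (x := x)
    (C := fun l => ModuleCat.of Q (Fin (b l) → Q)) (d := fun l => (D l).mulVecLin)
    (fun l => by rw [← Matrix.mulVecLin_mul, dd, Matrix.mulVecLin_zero]) hr hom'
    (fun m i hi j hj => subsingleton_ext_of_isWeaklyRegular (fun j hj => hxm j (by omega))
      (hreg' i hi) (ModuleCat.of Q (Fin (b m) → Q)) hj) v ⟨u, hv.symm⟩
  exact ⟨u', hu'.symm⟩

theorem frobenius_contradiction (p : ℕ) [Fact p.Prime] [CharP Q p]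
    {b : ℕ → ℕ} {D : ∀ l, Matrix (Fin (b l)) (Fin (b (l + 1))) Q}
    (dd : ∀ l, D l * D (l + 1) = 0) {r : ℕ} {x : ℕ → Q} (hr : x r = 1)
    (hxm : ∀ i < r, x i ∈ maximalIdeal Q)
    (hreg : ∀ q, 0 < q → IsWeaklyRegular Q ((List.range r).map fun j => x j ^ q))
    {H : ∀ m (_ : ℕ), Matrix (Fin (b (m + 2))) (Fin (b (m + 1))) Q}
    {G : ∀ m (_ : ℕ), Matrix (Fin (b (m + 1))) (Fin (b m)) Q}
    (hom : ∀ m < r, ∀ i ≤ m + 1, x i • (1 : Matrix (Fin (b (m + 1))) (Fin (b (m + 1))) Q) =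
      D (m + 1) * H m i + G m i * D m)
    {ζ e : Fin (b 0) → Q} {v : Fin (b 1) → Q} {c : Q} {t : ℕ} {f : Fin t → Q}
    {y : Fin t → Fin (b 0) → Q}
    (hζ : x 0 • ζ = (D 0).mulVec v + ∑ j, f j • y j) (hcf : ∀ j, c * f j = 0)
    (he : e ⬝ᵥ ζ = 1) (heD : ∀ j, Matrix.vecMul e (D 0) j ∈ maximalIdeal Q) : c = 0 := by
  have key : ∀ s : ℕ, c ∈ maximalIdeal Q ^ (p ^ s) := by
    intro s
    set φ : Q →+* Q := iterateFrobenius Q p s with hφ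
    have hφa : ∀ a, φ a = a ^ p ^ s := fun a => iterateFrobenius_def ..
    have hq : 0 < p ^ s := pow_pos (Fact.out : p.Prime).pos s
    obtain ⟨u', hu'⟩ := matrix_chase (D := fun l => (D l).map φ) (r := r) (x := fun j => φ (x j))
      (fun l => by rw [← Matrix.map_mul, dd, Matrix.map_zero _ (map_zero φ)])
      (by rw [hr, map_one])
      (fun i hi => by rw [hφa]; exact Ideal.pow_mem_of_mem _ (hxm i hi) _ hq)
      (by simpa only [hφa] using hreg _ hq)
      (H := fun m i => (H m i).map φ) (G := fun m i => (G m i).map φ)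
      (fun m hm i hi => by
        have := congrArg (fun M => M.map φ) (hom m hm i hi)
        beta_reduce at this
        rw [Matrix.map_add _ (map_add φ), Matrix.map_mul, Matrix.map_mul] at this
        rw [← this]
        ext j k
        simp [Matrix.one_apply, apply_ite φ])
      (c • fun j => φ (ζ j)) (c • fun j => φ (v j)) (by
        have h1 : ∀ i, φ (x 0) * φ (ζ i) = ((D 0).map φ).mulVec (fun j => φ (v j)) i +
            ∑ j, φ (f j) * φ (y j i) := by
          intro i
          have := congrArg φ (congrFun hζ i)
          simpa [Matrix.mulVec, dotProduct, Finset.sum_apply] using this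
        have h2 : ∀ j, c * φ (f j) = 0 := by
          intro j
          rw [hφa, ← Nat.succ_pred_eq_of_pos hq, pow_succ', ← mul_assoc, hcf, zero_mul]
        rw [Matrix.mulVec_smul]
        ext i
        simp only [Pi.smul_apply, smul_eq_mul]
        rw [mul_left_comm, h1, mul_add, Finset.mul_sum, Finset.sum_eq_zero, add_zero]
        intro j _
        rw [← mul_assoc, h2, zero_mul])
    have h3 : (fun j => φ (e j)) ⬝ᵥ (c • fun j => φ (ζ j)) = c := by
      rw [dotProduct_smul]
      have : (fun j => φ (e j)) ⬝ᵥ (fun j => φ (ζ j)) = 1 := by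
        have := congrArg φ he
        simpa [dotProduct] using this
      rw [this, smul_eq_mul, mul_one]
    rw [hu', Matrix.dotProduct_mulVec] at h3
    rw [← h3]
    refine Ideal.sum_mem _ fun j _ => Ideal.mul_mem_right _ _ ?_
    have : Matrix.vecMul (fun j => φ (e j)) ((D 0).map φ) j = φ (Matrix.vecMul e (D 0) j) := by
      simp [Matrix.vecMul, dotProduct]
    rw [this, hφa]
    exact Ideal.pow_mem_pow (heD j) _
  have h0 : c ∈ (⨅ i : ℕ, maximalIdeal Q ^ i : Ideal Q) := by
    rw [Ideal.mem_iInf]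
    intro i
    exact Ideal.pow_le_pow_right (Nat.lt_pow_self (Fact.out : p.Prime).one_lt).le (key i)
  rwa [Ideal.iInf_pow_eq_bot_of_isLocalRing _ (IsLocalRing.maximalIdeal.isMaximal Q).ne_top] at h0

end Frobenius

section Neg

open CategoryTheory Abelian Limits RingTheory.Sequence
open scoped Pointwise

/-- The matrix data carried by a complex of finite free modules with chosen null-homotopies, a
vector `ζ` in the bottom degree which a multiple of `x 0` moves into the image of the differential
up to multiples of the `f j`, and a functional `e` with `e ζ = 1`. -/
structure ChaseData (A : Type u) [CommRing A] (r : ℕ) (b : ℕ → ℕ) (t : ℕ) where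
  D : ∀ l, Matrix (Fin (b l)) (Fin (b (l + 1))) A
  x : ℕ → A
  H : ∀ m (_ : ℕ), Matrix (Fin (b (m + 2))) (Fin (b (m + 1))) A
  G : ∀ m (_ : ℕ), Matrix (Fin (b (m + 1))) (Fin (b m)) A
  ζ : Fin (b 0) → A
  e : Fin (b 0) → A
  v : Fin (b 1) → A
  f : Fin t → A
  y : Fin t → Fin (b 0) → A
  dd : ∀ l < r, D l * D (l + 1) = 0
  xr : x r = 1
  hom : ∀ m < r, ∀ i ≤ m + 1, x i • (1 : Matrix (Fin (b (m + 1))) (Fin (b (m + 1))) A) =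
      D (m + 1) * H m i + G m i * D m
  rel : x 0 • ζ = (D 0).mulVec v + ∑ j, f j • y j
  eζ : e ⬝ᵥ ζ = 1

namespace ChaseData

variable {A B : Type u} [CommRing A] [CommRing B] {r : ℕ} {b : ℕ → ℕ} {t : ℕ}

@[simps]
def map (N : ChaseData A r b t) (φ : A →+* B) : ChaseData B r b t where
  D l := (N.D l).map φ
  x i := φ (N.x i)
  H m i := (N.H m i).map φ
  G m i := (N.G m i).map φ
  ζ i := φ (N.ζ i)
  e i := φ (N.e i)
  v i := φ (N.v i)
  f j := φ (N.f j)
  y j i := φ (N.y j i)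
  dd l hl := by rw [← Matrix.map_mul, N.dd l hl, Matrix.map_zero _ (map_zero φ)]
  xr := by rw [N.xr, map_one]
  hom m hm i hi := by
    have := congrArg (fun M => M.map φ) (N.hom m hm i hi)
    beta_reduce at this
    rw [Matrix.map_add _ (map_add φ), Matrix.map_mul, Matrix.map_mul] at this
    rw [← this]
    ext j k
    simp [Matrix.one_apply, apply_ite φ]
  rel := by
    ext i
    have := congrArg φ (congrFun N.rel i)
    simpa [Matrix.mulVec, dotProduct, Finset.sum_apply] using this
  eζ := by
    have := congrArg φ N.eζ
    simpa [dotProduct] using this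

lemma vecMul_map (N : ChaseData A r b t) (φ : A →+* B) (j : Fin (b 1)) :
    Matrix.vecMul (N.map φ).e ((N.map φ).D 0) j = φ (Matrix.vecMul N.e (N.D 0) j) := by
  simp [Matrix.vecMul, dotProduct]

theorem eq_zero_of_charP {Q : Type u} [CommRing Q] [IsLocalRing Q] [IsNoetherianRing Q] (p : ℕ)
    [Fact p.Prime] [CharP Q p] (N : ChaseData Q r b t)
    (hxm : ∀ i < r, N.x i ∈ maximalIdeal Q)
    (hreg : ∀ q, 0 < q → IsWeaklyRegular Q ((List.range r).map fun j => N.x j ^ q))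
    {c : Q} (hcf : ∀ j, c * N.f j = 0)
    (heD : ∀ j, Matrix.vecMul N.e (N.D 0) j ∈ maximalIdeal Q) : c = 0 := by
  have dd : ∀ l, (if l ≤ r then N.D l else 0) * (if l + 1 ≤ r then N.D (l + 1) else 0) = 0 := by
    intro l
    split_ifs with h1 h2 h2
    · exact N.dd l h2
    · exact Matrix.mul_zero _
    · exact Matrix.zero_mul _
    · exact Matrix.mul_zero _
  refine frobenius_contradiction p dd N.xr hxm hreg (H := N.H) (G := N.G) ?_ (ζ := N.ζ) (e := N.e)
    (v := N.v) (f := N.f) (y := N.y) ?_ hcf N.eζ ?_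
  · intro m hm i hi
    rw [if_pos (by omega), if_pos (by omega)]
    exact N.hom m hm i hi
  · rw [if_pos (Nat.zero_le r)]
    exact N.rel
  · rw [if_pos (Nat.zero_le r)]
    exact heD

theorem mem_initIdeal [IsLocalRing A] {n h : ℕ} (hn : h + r = n) (hA : CMLoc A n) {s : ℕ → A}
    (hsm : ∀ j < n, s j ∈ maximalIdeal A) (hrad : maximalIdeal A ≤ (initIdeal s n).radical)
    (p : ℕ) (hpp : p.Prime) (hp : (p : A) ∈ initIdeal s h) (N : ChaseData A r b t)
    (hx : ∀ i < r, N.x i = s (h + i))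
    {c : A} (hcf : ∀ j, c * N.f j ∈ initIdeal s h)
    (heD : ∀ j, Matrix.vecMul N.e (N.D 0) j ∈ maximalIdeal A) : c ∈ initIdeal s h := by
  have := hA.noeth
  have := Fact.mk hpp
  have hsub : initIdeal s h ≤ maximalIdeal A := initIdeal_le_iff.mpr fun j hj => hsm j (by omega)
  have hne : initIdeal s h ≠ ⊤ := fun h => (maximalIdeal.isMaximal A).ne_top (top_le_iff.mp (h ▸ hsub))
  have hloc : IsLocalRing (A ⧸ initIdeal s h) := isLocalRing_quotient hne
  have hchar : CharP (A ⧸ initIdeal s h) p := by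
    refine (CharP.charP_iff_prime_eq_zero hpp).2 ?_
    rw [← map_natCast (Ideal.Quotient.mk (initIdeal s h))]
    exact Ideal.Quotient.eq_zero_iff_mem.mpr hp
  have hmk : ∀ a ∈ maximalIdeal A, Ideal.Quotient.mk (initIdeal s h) a ∈
      maximalIdeal (A ⧸ initIdeal s h) := fun a ha => by
    rw [maximalIdeal_quotient]; exact Ideal.mem_map_of_mem _ ha
  refine Ideal.Quotient.eq_zero_iff_mem.mp
    (eq_zero_of_charP p (N.map (Ideal.Quotient.mk (initIdeal s h))) ?_ ?_ ?_ ?_)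
  · intro i hi
    rw [map_x, hx i hi]
    exact hmk _ (hsm _ (by omega))
  · intro q hq
    set s' : ℕ → A := fun j => if j < h then s j else s j ^ q with hs'
    have h1 : initIdeal s' h = initIdeal s h := initIdeal_congr fun j hj => if_pos hj
    have h2 : IsWeaklyRegular A ((List.range n).map s') := by
      refine hA.isWeaklyRegular (fun j hj => ?_) (hrad.trans ?_)
      · simp only [hs']
        split_ifs
        · exact hsm j hj
        · exact Ideal.pow_mem_of_mem _ (hsm j hj) _ hq
      · rw [Ideal.radical_le_radical_iff, initIdeal_le_iff]
        intro j hj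
        have : s' j ∈ initIdeal s' n := _root_.mem_initIdeal hj
        simp only [hs'] at this
        split_ifs at this
        · exact Ideal.le_radical this
        · exact ⟨q, this⟩
    rw [← hn, List.range_add, List.map_append, isWeaklyRegular_append_iff] at h2
    have h3 := ((Submodule.quotEquivOfEq _ (initIdeal s h) (by
      rw [ofList_range_map, h1, smul_eq_mul, Ideal.mul_top])).isWeaklyRegular_congr _).mp h2.2
    have h4 := (isWeaklyRegular_map_algebraMap_iff (A ⧸ initIdeal s h) (A ⧸ initIdeal s h) _).mpr h3
    have h5 : ((List.range r).map fun j => (N.map (Ideal.Quotient.mk (initIdeal s h))).x j ^ q) =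
        List.map (algebraMap A (A ⧸ initIdeal s h))
          (List.map s' (List.map (fun x => h + x) (List.range r))) := by
      rw [List.map_map, List.map_map]
      refine List.map_congr_left fun i hi => ?_
      have hi' := List.mem_range.mp hi
      simp [hs', hx i hi']
    rw [h5]
    exact h4
  · intro j
    rw [map_f, ← map_mul]
    exact Ideal.Quotient.eq_zero_iff_mem.mpr (hcf j)
  · intro j
    rw [vecMul_map]
    exact hmk _ (heD j)

end ChaseData

end Neg

section Newton

open Polynomial

variable {B : Type u} [CommRing B] [HenselianLocalRing B]

lemma exists_root_linear_add {c : B} (hc : c ∈ maximalIdeal B) (n : ℕ) (p : ℕ → B) :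
    ∃ u : B, c + c * u + ∑ i ∈ Finset.range n, p i * (c * u) ^ (i + 2) = 0 := by
  set g : B[X] := ∑ i ∈ Finset.range n, C (c ^ (i + 1) * p i) * X ^ (n - i) with hg
  have hgm : ∀ a, g.eval a ∈ maximalIdeal B := fun a => by
    rw [hg, eval_finsetSum]
    refine Ideal.sum_mem _ fun i _ => ?_
    rw [eval_C_mul, pow_succ', mul_assoc, mul_assoc]
    exact Ideal.mul_mem_right _ _ hc
  have hgm' : ∀ a, (derivative g).eval a ∈ maximalIdeal B := fun a => by
    rw [hg, derivative_sum, eval_finsetSum]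
    refine Ideal.sum_mem _ fun i _ => ?_
    rw [derivative_C_mul, eval_C_mul, pow_succ', mul_assoc, mul_assoc]
    exact Ideal.mul_mem_right _ _ hc
  have hgd : (X ^ (n + 1) + g).degree < ((n + 2 : ℕ) : WithBot ℕ) := by
    refine (degree_add_le _ _).trans_lt (max_lt ?_ ?_)
    · refine (degree_X_pow_le _).trans_lt (by exact_mod_cast Nat.lt_succ_self _)
    · refine (degree_sum_le _ _).trans_lt ((Finset.sup_lt_iff (by exact_mod_cast WithBot.bot_lt_coe _)).mpr ?_)
      intro i _
      refine (degree_C_mul_X_pow_le _ _).trans_lt (by exact_mod_cast (by omega : n - i < n + 2))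
  obtain ⟨v, hv, hv1⟩ := HenselianLocalRing.is_henselian (X ^ (n + 2) + (X ^ (n + 1) + g))
    (monic_X_pow_add hgd) (-1) (by
      rw [eval_add, eval_add, eval_pow, eval_pow, eval_X, ← add_assoc]
      refine Ideal.add_mem _ ?_ (hgm _)
      rw [pow_succ]; simp) (by
      have h1 : (derivative (X ^ (n + 2) + (X ^ (n + 1) + g))).eval (-1) =
          (-1) ^ (n + 1) + (derivative g).eval (-1) := by
        simp only [derivative_add, derivative_X_pow, eval_add, eval_mul, eval_pow, eval_X, eval_C]
        push_cast
        ring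
      rw [h1]
      by_contra hu
      have h2 := Ideal.sub_mem _ ((mem_maximalIdeal _).mpr hu) (hgm' (-1))
      rw [add_sub_cancel_right] at h2
      exact (mem_maximalIdeal _).mp h2 ((isUnit_one.neg).pow _))
  have hvu : IsUnit v := by
    by_contra hu
    have h2 := Ideal.sub_mem _ ((mem_maximalIdeal _).mpr hu) hv1
    exact (mem_maximalIdeal _).mp h2 (by simp)
  obtain ⟨u, hu⟩ := hvu.exists_right_inv
  refine ⟨u, ?_⟩
  rw [IsRoot.def, eval_add, eval_add, eval_pow, eval_pow, eval_X, hg, eval_finsetSum] at hv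
  have key : ∀ i ∈ Finset.range n, p i * (c * u) ^ (i + 2) =
      c * u ^ (n + 2) * (eval v (C (c ^ (i + 1) * p i) * X ^ (n - i))) := by
    intro i hi
    have hi' : i < n := Finset.mem_range.mp hi
    rw [eval_C_mul, eval_pow, eval_X, show n + 2 = (i + 2) + (n - i) by omega, pow_add]
    have : u ^ (n - i) * v ^ (n - i) = 1 := by rw [← mul_pow, mul_comm u, hu, one_pow]
    linear_combination (-(p i * c ^ (i + 2) * u ^ (i + 2))) * this
  rw [Finset.sum_congr rfl key, ← Finset.mul_sum]
  have h1 : u ^ (n + 2) * v ^ (n + 2) = 1 := by rw [← mul_pow, mul_comm u, hu, one_pow]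
  have h2 : u ^ (n + 1) * v ^ (n + 1) = 1 := by rw [← mul_pow, mul_comm u, hu, one_pow]
  linear_combination (c * u ^ (n + 2)) * hv - c * h1 - c * u * h2

lemma exists_root_of_sq_dvd {F : B[X]} {η c : B} (hc : c ∈ maximalIdeal B)
    (hF : F.eval η = (derivative F).eval η ^ 2 * c) :
    ∃ w, c ∣ w ∧ F.eval (η + (derivative F).eval η * w) = 0 := by
  set g := (derivative F).eval η with hg
  obtain ⟨u, hu⟩ := exists_root_linear_add hc F.natDegree
    (fun i => (taylor η F).coeff (i + 2) * g ^ i)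
  refine ⟨c * u, dvd_mul_right _ _, ?_⟩
  have h1 : F.eval (η + g * (c * u)) = (taylor η F).eval (g * (c * u)) := by
    rw [taylor_eval, add_comm]
  have hdeg : (taylor η F).natDegree < F.natDegree + 2 := by rw [natDegree_taylor]; omega
  rw [h1, eval_eq_sum_range' hdeg, Finset.sum_range_succ', Finset.sum_range_succ', taylor_coeff_zero,
    taylor_coeff_one, hF, ← hg]
  have : ∀ i ∈ Finset.range F.natDegree, (taylor η F).coeff (i + 1 + 1) * (g * (c * u)) ^ (i + 1 + 1) =
      g ^ 2 * ((taylor η F).coeff (i + 2) * g ^ i * (c * u) ^ (i + 2)) := by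
    intro i _; ring
  rw [Finset.sum_congr rfl this, ← Finset.mul_sum]
  linear_combination g ^ 2 * hu

end Newton

section Lifting

open Polynomial

lemma exists_pseudo_division {A : Type*} [CommRing A] (F : A[X]) (hF : 0 < F.natDegree) (P : A[X]) :
    ∃ (k : ℕ) (Q S : A[X]), C (F.leadingCoeff ^ k) * P = F * Q + S ∧ S.natDegree < F.natDegree := by
  induction h : P.natDegree using Nat.strong_induction_on generalizing P with
  | _ m ih =>
    by_cases hm : m < F.natDegree
    · exact ⟨0, 0, P, by simp, h ▸ hm⟩
    push Not at hm
    set P₁ := C F.leadingCoeff * P - F * (C P.leadingCoeff * X ^ (m - F.natDegree)) with hP₁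
    have hle : P₁.natDegree ≤ m := by
      refine (natDegree_sub_le _ _).trans (max_le ?_ ?_)
      · exact (natDegree_C_mul_le _ _).trans h.le
      · refine natDegree_mul_le.trans ?_
        have := natDegree_C_mul_X_pow_le P.leadingCoeff (m - F.natDegree)
        omega
    have hco : P₁.coeff m = 0 := by
      rw [hP₁, coeff_sub, coeff_C_mul, ← mul_assoc, coeff_mul_X_pow', if_pos (by omega),
        Nat.sub_sub_self hm, coeff_mul_C, ← h]
      simp only [coeff_natDegree]
      ring
    have hlt : P₁.natDegree < m := by
      refine lt_of_le_of_ne hle fun he => ?_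
      rw [← he, coeff_natDegree, leadingCoeff_eq_zero] at hco
      rw [hco, natDegree_zero] at he
      omega
    obtain ⟨k, Q, S, h1, h2⟩ := ih _ hlt P₁ rfl
    refine ⟨k + 1, Q + C (F.leadingCoeff ^ k) * (C P.leadingCoeff * X ^ (m - F.natDegree)), S, ?_, h2⟩
    rw [mul_add, add_right_comm, ← h1, hP₁, pow_succ, C_mul]
    ring

lemma aeval_eq_eval₂_finSuccEquiv {A : Type*} [CommRing A] {N : ℕ} (y : Fin (N + 1) → A)
    (P : MvPolynomial (Fin (N + 1)) ℤ) :
    MvPolynomial.aeval y P = (MvPolynomial.finSuccEquiv ℤ N P).eval₂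
      (MvPolynomial.aeval (fun i => y i.succ) : MvPolynomial (Fin N) ℤ →ₐ[ℤ] A).toRingHom (y 0) := by
  have : (MvPolynomial.aeval y : MvPolynomial (Fin (N + 1)) ℤ →ₐ[ℤ] A).toRingHom =
      (eval₂RingHom (MvPolynomial.aeval (fun i => y i.succ) :
        MvPolynomial (Fin N) ℤ →ₐ[ℤ] A).toRingHom (y 0)).comp
        (MvPolynomial.finSuccEquiv ℤ N).toAlgHom.toRingHom := by
    refine MvPolynomial.ringHom_ext' (RingHom.ext_int _ _) fun i => ?_
    refine Fin.cases ?_ (fun i => ?_) i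
    · simp [MvPolynomial.finSuccEquiv_X_zero]
    · simp [MvPolynomial.finSuccEquiv_X_succ]
  exact RingHom.congr_fun this P

lemma dvd_aeval_sub_aeval {A : Type*} [CommRing A] {σ : Type*} {u v : σ → A} {a : A}
    (h : ∀ i, a ∣ u i - v i) (P : MvPolynomial σ ℤ) :
    a ∣ MvPolynomial.aeval u P - MvPolynomial.aeval v P := by
  have key : ∀ w : σ → A, Ideal.Quotient.mk (Ideal.span {a}) (MvPolynomial.aeval w P) =
      MvPolynomial.aeval (fun i => Ideal.Quotient.mk (Ideal.span {a}) (w i)) P := by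
    intro w
    induction P using MvPolynomial.induction_on with
    | C r => simp
    | add p q hp hq => simp only [map_add, hp, hq]
    | mul_X p i hp => simp only [map_mul, hp, MvPolynomial.aeval_X]
  rw [← Ideal.mem_span_singleton, ← Ideal.Quotient.eq, key, key]
  congr 2
  funext i
  rw [Ideal.Quotient.eq, Ideal.mem_span_singleton]
  exact h i

lemma exists_eq_mul_of_sq_dvd {B : Type*} [CommRing B] [IsLocalRing B] {a g b : B}
    (ha : a ∈ maximalIdeal B) (h : a ^ 2 ∣ a - g * b) : g ∣ a := by
  obtain ⟨s, hs⟩ := h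
  have hu : IsUnit (1 - a * s) := by
    by_contra hu
    have h2 := Ideal.add_mem _ ((mem_maximalIdeal _).mpr hu) (Ideal.mul_mem_right s _ ha)
    rw [sub_add_cancel] at h2
    exact (mem_maximalIdeal _).mp h2 isUnit_one
  have : g ∣ a * (1 - a * s) := ⟨b, by linear_combination hs⟩
  exact hu.dvd_mul_right.mp this

theorem exists_lifting {R : Type u} [CommRing R] [IsDomain R] [CharZero R] (N : ℕ) (y : Fin N → R) :
    ∃ 𝒢 𝒟 : Finset (MvPolynomial (Fin N) ℤ), (∀ G ∈ 𝒢, MvPolynomial.aeval y G = 0) ∧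
      (∀ d ∈ 𝒟, MvPolynomial.aeval y d ≠ 0) ∧
      ∀ (B : Type u) [CommRing B] [HenselianLocalRing B] [IsDomain B] (a : B),
        a ∈ maximalIdeal B → a ≠ 0 → ∀ e, 2 ≤ e → ∀ η : Fin N → B,
        (∀ G ∈ 𝒢, a ^ (e + 2 * N) ∣ MvPolynomial.aeval η G) →
        (∀ d ∈ 𝒟, ∃ b, a ^ 2 ∣ a - MvPolynomial.aeval η d * b) →
        ∃ y' : Fin N → B, (∀ i, a ^ e ∣ y' i - η i) ∧
          ∀ P : MvPolynomial (Fin N) ℤ, MvPolynomial.aeval y P = 0 → MvPolynomial.aeval y' P = 0 := by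
  classical
  induction N with
  | zero =>
    refine ⟨∅, ∅, by simp, by simp, fun B _ _ _ a _ _ e _ η _ _ => ⟨η, fun i => i.elim0, fun P hP => ?_⟩⟩
    obtain ⟨m, rfl⟩ := MvPolynomial.C_surjective (Fin 0) P
    rw [MvPolynomial.aeval_C] at hP ⊢
    simp only [algebraMap_int_eq, eq_intCast, Int.cast_eq_zero] at hP
    simp [hP]
  | succ N ih =>
    obtain ⟨𝒢, 𝒟, hG, hD, hlift⟩ := ih (fun i => y i.succ)
    set φ : MvPolynomial (Fin N) ℤ →+* R := (MvPolynomial.aeval (fun i => y i.succ) :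
        MvPolynomial (Fin N) ℤ →ₐ[ℤ] R).toRingHom with hφ
    have hren : ∀ {A : Type u} [CommRing A] (z : Fin (N + 1) → A) (P : MvPolynomial (Fin N) ℤ),
        MvPolynomial.aeval z (MvPolynomial.rename Fin.succ P) =
          MvPolynomial.aeval (fun i => z i.succ) P := fun z P => by
      rw [MvPolynomial.aeval_rename]; rfl
    have hsymm : ∀ {A : Type u} [CommRing A] (z : Fin (N + 1) → A) (F : (MvPolynomial (Fin N) ℤ)[X]),
        MvPolynomial.aeval z ((MvPolynomial.finSuccEquiv ℤ N).symm F) = F.eval₂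
          (MvPolynomial.aeval (fun i => z i.succ) :
            MvPolynomial (Fin N) ℤ →ₐ[ℤ] A).toRingHom (z 0) := fun z F => by
      rw [aeval_eq_eval₂_finSuccEquiv, AlgEquiv.apply_symm_apply]
    by_cases htr : ∀ F : (MvPolynomial (Fin N) ℤ)[X], F.eval₂ φ (y 0) = 0 → ∀ i, φ (F.coeff i) = 0
    · refine ⟨𝒢.image (MvPolynomial.rename Fin.succ), 𝒟.image (MvPolynomial.rename Fin.succ),
        ?_, ?_, fun B _ _ _ a ha ha0 e he η hηG hηD => ?_⟩
      · simp only [Finset.forall_mem_image, hren]; exact hG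
      · simp only [Finset.forall_mem_image, hren]; exact hD
      · simp only [Finset.forall_mem_image, hren] at hηG hηD
        obtain ⟨z, hz1, hz2⟩ := hlift B a ha ha0 e he (fun i => η i.succ)
          (fun G hG => (pow_dvd_pow a (by omega)).trans (hηG hG)) (fun d hd => hηD hd)
        refine ⟨Fin.cons (η 0) z, fun i => ?_, fun P hP => ?_⟩
        · refine Fin.cases ?_ (fun i => ?_) i
          · simp
          · simpa using hz1 i
        · rw [aeval_eq_eval₂_finSuccEquiv] at hP ⊢
          have := htr _ hP
          rw [eval₂_eq_sum_range]
          refine Finset.sum_eq_zero fun i _ => ?_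
          have h3 := hz2 _ (this i)
          simp only [Fin.cons_succ, Fin.cons_zero]
          exact mul_eq_zero_of_left h3 _
    · have hex : ∃ m, ∃ F : (MvPolynomial (Fin N) ℤ)[X], F.natDegree = m ∧ F.eval₂ φ (y 0) = 0 ∧
          ∃ i, φ (F.coeff i) ≠ 0 := by
        push Not at htr
        obtain ⟨F, h1, h2⟩ := htr
        exact ⟨_, F, rfl, h1, h2⟩
      obtain ⟨F, hFm, hF0, i₀, hi₀⟩ := Nat.find_spec hex
      have hmin : ∀ S : (MvPolynomial (Fin N) ℤ)[X], S.natDegree < F.natDegree →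
          S.eval₂ φ (y 0) = 0 → ∀ i, φ (S.coeff i) = 0 := by
        intro S hS h0
        by_contra! hcon
        exact Nat.find_min hex (hFm ▸ hS) ⟨S, rfl, h0, hcon⟩
      have hlead : φ F.leadingCoeff ≠ 0 := by
        intro hl
        have h1 : F.eraseLead.eval₂ φ (y 0) = 0 := by
          have := congrArg (eval₂ φ (y 0)) F.eraseLead_add_C_mul_X_pow
          rw [eval₂_add, hF0, eval₂_mul, eval₂_C, hl, zero_mul, add_zero] at this
          exact this
        have h2 : ∀ i, φ (F.eraseLead.coeff i) = 0 := by
          rcases F.eraseLead_natDegree_lt_or_eraseLead_eq_zero with h | h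
          · exact hmin _ h h1
          · intro i; rw [h, coeff_zero, map_zero]
        apply hi₀
        by_cases hi : i₀ = F.natDegree
        · rw [hi]; exact hl
        · rw [← eraseLead_coeff_of_ne i₀ hi]; exact h2 i₀
      have hpos : 0 < F.natDegree := by
        by_contra h
        have h0 : F.natDegree = 0 := by omega
        rw [eq_C_of_natDegree_eq_zero h0, eval₂_C] at hF0
        rw [leadingCoeff, h0] at hlead
        exact hlead hF0
      have hder : (derivative F).eval₂ φ (y 0) ≠ 0 := by
        intro h
        have := hmin _ (natDegree_derivative_lt hpos.ne') h (F.natDegree - 1)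
        rw [coeff_derivative, map_mul, Nat.sub_add_cancel hpos] at this
        rcases mul_eq_zero.mp this with h | h
        · exact hlead h
        · have h' : ((F.natDegree : ℕ) : R) = 0 := by
            rw [← h, ← Nat.cast_succ, Nat.succ_eq_add_one, Nat.sub_add_cancel hpos, map_natCast]
          exact hpos.ne' (Nat.cast_eq_zero.mp h')
      refine ⟨insert ((MvPolynomial.finSuccEquiv ℤ N).symm F) (𝒢.image (MvPolynomial.rename Fin.succ)),
        insert ((MvPolynomial.finSuccEquiv ℤ N).symm (derivative F))
          (insert (MvPolynomial.rename Fin.succ F.leadingCoeff)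
            (𝒟.image (MvPolynomial.rename Fin.succ))),
        ?_, ?_, fun B _ _ _ a ha ha0 e he η hηG hηD => ?_⟩
      · simp only [Finset.forall_mem_insert, Finset.forall_mem_image, hren, hsymm]
        exact ⟨hF0, hG⟩
      · simp only [Finset.forall_mem_insert, Finset.forall_mem_image, hren, hsymm]
        exact ⟨hder, hlead, hD⟩
      · simp only [Finset.forall_mem_insert, Finset.forall_mem_image, hren] at hηG hηD
        obtain ⟨hηF, hηG⟩ := hηG
        obtain ⟨⟨b₁, hb₁⟩, ⟨b₂, hb₂⟩, hηD⟩ := hηD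
        obtain ⟨z, hz1, hz2⟩ := hlift B a ha ha0 (e + 2) (by omega) (fun i => η i.succ)
          (fun G hG => (pow_dvd_pow a (by omega)).trans (hηG hG)) (fun d hd => hηD hd)
        set ψ : MvPolynomial (Fin N) ℤ →+* B := (MvPolynomial.aeval z :
          MvPolynomial (Fin N) ℤ →ₐ[ℤ] B).toRingHom with hψ
        have hcong : ∀ P : (MvPolynomial (Fin N) ℤ)[X], a ^ (e + 2) ∣ P.eval₂ ψ (η 0) -
            MvPolynomial.aeval η ((MvPolynomial.finSuccEquiv ℤ N).symm P) := by
          intro P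
          have := dvd_aeval_sub_aeval (u := Fin.cons (η 0) z) (v := η) (a := a ^ (e + 2)) (fun i => by
            refine Fin.cases ?_ (fun i => ?_) i
            · simp
            · simpa using hz1 i) ((MvPolynomial.finSuccEquiv ℤ N).symm P)
          rw [hsymm] at this
          simp only [Fin.cons_succ, Fin.cons_zero] at this
          exact this
        have hsq : a ^ 2 ∣ a ^ (e + 2) := pow_dvd_pow a (by omega)
        set g := (derivative (F.map ψ)).eval (η 0) with hg
        have hg' : g = (derivative F).eval₂ ψ (η 0) := by
          rw [hg, derivative_map, eval_map]
        have hga : g ∣ a := by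
          refine exists_eq_mul_of_sq_dvd ha (b := b₁) ?_
          have h1 := (hsq.trans (hcong (derivative F))).mul_right b₁
          rw [← hg'] at h1
          have h2 := dvd_sub hb₁ h1
          convert h2 using 1
          ring
        have hℓ : ψ F.leadingCoeff ≠ 0 := by
          intro h0
          have h1 := dvd_aeval_sub_aeval hz1 F.leadingCoeff
          have h2 : ψ F.leadingCoeff ∣ a := by
            refine exists_eq_mul_of_sq_dvd ha (b := b₂) ?_
            have h3 := dvd_sub hb₂ ((hsq.trans h1).mul_right b₂)
            convert h3 using 1
            change _ = a - _ - (ψ _ - _) * _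
            ring
          rw [h0, zero_dvd_iff] at h2
          exact ha0 h2
        obtain ⟨β, hβ⟩ := hga
        obtain ⟨q, hq⟩ : a ^ (e + 2) ∣ (F.map ψ).eval (η 0) := by
          rw [eval_map]
          have h1 := dvd_add (hcong F) ((pow_dvd_pow a (by omega)).trans hηF)
          rwa [sub_add_cancel] at h1
        obtain ⟨w, hw, hroot⟩ := exists_root_of_sq_dvd (F := F.map ψ) (η := η 0)
          (c := a ^ e * (β ^ 2 * q))
          (Ideal.mul_mem_right _ _ (Ideal.pow_mem_of_mem _ ha _ (by omega))) (by
            rw [hq, ← hg, pow_add]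
            linear_combination (a ^ e * q * (a + g * β)) * hβ)
        rw [← hg] at hroot
        refine ⟨Fin.cons (η 0 + g * w) z, fun i => ?_, fun P hP => ?_⟩
        · refine Fin.cases ?_ (fun i => ?_) i
          · simp only [Fin.cons_zero, add_sub_cancel_left]
            exact ((dvd_mul_right _ _).trans hw).mul_left g
          · simp only [Fin.cons_succ]
            exact (pow_dvd_pow a (by omega)).trans (hz1 i)
        · rw [aeval_eq_eval₂_finSuccEquiv] at hP ⊢
          simp only [Fin.cons_succ, Fin.cons_zero]
          change eval₂ ψ _ _ = 0
          change eval₂ φ _ _ = 0 at hP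
          set P₁ := MvPolynomial.finSuccEquiv ℤ N P
          obtain ⟨k, Q, S, h1, h2⟩ := exists_pseudo_division F hpos P₁
          have h3 : S.eval₂ φ (y 0) = 0 := by
            have := congrArg (eval₂ φ (y 0)) h1
            rw [eval₂_mul, hP, mul_zero, eval₂_add, eval₂_mul, hF0, zero_mul, zero_add] at this
            exact this.symm
          have h4 : S.eval₂ ψ (η 0 + g * w) = 0 := by
            rw [eval₂_eq_sum_range]
            refine Finset.sum_eq_zero fun i _ => ?_
            exact mul_eq_zero_of_left (hz2 _ (hmin S h2 h3 i)) _
          have h5 := congrArg (eval₂ ψ (η 0 + g * w)) h1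
          rw [eval₂_mul, eval₂_add, eval₂_mul, h4, ← eval_map (p := F), hroot, zero_mul, zero_add,
            eval₂_C, map_pow] at h5
          exact (mul_eq_zero.mp h5).resolve_left (pow_ne_zero _ hℓ)

end Lifting

section PowerSeriesLocal

open PowerSeries

variable {A : Type u} [CommRing A] [IsLocalRing A]

lemma PowerSeries.mem_maximalIdeal_iff {g : A⟦X⟧} :
    g ∈ maximalIdeal A⟦X⟧ ↔ constantCoeff g ∈ maximalIdeal A := by
  rw [mem_maximalIdeal, mem_maximalIdeal, mem_nonunits_iff, mem_nonunits_iff,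
    PowerSeries.isUnit_iff_constantCoeff]

lemma PowerSeries.coeff_mem_of_mem_maximalIdeal_pow {N : ℕ} {g : A⟦X⟧}
    (hg : g ∈ maximalIdeal A⟦X⟧ ^ N) (j : ℕ) : coeff j g ∈ maximalIdeal A ^ (N - j) := by
  induction N generalizing g j with
  | zero => simp
  | succ N ih =>
    rw [pow_succ] at hg
    refine Submodule.mul_induction_on hg (fun a ha b hb => ?_) (fun a b ha hb => ?_)
    · rw [coeff_mul]
      refine Ideal.sum_mem _ fun q hq => ?_
      rw [Finset.HasAntidiagonal.mem_antidiagonal] at hq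
      have h1 := ih ha q.1
      rcases Nat.eq_zero_or_pos q.2 with h0 | h0
      · have hb' : coeff q.2 b ∈ maximalIdeal A := by
          rw [h0, coeff_zero_eq_constantCoeff_apply]
          exact PowerSeries.mem_maximalIdeal_iff.mp hb
        have := Ideal.mul_mem_mul h1 hb'
        rw [← pow_succ] at this
        exact Ideal.pow_le_pow_right (by omega) this
      · exact Ideal.mul_mem_right _ _ (Ideal.pow_le_pow_right (by omega) h1)
    · rw [map_add]
      exact add_mem ha hb

lemma PowerSeries.C_mem_maximalIdeal_pow {N : ℕ} {a : A} (ha : a ∈ maximalIdeal A ^ N) :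
    C a ∈ maximalIdeal A⟦X⟧ ^ N := by
  have h : (maximalIdeal A).map (C : A →+* A⟦X⟧) ≤ maximalIdeal A⟦X⟧ := by
    rw [Ideal.map_le_iff_le_comap]
    intro b hb
    rw [Ideal.mem_comap, PowerSeries.mem_maximalIdeal_iff]
    simpa using hb
  have := Ideal.mem_map_of_mem (C : A →+* A⟦X⟧) ha
  rw [Ideal.map_pow] at this
  exact Ideal.pow_right_mono h N this

lemma PowerSeries.X_mem_maximalIdeal : (X : A⟦X⟧) ∈ maximalIdeal A⟦X⟧ := by
  rw [PowerSeries.mem_maximalIdeal_iff]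
  simp

lemma PowerSeries.mem_maximalIdeal_pow {N : ℕ} {g : A⟦X⟧}
    (h : ∀ j < N, coeff j g ∈ maximalIdeal A ^ (N - j)) : g ∈ maximalIdeal A⟦X⟧ ^ N := by
  induction N generalizing g with
  | zero => simp
  | succ N ih =>
    have hg := eq_X_mul_shift_add_const g
    rw [hg]
    refine add_mem ?_ (C_mem_maximalIdeal_pow ?_)
    · rw [pow_succ']
      refine Ideal.mul_mem_mul X_mem_maximalIdeal (ih fun j hj => ?_)
      rw [coeff_mk]
      have := h (j + 1) (by omega)
      simpa using this
    · simpa using h 0 (by omega)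

instance PowerSeries.isPrecomplete_maximalIdeal [IsPrecomplete (maximalIdeal A) A] :
    IsPrecomplete (maximalIdeal A⟦X⟧) A⟦X⟧ := by
  refine ⟨fun f hf => ?_⟩
  have key : ∀ j, ∃ L : A, ∀ N, coeff j (f (N + j)) - L ∈ maximalIdeal A ^ N := by
    intro j
    have hp : IsPrecomplete (maximalIdeal A) A := inferInstance
    obtain ⟨L, hL⟩ := hp.prec (f := fun N => coeff j (f (N + j))) (fun {m n} hmn => by
      have := hf (show m + j ≤ n + j by omega)
      rw [SModEq.sub_mem, smul_eq_mul, Ideal.mul_top] at this ⊢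
      have := coeff_mem_of_mem_maximalIdeal_pow this j
      simpa using this)
    refine ⟨L, fun N => ?_⟩
    have := hL N
    rwa [SModEq.sub_mem, smul_eq_mul, Ideal.mul_top] at this
  choose L hL using key
  refine ⟨PowerSeries.mk L, fun N => ?_⟩
  rw [SModEq.sub_mem, smul_eq_mul, Ideal.mul_top]
  refine mem_maximalIdeal_pow fun j hj => ?_
  have := hL j (N - j)
  rw [Nat.sub_add_cancel hj.le] at this
  simpa using this

/-- Parameters of `A⟦X⟧` obtained from parameters of `A` by adjoining `X`. -/
noncomputable def PowerSeries.params (ξ : ℕ → A) (n : ℕ) (i : ℕ) : A⟦X⟧ :=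
  if i < n then C (ξ i) else X

lemma PowerSeries.initIdeal_params {ξ : ℕ → A} {n : ℕ} (h : initIdeal ξ n = maximalIdeal A) :
    initIdeal (PowerSeries.params ξ n) (n + 1) = maximalIdeal A⟦X⟧ := by
  have h1 : initIdeal (PowerSeries.params ξ n) n = (maximalIdeal A).map C := by
    rw [← h, initIdeal_map]
    exact initIdeal_congr fun j hj => by simp [params, hj]
  rw [initIdeal_succ, h1]
  apply le_antisymm
  · rw [sup_le_iff, Ideal.span_singleton_le_iff_mem]
    refine ⟨?_, by simpa [params] using X_mem_maximalIdeal⟩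
    rw [Ideal.map_le_iff_le_comap]
    intro b hb
    simpa using C_mem_maximalIdeal_pow (N := 1) (a := b) (by simpa using hb)
  · intro g hg
    rw [eq_X_mul_shift_add_const g]
    refine add_mem (Ideal.mul_mem_right _ _ (Ideal.mem_sup_right (Ideal.subset_span ?_)))
      (Ideal.mem_sup_left (Ideal.mem_map_of_mem _ (mem_maximalIdeal_iff.mp hg)))
    simp [params]

lemma RegLoc.powerSeries {n : ℕ} (hA : RegLoc A n) : RegLoc A⟦X⟧ (n + 1) := by
  have := hA.noeth
  obtain ⟨ξ, hξ⟩ := hA.gen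
  have h := PowerSeries.initIdeal_params hξ
  refine ⟨inferInstance, ⟨_, h⟩, le_antisymm ?_ ?_⟩
  · exact ringKrullDim_le_of_maximalIdeal_le_radical (fun j hj => h ▸ mem_initIdeal hj)
      (h ▸ Ideal.le_radical)
  · have := ringKrullDim_succ_le_ringKrullDim_powerseries (R := A)
    rw [hA.dim] at this
    exact_mod_cast this

end PowerSeriesLocal

section PowerSeriesEval

open PowerSeries

variable {A R : Type u} [CommRing A] [CommRing R]

lemma Polynomial.eval₂_sub_mem_pow {f : A →+* R} {y : R} {N : ℕ} {P Q : Polynomial A}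
    (h : ∀ i < N, P.coeff i = Q.coeff i) :
    P.eval₂ f y - Q.eval₂ f y ∈ Ideal.span {y} ^ N := by
  rw [← Polynomial.eval₂_sub, Ideal.span_singleton_pow, Ideal.mem_span_singleton]
  have : (Polynomial.X : Polynomial A) ^ N ∣ P - Q := by
    rw [Polynomial.X_pow_dvd_iff]
    intro i hi
    rw [Polynomial.coeff_sub, h i hi, sub_self]
  obtain ⟨q, hq⟩ := this
  rw [hq, Polynomial.eval₂_mul, Polynomial.eval₂_pow, Polynomial.eval₂_X]
  exact dvd_mul_right _ _

lemma PowerSeries.exists_eval [IsLocalRing R] [IsAdicComplete (maximalIdeal R) R] (f : A →+* R)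
    {y : R} (hy : y ∈ maximalIdeal R) :
    ∃ F : A⟦X⟧ →+* R, F X = y ∧ ∀ a, F (C a) = f a := by
  have hle : ∀ N, Ideal.span {y} ^ N ≤ maximalIdeal R ^ N := fun N =>
    Ideal.pow_right_mono ((Ideal.span_singleton_le_iff_mem _).mpr hy) N
  have hmk : ∀ (N : ℕ) {P Q : Polynomial A}, (∀ i < N, P.coeff i = Q.coeff i) →
      Ideal.Quotient.mk (maximalIdeal R ^ N) (P.eval₂ f y) =
        Ideal.Quotient.mk (maximalIdeal R ^ N) (Q.eval₂ f y) := fun N P Q h =>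
    Ideal.Quotient.eq.mpr (hle N (Polynomial.eval₂_sub_mem_pow h))
  let φ : ∀ N : ℕ, A⟦X⟧ →+* R ⧸ maximalIdeal R ^ N := fun N =>
    { toFun := fun g => Ideal.Quotient.mk _ ((trunc N g).eval₂ f y)
      map_one' := by
        rw [hmk N (Q := 1), Polynomial.eval₂_one, map_one]
        intro i hi
        rw [coeff_trunc, if_pos hi, coeff_one, Polynomial.coeff_one]
      map_mul' := fun g h => by
        rw [← map_mul, ← Polynomial.eval₂_mul]
        refine hmk N fun i hi => ?_
        rw [coeff_trunc, if_pos hi, coeff_mul, Polynomial.coeff_mul]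
        refine Finset.sum_congr rfl fun q hq => ?_
        rw [Finset.HasAntidiagonal.mem_antidiagonal] at hq
        rw [coeff_trunc, if_pos (by omega), coeff_trunc, if_pos (by omega)]
      map_zero' := by simp
      map_add' := fun g h => by simp [Polynomial.eval₂_add] }
  have hφ : ∀ N g, φ N g = Ideal.Quotient.mk _ ((trunc N g).eval₂ f y) := fun N g => rfl
  have hcomp : ∀ {m n : ℕ} (hle : m ≤ n),
      (Ideal.Quotient.factorPow (maximalIdeal R) hle).comp (φ n) = φ m := by
    intro m n hmn
    ext g
    rw [RingHom.comp_apply, hφ, hφ, Ideal.Quotient.factor_mk]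
    refine hmk m fun i hi => ?_
    rw [coeff_trunc, if_pos (by omega), coeff_trunc, if_pos hi]
  refine ⟨IsAdicComplete.liftRingHom (maximalIdeal R) φ hcomp, ?_, fun a => ?_⟩
  · rw [IsHausdorff.eq_iff_smodEq (I := maximalIdeal R)]
    intro N
    rw [SModEq.sub_mem, smul_eq_mul, Ideal.mul_top, ← Ideal.Quotient.eq,
      IsAdicComplete.mk_liftRingHom, hφ, hmk N (Q := Polynomial.X), Polynomial.eval₂_X]
    intro i hi
    rw [coeff_trunc, if_pos hi, coeff_X, Polynomial.coeff_X]
    simp [eq_comm]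
  · rw [IsHausdorff.eq_iff_smodEq (I := maximalIdeal R)]
    intro N
    rw [SModEq.sub_mem, smul_eq_mul, Ideal.mul_top, ← Ideal.Quotient.eq,
      IsAdicComplete.mk_liftRingHom, hφ, hmk N (Q := Polynomial.C a), Polynomial.eval₂_C]
    intro i hi
    rw [coeff_trunc, if_pos hi, coeff_C, Polynomial.coeff_C]

end PowerSeriesEval

section CoefficientField

open PowerSeries

/-- `A` is the power series ring in the parameters `ξ 0, …, ξ (n - 1)` over the
coefficient field `k`, up to isomorphism. -/
structure IsPowerSeriesRing (k : Type u) [Field k] (n : ℕ) (A : Type u) [CommRing A]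
    [IsLocalRing A] (ι : k →+* A) (ξ : ℕ → A) : Prop where
  reg : RegLoc A n
  prec : IsPrecomplete (maximalIdeal A) A
  gen : initIdeal ξ n = maximalIdeal A
  res : ∀ a, ∃ c, a - ι c ∈ maximalIdeal A
  lift : ∀ (R : Type u) [CommRing R] [IsLocalRing R] [IsAdicComplete (maximalIdeal R) R]
    (κ : k →+* R) (y : ℕ → R), (∀ j < n, y j ∈ maximalIdeal R) →
      ∃ f : A →+* R, (∀ c, f (ι c) = κ c) ∧ ∀ j < n, f (ξ j) = y j

lemma isPowerSeriesRing_zero (k : Type u) [Field k] (ξ : ℕ → k) :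
    IsPowerSeriesRing k 0 k (RingHom.id k) ξ := by
  have hbot : maximalIdeal k = ⊥ := IsLocalRing.maximalIdeal_eq_bot
  have h0 : initIdeal ξ 0 = maximalIdeal k := by rw [initIdeal_zero, hbot]
  refine ⟨⟨inferInstance, ⟨ξ, h0⟩, ?_⟩, ⟨fun f hf => ⟨f 1, fun n => ?_⟩⟩, h0, fun a => ⟨a, by simp⟩,
    fun R _ _ _ κ y _ => ⟨κ, fun c => rfl, fun j hj => absurd hj (by omega)⟩⟩
  · simp
  · rcases Nat.eq_zero_or_pos n with rfl | hn
    · rw [SModEq.sub_mem]; simp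
    · exact (hf (show 1 ≤ n from hn)).symm.mono (by rw [hbot, Ideal.bot_pow (by simp)]; simp)

lemma IsPowerSeriesRing.succ {k : Type u} [Field k] {n : ℕ} {A : Type u} [CommRing A]
    [IsLocalRing A] {ι : k →+* A} {ξ : ℕ → A} (h : IsPowerSeriesRing k n A ι ξ) :
    IsPowerSeriesRing k (n + 1) A⟦X⟧ ((C : A →+* A⟦X⟧).comp ι) (PowerSeries.params ξ n) := by
  have := h.prec
  refine ⟨h.reg.powerSeries, inferInstance, PowerSeries.initIdeal_params h.gen, fun g => ?_,
    fun R _ _ _ κ y hy => ?_⟩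
  · obtain ⟨c, hc⟩ := h.res (constantCoeff g)
    exact ⟨c, by rw [PowerSeries.mem_maximalIdeal_iff]; simpa using hc⟩
  · obtain ⟨f, hf1, hf2⟩ := h.lift R κ y fun j hj => hy j (by omega)
    obtain ⟨F, hX, hC⟩ := PowerSeries.exists_eval f (hy n (by omega))
    refine ⟨F, fun c => by simp [hC, hf1], fun j hj => ?_⟩
    by_cases hjn : j < n
    · simp [params, hjn, hC, hf2]
    · obtain rfl : j = n := by omega
      simp [params, hX]

lemma exists_isPowerSeriesRing (k : Type u) [Field k] (n : ℕ) :
    ∃ (A : Type u) (_ : CommRing A) (_ : IsLocalRing A) (ι : k →+* A) (ξ : ℕ → A),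
      IsPowerSeriesRing k n A ι ξ := by
  induction n with
  | zero => exact ⟨k, inferInstance, inferInstance, _, 0, isPowerSeriesRing_zero k 0⟩
  | succ n ih =>
    obtain ⟨A, _, _, ι, ξ, h⟩ := ih
    exact ⟨A⟦X⟧, inferInstance, inferInstance, _, _, h.succ⟩

lemma IsPowerSeriesRing.surjective {k : Type u} [Field k] {n : ℕ} {A : Type u} [CommRing A]
    [IsLocalRing A] {ι : k →+* A} {ξ : ℕ → A} (h : IsPowerSeriesRing k n A ι ξ) {R : Type u}
    [CommRing R] [IsLocalRing R] [IsHausdorff (maximalIdeal R) R] {f : A →+* R}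
    (hgen : initIdeal (fun j => f (ξ j)) n = maximalIdeal R)
    (hres : ∀ r, ∃ c, r - f (ι c) ∈ maximalIdeal R) : Function.Surjective f := by
  have hmap : (maximalIdeal A).map f = maximalIdeal R := by
    rw [← h.gen, initIdeal_map, hgen]
  have := h.prec
  have : IsHausdorff ((maximalIdeal A).map f) R := by rw [hmap]; infer_instance
  refine surjective_of_mk_map_comp_surjective (I := maximalIdeal A) f fun r => ?_
  obtain ⟨r, rfl⟩ := Ideal.Quotient.mk_surjective r
  obtain ⟨c, hc⟩ := hres r
  refine ⟨ι c, ?_⟩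
  rw [RingHom.comp_apply, eq_comm, Ideal.Quotient.eq, hmap]
  exact hc

lemma IsPowerSeriesRing.bijective {k : Type u} [Field k] {n : ℕ} {A : Type u} [CommRing A]
    [IsLocalRing A] {ι : k →+* A} {ξ : ℕ → A} (h : IsPowerSeriesRing k n A ι ξ) {R : Type u}
    [CommRing R] [IsLocalRing R] (hR : RegLoc R n) {f : A →+* R}
    (hgen : initIdeal (fun j => f (ξ j)) n = maximalIdeal R)
    (hres : ∀ r, ∃ c, r - f (ι c) ∈ maximalIdeal R) : Function.Bijective f := by
  have := hR.noeth
  have := h.reg.noeth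
  have := h.reg.isDomain
  have hs := h.surjective hgen hres
  refine ⟨(injective_iff_map_eq_zero f).mpr fun a ha => ?_, hs⟩
  by_contra ha0
  have h1 := ringKrullDim_quotient_succ_le_of_nonZeroDivisor (mem_nonZeroDivisors_of_ne_zero ha0)
  have h2 : ringKrullDim R ≤ ringKrullDim (A ⧸ Ideal.span {a}) := by
    refine ringKrullDim_le_of_surjective (Ideal.Quotient.lift (Ideal.span {a}) f ?_)
      (Ideal.Quotient.lift_surjective_of_surjective _ _ hs)
    intro b hb
    obtain ⟨c, rfl⟩ := Ideal.mem_span_singleton.mp hb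
    rw [map_mul, ha, zero_mul]
  rw [h.reg.dim] at h1
  rw [hR.dim] at h2
  have h3 := (add_le_add_left h2 1).trans h1
  have : (n : WithBot ℕ∞) + 1 = ((n + 1 : ℕ) : WithBot ℕ∞) := by push_cast; rfl
  rw [this] at h3
  exact absurd (by exact_mod_cast h3 : n + 1 ≤ n) (by omega)

end CoefficientField

section Completion

open RingTheory.Sequence
open scoped Pointwise

lemma exists_ringHom_rat {R : Type u} [CommRing R] (h : ∀ p : ℕ, p.Prime → IsUnit (p : R)) :
    Nonempty (ℚ →+* R) := by
  have h1 : ∀ m : ℕ, m ≠ 0 → IsUnit (m : R) := by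
    intro m
    induction m using Nat.recOnMul with
    | zero => intro h0; exact absurd rfl h0
    | one => intro; simp
    | prime p hp => intro; exact h p hp
    | mul a b ha hb =>
      intro hab
      rw [mul_ne_zero_iff] at hab
      rw [Nat.cast_mul]
      exact (ha hab.1).mul (hb hab.2)
  refine ⟨IsLocalization.lift (M := nonZeroDivisors ℤ) (g := Int.castRingHom R) fun y => ?_⟩
  have hy := nonZeroDivisors.coe_ne_zero y
  rw [eq_intCast]
  rcases Int.natAbs_eq (y : ℤ) with h' | h' <;> rw [h']
  · simpa using h1 _ (Int.natAbs_ne_zero.mpr hy)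
  · simpa using h1 _ (Int.natAbs_ne_zero.mpr hy)

lemma formallySmooth_rat (L : Type u) [Field L] [Algebra ℚ L] : Algebra.FormallySmooth ℚ L := by
  obtain ⟨s, v, hs⟩ := exists_isTranscendenceBasis' ℚ L
  have := hs.isAlgebraic_field
  have : CharZero L := algebraRat.charZero L
  exact Algebra.FormallySmooth.of_algebraicIndependent_of_isSeparable hs.1

lemma exists_coefficientField {R : Type u} [CommRing R] [IsLocalRing R]
    [IsAdicComplete (maximalIdeal R) R] (h : ∀ p : ℕ, p.Prime → IsUnit (p : R)) :
    ∃ κ : ResidueField R →+* R, ∀ r, ∃ c, r - κ c ∈ maximalIdeal R := by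
  obtain ⟨q⟩ := exists_ringHom_rat h
  let _ : Algebra ℚ R := q.toAlgebra
  have := formallySmooth_rat (ResidueField R)
  obtain ⟨g, hg⟩ := Algebra.FormallySmooth.exists_mkₐ_comp_eq_of_isAdicComplete (R := ℚ)
    (A := ResidueField R) (I := maximalIdeal R) (AlgHom.id ℚ (ResidueField R))
  refine ⟨g.toRingHom, fun r => ⟨residue R r, ?_⟩⟩
  have := DFunLike.congr_fun hg (residue R r)
  rw [← Ideal.Quotient.eq]
  exact this.symm

lemma RegLoc.of_flat {R S : Type u} [CommRing R] [IsLocalRing R] [CommRing S] [IsLocalRing S]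
    [Algebra R S] [Module.Flat R S] [IsNoetherianRing S] {n : ℕ} (hR : RegLoc R n)
    (hm : (maximalIdeal R).map (algebraMap R S) = maximalIdeal S) : RegLoc S n := by
  obtain ⟨y, hy⟩ := hR.gen
  have hgen : initIdeal (fun j => algebraMap R S (y j)) n = maximalIdeal S := by
    rw [← initIdeal_map, hy, hm]
  have h1 : IsWeaklyRegular R ((List.range n).map y) :=
    isWeaklyRegular_range_iff.mpr fun j hj => hR.isSMulRegular hy hj
  have h2 := isWeaklyRegular_of_flat S h1
  rw [← isWeaklyRegular_map_algebraMap_iff S S, List.map_map] at h2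
  have h3 := le_height_of_isSMulRegular (isWeaklyRegular_range_iff.mp h2)
  refine ⟨inferInstance, ⟨_, hgen⟩, le_antisymm ?_ ?_⟩
  · exact ringKrullDim_le_of_maximalIdeal_le_radical (fun j hj => hgen ▸ mem_initIdeal hj)
      (hgen ▸ Ideal.le_radical)
  · rw [← IsLocalRing.maximalIdeal_height_eq_ringKrullDim]
    have h4 : initIdeal (algebraMap R S ∘ y) n = maximalIdeal S := hgen
    rw [h4] at h3
    exact_mod_cast h3

/-- A regular local ring of residue characteristic zero maps to a power series ring over a field
in a way that reflects membership. -/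
lemma RegLoc.exists_completion {R : Type u} [CommRing R] [IsLocalRing R] {n : ℕ}
    (hR : RegLoc R n) (hchar : ∀ p : ℕ, p.Prime → IsUnit (p : R)) {x : ℕ → R}
    (hx : initIdeal x n = maximalIdeal R) :
    ∃ (k : Type u) (_ : Field k) (A : Type u) (_ : CommRing A) (_ : IsLocalRing A) (ι : k →+* A)
      (ξ : ℕ → A) (g : R →+* A), IsPowerSeriesRing k n A ι ξ ∧ (∀ j < n, g (x j) = ξ j) ∧
        ∀ (J : Ideal R) (c : R), g c ∈ J.map g → c ∈ J := by
  have := hR.noeth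
  set S := AdicCompletion (maximalIdeal R) R with hS
  set φ := algebraMap R S with hφ
  have hm : maximalIdeal S = (maximalIdeal R).map φ := AdicCompletion.maximalIdeal_eq_map
  obtain ⟨κ, hκ⟩ := exists_coefficientField (R := S) fun p hp => by
    have := (hchar p hp).map φ
    rwa [map_natCast] at this
  obtain ⟨A, _, _, ι, ξ, hA⟩ := exists_isPowerSeriesRing (ResidueField S) n
  have hgen : initIdeal (fun j => φ (x j)) n = maximalIdeal S := by
    rw [← initIdeal_map, hx, hm]
  obtain ⟨f, hf1, hf2⟩ := hA.lift S κ (fun j => φ (x j)) fun j hj => hgen ▸ mem_initIdeal hj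
  have hgen' : initIdeal (fun j => f (ξ j)) n = maximalIdeal S :=
    (initIdeal_congr hf2).trans hgen
  have hres : ∀ r, ∃ c, r - f (ι c) ∈ maximalIdeal S := fun r => by
    obtain ⟨c, hc⟩ := hκ r
    exact ⟨c, by rwa [hf1]⟩
  have hs := hA.surjective hgen' hres
  have := hA.reg.noeth
  have : IsNoetherianRing S := isNoetherianRing_of_surjective A S f hs
  have hSr : RegLoc S n := hR.of_flat hm.symm
  have hb := hA.bijective hSr hgen' hres
  let e := RingEquiv.ofBijective f hb
  refine ⟨_, inferInstance, A, _, _, ι, ξ, (e.symm : S →+* A).comp φ, hA, fun j hj => ?_,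
    fun J c hc => ?_⟩
  · rw [RingHom.comp_apply, ← hf2 j hj]
    exact e.symm_apply_apply _
  · have h1 : φ c ∈ J.map φ := by
      rw [← Ideal.map_map] at hc
      have := Ideal.mem_map_of_mem (e : A →+* S) hc
      rw [Ideal.map_map] at this
      have h2 : (e : A →+* S).comp (e.symm : S →+* A) = RingHom.id S := by ext; simp
      rw [h2, Ideal.map_id, RingHom.comp_apply] at this
      simpa using this
    have h3 : ∀ N, c ∈ J ⊔ maximalIdeal R ^ N := by
      intro N
      have h4 := Ideal.mem_map_of_mem (AdicCompletion.evalₐ (maximalIdeal R) N).toRingHom h1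
      rw [Ideal.map_map] at h4
      have h5 : (AdicCompletion.evalₐ (maximalIdeal R) N).toRingHom.comp φ =
          Ideal.Quotient.mk (maximalIdeal R ^ N) := by
        ext r
        exact (AdicCompletion.evalₐ (maximalIdeal R) N).commutes r
      have h6 : (AdicCompletion.evalₐ (maximalIdeal R) N).toRingHom (φ c) =
          Ideal.Quotient.mk (maximalIdeal R ^ N) c := RingHom.congr_fun h5 c
      rw [h5, h6] at h4
      rw [sup_comm]
      have := (Ideal.mem_quotient_iff_mem_sup).mp h4
      rwa [sup_comm] at this
    by_contra hcJ
    have hJ : J ≠ ⊤ := fun h => hcJ (h ▸ Submodule.mem_top)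
    have : IsLocalRing (R ⧸ J) := isLocalRing_quotient hJ
    have hK := Ideal.iInf_pow_eq_bot_of_isLocalRing (maximalIdeal (R ⧸ J))
      (maximalIdeal.isMaximal _).ne_top
    have : Ideal.Quotient.mk J c ∈ (⨅ N, maximalIdeal (R ⧸ J) ^ N : Ideal (R ⧸ J)) := by
      rw [Ideal.mem_iInf]
      intro N
      rw [maximalIdeal_quotient J, ← Ideal.map_pow, Ideal.mem_quotient_iff_mem_sup]
      rw [sup_comm]; exact h3 N
    rw [hK, Ideal.mem_bot, Ideal.Quotient.eq_zero_iff_mem] at this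
    exact hcJ this

end Completion

section Approximation

/-- Finitely generated subrings of `R` containing the parameters `x` have homomorphisms to
Henselian regular local rings of the same dimension and of prime characteristic that take `x` to
parameters. -/
def Approximable {R : Type u} [CommRing R] (x : ℕ → R) (n : ℕ) : Prop :=
  ∀ S : Set R, S.Finite → ∃ (O : Type u) (_ : CommRing O) (B : Type u) (_ : CommRing B)
    (_ : HenselianLocalRing B) (ι : O →+* R) (φ : O →+* B) (p : ℕ) (x' : ℕ → O),
    Function.Injective ι ∧ (∀ s ∈ S, ∃ o, ι o = s) ∧ p.Prime ∧ (p : B) = 0 ∧ RegLoc B n ∧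
      (∀ j < n, ι (x' j) = x j) ∧ initIdeal (fun j => φ (x' j)) n = maximalIdeal B

lemma exists_coeff_initIdeal_le {R : Type u} [CommRing R] {x y : ℕ → R} {n : ℕ}
    (h : initIdeal x n ≤ initIdeal y n) :
    ∃ a : ℕ → ℕ → R, ∀ i < n, x i = ∑ j ∈ Finset.range n, a i j * y j := by
  have : ∀ i, ∃ a : ℕ → R, i < n → x i = ∑ j ∈ Finset.range n, a j * y j := by
    intro i
    by_cases hi : i < n
    · obtain ⟨a, ha⟩ := mem_initIdeal_iff.mp (h (mem_initIdeal hi))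
      exact ⟨a, fun _ => ha⟩
    · exact ⟨0, fun h' => absurd h' hi⟩
  choose a ha using this
  exact ⟨a, ha⟩

lemma initIdeal_le_of_coeff {R O : Type u} [CommRing R] [CommRing O] {ι : O →+* R}
    (hι : Function.Injective ι) {x y : ℕ → R} {x' y' : ℕ → O} {n : ℕ}
    (hx : ∀ j < n, ι (x' j) = x j) (hy : ∀ j < n, ι (y' j) = y j)
    {a : ℕ → ℕ → R} (h : ∀ i < n, x i = ∑ j ∈ Finset.range n, a i j * y j)
    (ha : ∀ i < n, ∀ j < n, ∃ o, ι o = a i j) : initIdeal x' n ≤ initIdeal y' n := by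
  rw [initIdeal_le_iff]
  intro i hi
  have : ∀ j, ∃ o, j < n → ι o = a i j := fun j => by
    by_cases hj : j < n
    · obtain ⟨o, ho⟩ := ha i hi j hj
      exact ⟨o, fun _ => ho⟩
    · exact ⟨0, fun h => absurd h hj⟩
  choose o ho using this
  rw [mem_initIdeal_iff]
  refine ⟨o, hι ?_⟩
  rw [hx i hi, h i hi, map_sum]
  refine Finset.sum_congr rfl fun j hj => ?_
  rw [Finset.mem_range] at hj
  rw [map_mul, ho j hj, hy j hj]

lemma Approximable.congr {R : Type u} [CommRing R] {x y : ℕ → R} {n : ℕ} (h : Approximable x n)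
    (hxy : initIdeal x n = initIdeal y n) : Approximable y n := by
  intro S hS
  obtain ⟨a, ha⟩ := exists_coeff_initIdeal_le hxy.le
  obtain ⟨b, hb⟩ := exists_coeff_initIdeal_le hxy.ge
  have hfin : ∀ c : ℕ → ℕ → R, (Set.image2 c (Set.Iio n) (Set.Iio n)).Finite := fun c =>
    Set.Finite.image2 _ (Set.finite_Iio n) (Set.finite_Iio n)
  obtain ⟨O, _, B, _, _, ι, φ, p, x', hι, hO, hp, hpB, hB, hx', hgen⟩ :=
    h (S ∪ Set.image2 a (Set.Iio n) (Set.Iio n) ∪ Set.image2 b (Set.Iio n) (Set.Iio n) ∪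
      y '' Set.Iio n) (((hS.union (hfin a)).union (hfin b)).union ((Set.finite_Iio n).image y))
  have : ∀ j, ∃ o, j < n → ι o = y j := fun j => by
    by_cases hj : j < n
    · obtain ⟨o, ho⟩ := hO (y j) (Or.inr ⟨j, hj, rfl⟩)
      exact ⟨o, fun _ => ho⟩
    · exact ⟨0, fun h => absurd h hj⟩
  choose y' hy' using this
  refine ⟨O, _, B, _, ‹_›, ι, φ, p, y', hι, fun s hs => hO s (Or.inl (Or.inl (Or.inl hs))), hp,
    hpB, hB, hy', ?_⟩
  have h1 : initIdeal y' n = initIdeal x' n := le_antisymm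
    (initIdeal_le_of_coeff hι hy' hx' hb fun i hi j hj => hO _ (Or.inl (Or.inr ⟨i, hi, j, hj, rfl⟩)))
    (initIdeal_le_of_coeff hι hx' hy' ha
      fun i hi j hj => hO _ (Or.inl (Or.inl (Or.inr ⟨i, hi, j, hj, rfl⟩))))
  rw [← initIdeal_map, h1, initIdeal_map, hgen]

lemma Approximable.map_equiv {R R' : Type u} [CommRing R] [CommRing R'] (e : R ≃+* R')
    {x : ℕ → R} {n : ℕ} (h : Approximable x n) : Approximable (fun j => e (x j)) n := by
  intro S hS
  obtain ⟨O, _, B, _, _, ι, φ, p, x', hι, hO, hp, hpB, hB, hx', hgen⟩ :=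
    h (e.symm '' S) (hS.image _)
  refine ⟨O, _, B, _, ‹_›, (e : R →+* R').comp ι, φ, p, x', e.injective.comp hι, fun s hs => ?_, hp,
    hpB, hB, fun j hj => by simp [hx' j hj], hgen⟩
  obtain ⟨o, ho⟩ := hO _ ⟨s, hs, rfl⟩
  exact ⟨o, by simp [ho]⟩

lemma Int.isJacobsonRing : IsJacobsonRing ℤ := by
  rw [isJacobsonRing_iff_prime_eq]
  intro P hP
  by_cases hbot : P = ⊥
  · subst hbot
    rw [eq_bot_iff]
    intro x hx
    rw [Ideal.mem_jacobson_bot] at hx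
    have := hx x
    rw [Int.isUnit_iff] at this
    rw [Ideal.mem_bot]
    rcases this with h | h <;> nlinarith
  · have := IsPrime.to_maximal_ideal hbot
    exact Ideal.jacobson_eq_self_of_isMaximal

lemma exists_prime_eq_zero_of_finiteType (L : Type u) [Field L]
    (hL : (Int.castRingHom L).FiniteType) : ∃ p : ℕ, p.Prime ∧ (p : L) = 0 := by
  have := Int.isJacobsonRing
  have hfin := (RingHom.finite_iff_finiteType_of_isJacobsonRing.mpr hL).to_isIntegral
  obtain ⟨p, hp⟩ := CharP.exists L
  rcases CharP.char_is_prime_or_zero L p with h | rfl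
  · exact ⟨p, h, CharP.cast_eq_zero L p⟩
  · have : CharZero L := CharP.charP_to_charZero L
    have hinj : Function.Injective (Int.castRingHom L) := RingHom.injective_int _
    let _ := (Int.castRingHom L).toAlgebra
    have : Algebra.IsIntegral ℤ L := ⟨hfin⟩
    exact absurd (isField_of_isIntegral_of_isField hinj (Field.toIsField L)) Int.not_isField

lemma approximable_of_field {k : Type u} [Field k] (x : ℕ → k) : Approximable x 0 := by
  intro S hS
  set O := Algebra.adjoin ℤ S with hO
  have hft : Algebra.FiniteType ℤ O := by
    rw [← Subalgebra.fg_iff_finiteType]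
    exact Subalgebra.fg_def.mpr ⟨S, hS, rfl⟩
  obtain ⟨M, hM⟩ := Ideal.exists_maximal O
  let _ : Field (O ⧸ M) := Ideal.Quotient.field M
  have hft' : (Int.castRingHom (O ⧸ M)).FiniteType := by
    have h1 := (RingHom.finiteType_algebraMap.mpr hft).comp_surjective
      (g := Ideal.Quotient.mk M) Ideal.Quotient.mk_surjective
    rwa [RingHom.ext_int ((Ideal.Quotient.mk M).comp (algebraMap ℤ O))
      (Int.castRingHom (O ⧸ M))] at h1
  obtain ⟨p, hp, hp0⟩ := exists_prime_eq_zero_of_finiteType (O ⧸ M) hft'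
  have hgen : ∀ y : ℕ → O ⧸ M, initIdeal y 0 = maximalIdeal (O ⧸ M) := fun y => by
    rw [initIdeal_zero, IsLocalRing.maximalIdeal_eq_bot]
  refine ⟨O, inferInstance, O ⧸ M, inferInstance, inferInstance, O.subtype, Ideal.Quotient.mk M, p,
    0, Subtype.val_injective, fun s hs => ⟨⟨s, Algebra.subset_adjoin hs⟩, rfl⟩, hp, hp0,
    ⟨inferInstance, ⟨0, hgen 0⟩, by simp⟩, fun j hj => absurd hj (by omega), hgen _⟩

end Approximation

section Coordinates

lemma initIdeal_one {R : Type u} [CommRing R] (y : ℕ → R) : initIdeal y 1 = Ideal.span {y 0} := by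
  rw [initIdeal_succ, initIdeal_zero, bot_sup_eq]

lemma mem_initIdeal_succ_iff {R : Type u} [CommRing R] {y : ℕ → R} {n : ℕ} {c : R} :
    c ∈ initIdeal y (n + 1) ↔ Ideal.Quotient.mk (initIdeal y 1) c ∈
      initIdeal (fun j => Ideal.Quotient.mk (initIdeal y 1) (y (1 + j))) n := by
  have h := initIdeal_sub y 1 (n + 1) (by omega)
  rw [Nat.add_sub_cancel] at h
  rw [← h, Ideal.mem_quotient_iff_mem (initIdeal_mono y (by omega))]

lemma RegLoc.initIdeal_isPrime {R : Type u} [CommRing R] [IsLocalRing R] {n i : ℕ}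
    (hR : RegLoc R n) {y : ℕ → R} (hy : initIdeal y n = maximalIdeal R) (hi : i ≤ n) :
    (initIdeal y i).IsPrime := by
  have hne : initIdeal y i ≠ ⊤ := initIdeal_ne_top fun j hj => hy ▸ mem_initIdeal (by omega)
  have := isLocalRing_quotient hne
  have := (hR.quotient hy hi).isDomain
  exact (Ideal.Quotient.isDomain_iff_prime _).mp this

lemma RegLoc.height_initIdeal {R : Type u} [CommRing R] [IsLocalRing R] {n i : ℕ}
    (hR : RegLoc R n) {y : ℕ → R} (hy : initIdeal y n = maximalIdeal R) (hi : i ≤ n) :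
    (i : ℕ∞) ≤ (initIdeal y i).height :=
  have := hR.noeth
  le_height_of_isSMulRegular fun _ hj => hR.isSMulRegular hy (by omega)

lemma initIdeal_update_add {R : Type u} [CommRing R] {x : ℕ → R} {n : ℕ} {c : R}
    (hc : c ∈ Ideal.span {x 1}) :
    initIdeal (Function.update x 0 (x 0 + c)) (n + 2) = initIdeal x (n + 2) := by
  obtain ⟨r, rfl⟩ := Ideal.mem_span_singleton.mp hc
  have h1 : Function.update x 0 (x 0 + x 1 * r) 1 = x 1 := by simp
  apply le_antisymm <;> rw [initIdeal_le_iff] <;> intro j hj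
  · by_cases h0 : j = 0
    · subst h0
      rw [Function.update_self]
      exact add_mem (mem_initIdeal hj) (Ideal.mul_mem_right _ _ (mem_initIdeal (by omega)))
    · rw [Function.update_of_ne h0]
      exact mem_initIdeal hj
  · by_cases h0 : j = 0
    · subst h0
      have h2 := mem_initIdeal (x := Function.update x 0 (x 0 + x 1 * r)) hj
      have h3 := mem_initIdeal (x := Function.update x 0 (x 0 + x 1 * r))
        (show 1 < n + 2 by omega)
      rw [h1] at h3
      rw [Function.update_self] at h2
      simpa using sub_mem h2 (Ideal.mul_mem_right r _ h3)
    · have h2 := mem_initIdeal (x := Function.update x 0 (x 0 + x 1 * r)) hj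
      rwa [Function.update_of_ne h0] at h2

/-- A nonzero element avoids some member of a regular system of parameters. -/
lemma RegLoc.exists_notMem_span {R : Type u} [CommRing R] [IsLocalRing R] {n : ℕ}
    (hR : RegLoc R (n + 2)) {d : R} (hd : d ≠ 0) :
    ∃ y : ℕ → R, initIdeal y (n + 2) = maximalIdeal R ∧ d ∉ initIdeal y 1 := by
  by_contra! H
  have := hR.noeth
  have := hR.isDomain
  obtain ⟨x, hx⟩ := hR.gen
  have hx0 : x 0 ∈ maximalIdeal R := hx ▸ mem_initIdeal (by omega)
  have hx1 : x 1 ∈ maximalIdeal R := hx ▸ mem_initIdeal (by omega)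
  set b : ℕ → R := fun j => x 0 + x 1 ^ (j + 1) with hb
  have hbm : ∀ j, b j ∈ maximalIdeal R := fun j =>
    add_mem hx0 (Ideal.pow_mem_of_mem _ hx1 _ (by omega))
  have hupd : ∀ j, initIdeal (Function.update x 0 (b j)) (n + 2) = maximalIdeal R := fun j =>
    (initIdeal_update_add (Ideal.mem_span_singleton.mpr (dvd_pow_self _ (by omega)))).trans hx
  have hspan : ∀ j, initIdeal (Function.update x 0 (b j)) 1 = Ideal.span {b j} := fun j => by
    rw [initIdeal_one, Function.update_self]
  have hdvd : ∀ j, b j ∣ d := fun j => by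
    rw [← Ideal.mem_span_singleton, ← hspan]
    exact H _ (hupd j)
  have hprime : ∀ j, Prime (b j) := fun j => by
    have hb0 : b j ≠ 0 := fun h0 => hd (by have := hdvd j; rwa [h0, zero_dvd_iff] at this)
    rw [← Ideal.span_singleton_prime hb0, ← hspan]
    exact hR.initIdeal_isPrime (hupd j) (by omega)
  have hnd : ∀ i j, i < j → ¬ b j ∣ b i := by
    intro i j hij h
    obtain ⟨e, rfl⟩ := Nat.exists_eq_add_of_lt hij
    have h1 : b (i + e + 1) ∣ x 1 ^ (i + 1) * (1 - x 1 ^ (e + 1)) := by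
      have := dvd_sub h (dvd_refl (b (i + e + 1)))
      convert this using 1
      simp only [hb]; ring
    have hu : IsUnit (1 - x 1 ^ (e + 1)) := by
      by_contra hu
      have h2 := add_mem ((mem_maximalIdeal _).mpr hu)
        (Ideal.pow_mem_of_mem _ hx1 (e + 1) (by omega))
      rw [sub_add_cancel] at h2
      exact (maximalIdeal.isMaximal R).ne_top ((Ideal.eq_top_iff_one _).mpr h2)
    have h2 : b (i + e + 1) ∣ x 1 := (hprime _).dvd_of_dvd_pow (hu.dvd_mul_right.mp h1)
    have h3 : b (i + e + 1) ∣ x 0 := by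
      have := dvd_sub (dvd_refl (b (i + e + 1))) (h2.trans (dvd_pow_self _
        (show i + e + 1 + 1 ≠ 0 by omega)))
      simpa [hb] using this
    have h4 : initIdeal x 2 ≤ Ideal.span {b (i + e + 1)} := by
      rw [initIdeal_le_iff]
      intro l hl
      rw [Ideal.mem_span_singleton]
      interval_cases l
      exacts [h3, h2]
    have h5 := (hR.height_initIdeal hx (show 2 ≤ n + 2 by omega)).trans (Ideal.height_mono h4)
    have h6 : (Ideal.span {b (i + e + 1)}).height ≤ 1 := by
      rw [← hspan]
      refine (initIdeal_height_le ?_).trans (by simp)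
      exact initIdeal_ne_top fun l hl => by
        rw [← hupd (i + e + 1)]; exact mem_initIdeal (by omega)
    exact absurd (h5.trans h6) (by norm_num)
  have hmem : ∀ N, ∏ j ∈ Finset.range N, b j ∣ d := by
    intro N
    induction N with
    | zero => simp
    | succ N ih =>
      obtain ⟨q, hq⟩ := ih
      have h1 : b N ∣ (∏ j ∈ Finset.range N, b j) * q := hq ▸ hdvd N
      rcases (hprime N).dvd_or_dvd h1 with h2 | h2
      · obtain ⟨i, hi, h3⟩ := (hprime N).exists_mem_finset_dvd h2
        exact absurd h3 (hnd i N (Finset.mem_range.mp hi))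
      · obtain ⟨q', rfl⟩ := h2
        exact ⟨q', by rw [hq, Finset.prod_range_succ, mul_assoc]⟩
  have hK := Ideal.iInf_pow_eq_bot_of_isLocalRing (maximalIdeal R) (maximalIdeal.isMaximal R).ne_top
  refine hd ?_
  rw [← Ideal.mem_bot, ← hK, Ideal.mem_iInf]
  intro N
  refine Ideal.mem_of_dvd _ (hmem N) ?_
  have := Ideal.prod_mem_prod (s := Finset.range N) (I := fun _ => maximalIdeal R) (x := b)
    fun i _ => hbm i
  simpa using this

lemma RegLoc.exists_notMem_initIdeal {n : ℕ} : ∀ {R : Type u} [CommRing R] [IsLocalRing R],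
    RegLoc R (n + 1) → ∀ {d : R}, d ≠ 0 →
      ∃ y : ℕ → R, initIdeal y (n + 1) = maximalIdeal R ∧ d ∉ initIdeal y n := by
  induction n with
  | zero =>
    intro R _ _ hR d hd
    obtain ⟨y, hy⟩ := hR.gen
    exact ⟨y, hy, by simpa [initIdeal_zero] using hd⟩
  | succ n ih =>
    intro R _ _ hR d hd
    obtain ⟨x, hx, hdx⟩ := hR.exists_notMem_span hd
    have hxm : ∀ j < n + 2, x j ∈ maximalIdeal R := fun j hj => hx ▸ mem_initIdeal hj
    have := isLocalRing_quotient (initIdeal_ne_top (i := 1) fun j hj => hxm j (by omega))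
    have hQ : RegLoc (R ⧸ initIdeal x 1) (n + 1) := hR.quotient hx (show 1 ≤ n + 2 by omega)
    obtain ⟨z, hz, hdz⟩ := ih hQ (d := Ideal.Quotient.mk _ d)
      (by rwa [Ne, Ideal.Quotient.eq_zero_iff_mem])
    choose w hw using fun j => Ideal.Quotient.mk_surjective (I := initIdeal x 1) (z j)
    set y : ℕ → R := fun j => if j = 0 then x 0 else w (j - 1) with hyd
    have h1 : initIdeal y 1 = initIdeal x 1 := initIdeal_congr fun j hj => by
      obtain rfl : j = 0 := by omega
      simp [hyd]
    have key : ∀ m c, c ∈ initIdeal y (m + 1) ↔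
        Ideal.Quotient.mk (initIdeal x 1) c ∈ initIdeal z m := by
      intro m c
      rw [mem_initIdeal_succ_iff, h1]
      have : (fun j => Ideal.Quotient.mk (initIdeal x 1) (y (1 + j))) = z := by
        ext j
        simp [hyd, hw]
      rw [this]
    refine ⟨y, ?_, fun h => hdz ((key n d).mp h)⟩
    ext c
    rw [key, hz, maximalIdeal_quotient, Ideal.mem_quotient_iff_mem]
    rw [initIdeal_le_iff]
    exact fun j hj => hxm j (by omega)

end Coordinates

section Approximation
open PowerSeries

lemma PowerSeries.henselianLocalRing (B : Type u) [CommRing B] [HenselianLocalRing B] :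
    HenselianLocalRing B⟦X⟧ := by
  refine ⟨fun f hf a₀ h0 h1 => ?_⟩
  have hev : ∀ (g : Polynomial B⟦X⟧) (c : B⟦X⟧), constantCoeff (g.eval c) =
      (g.map (constantCoeff (R := B))).eval (constantCoeff c) := fun g c => by
    rw [Polynomial.eval_map, Polynomial.eval₂_at_apply]
  obtain ⟨b, hb, hb'⟩ := HenselianLocalRing.is_henselian (f.map (constantCoeff (R := B)))
    (hf.map _) (constantCoeff a₀) (by rw [← hev]; exact PowerSeries.mem_maximalIdeal_iff.mp h0)
    (by rw [Polynomial.derivative_map, ← hev]; exact h1.map _)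
  have hu : IsUnit (f.derivative.eval (C b)) := by
    rw [PowerSeries.isUnit_iff_constantCoeff, hev, constantCoeff_C]
    have hu1 : IsUnit ((f.derivative.map (constantCoeff (R := B))).eval (constantCoeff a₀)) := by
      rw [← hev]; exact h1.map _
    by_contra hn
    refine (mem_maximalIdeal _).mp ?_ hu1
    have := Ideal.mem_of_dvd (maximalIdeal B)
      (Polynomial.sub_dvd_eval_sub b (constantCoeff a₀) (f.derivative.map (constantCoeff (R := B))))
      hb'
    have h2 := Ideal.sub_mem _ ((mem_maximalIdeal _).mpr hn) this
    simpa using h2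
  obtain ⟨c, hc, hc'⟩ := HenselianRing.is_henselian (I := Ideal.span {(X : B⟦X⟧)}) f hf (C b)
    (by
      rw [Ideal.mem_span_singleton, PowerSeries.X_dvd_iff, hev, constantCoeff_C]
      exact hb)
    (hu.map _)
  refine ⟨c, hc, ?_⟩
  rw [PowerSeries.mem_maximalIdeal_iff]
  have h2 : constantCoeff (c - C b) = 0 := by
    rwa [Ideal.mem_span_singleton, PowerSeries.X_dvd_iff] at hc'
  have h3 : constantCoeff (c - a₀) = constantCoeff (c - C b) + (b - constantCoeff a₀) := by
    simp
  rw [h3, h2, zero_add]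
  exact hb'

lemma Polynomial.IsDistinguishedAt.pow {A : Type u} [CommRing A] {I : Ideal A} {a : Polynomial A}
    (ha : a.IsDistinguishedAt I) (N : ℕ) : (a ^ N).IsDistinguishedAt I := by
  induction N with
  | zero =>
    rw [pow_zero]
    exact ⟨⟨fun h => by simp at h⟩, Polynomial.monic_one⟩
  | succ N ih =>
    rw [pow_succ]
    exact ih.mul ha

lemma Polynomial.IsDistinguishedAt.exists_dvd_sub {A : Type u} [CommRing A] {I : Ideal A}
    [IsAdicComplete I A] {a : Polynomial A} (ha : a.IsDistinguishedAt I) (g : A⟦X⟧) :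
    ∃ r : Polynomial A, (a : A⟦X⟧) ∣ g - r := by
  obtain ⟨-, h⟩ := ha.isWeierstrassDivisorAt'.isWeierstrassDivisionAt_div_mod g
  exact ⟨_, _, sub_eq_of_eq_add h⟩

lemma Polynomial.IsDistinguishedAt.dvd_of_coe_dvd {A : Type u} [CommRing A] {I : Ideal A}
    [IsAdicComplete I A] (hI : I ≠ ⊤) {a : Polynomial A} (ha : a.IsDistinguishedAt I)
    {P : Polynomial A} (h : (a : A⟦X⟧) ∣ P) : a ∣ P := by
  have : Nontrivial A := ⟨⟨0, 1, fun h => hI ((Ideal.eq_top_iff_one I).mpr (h ▸ I.zero_mem))⟩⟩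
  have hP := Polynomial.modByMonic_add_div P a
  rw [← Polynomial.modByMonic_eq_zero_iff_dvd ha.monic]
  have h2 : (a : A⟦X⟧) ∣ ((P %ₘ a : Polynomial A) : A⟦X⟧) := by
    have : ((P %ₘ a : Polynomial A) : A⟦X⟧) = P - a * ((P /ₘ a : Polynomial A) : A⟦X⟧) := by
      rw [← Polynomial.coe_mul, eq_sub_iff_add_eq, ← Polynomial.coe_add, hP]
    rw [this]
    exact dvd_sub h (dvd_mul_right _ _)
  obtain ⟨q, hq⟩ := h2
  refine (ha.isWeierstrassDivisorAt'.eq_zero_of_mul_eq ?_ hq.symm).2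
  have hdeg := ha.coe_natDegree_eq_order_map (a : A⟦X⟧) 1
    (by rwa [constantCoeff_one, ← Ideal.ne_top_iff_one]) (by simp)
  rw [← hdeg, ENat.toNat_natCast, ← Polynomial.degree_eq_natDegree ha.monic.ne_zero]
  exact Polynomial.degree_modByMonic_lt _ ha.monic

/-- Evaluation of an integral polynomial. -/
noncomputable def MvPolynomial.evalInt {A : Type*} [CommRing A] {σ : Type*} (η : σ → A) :
    MvPolynomial σ ℤ →+* A :=
  (MvPolynomial.aeval η : MvPolynomial σ ℤ →ₐ[ℤ] A).toRingHom

lemma MvPolynomial.map_evalInt {A B : Type*} [CommRing A] [CommRing B] {σ : Type*} (f : A →+* B)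
    (η : σ → A) (G : MvPolynomial σ ℤ) :
    f (MvPolynomial.evalInt η G) = MvPolynomial.evalInt (fun i => f (η i)) G := by
  change f (MvPolynomial.aeval η G) = MvPolynomial.aeval (fun i => f (η i)) G
  rw [MvPolynomial.aeval_def, MvPolynomial.aeval_def, MvPolynomial.hom_eval₂]
  congr 1
  exact RingHom.ext_int _ _

lemma MvPolynomial.dvd_evalInt_sub {A : Type*} [CommRing A] {σ : Type*} {u v : σ → A} {a : A}
    (h : ∀ i, a ∣ u i - v i) (P : MvPolynomial σ ℤ) :
    a ∣ MvPolynomial.evalInt u P - MvPolynomial.evalInt v P :=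
  dvd_aeval_sub_aeval h P

lemma Approximable.exists_polynomial {A : Type u} [CommRing A] {x : ℕ → A} {n : ℕ}
    (h : Approximable x n) {T : Set (Polynomial A)} (hT : T.Finite) :
    ∃ (O : Type u) (_ : CommRing O) (B : Type u) (_ : CommRing B)
    (_ : HenselianLocalRing B) (ι : O →+* A) (φ : O →+* B) (p : ℕ) (x' : ℕ → O),
    Function.Injective ι ∧ (∀ P ∈ T, ∃ o : Polynomial O, o.map ι = P) ∧ p.Prime ∧ (p : B) = 0 ∧
      RegLoc B n ∧ (∀ j < n, ι (x' j) = x j) ∧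
      initIdeal (fun j => φ (x' j)) n = maximalIdeal B := by
  obtain ⟨O, _, B, _, _, ι, φ, p, x', hι, hO, hp, hpB, hB, hx', hgen⟩ :=
    h (⋃ P ∈ T, (P.coeffs : Set A)) (hT.biUnion fun P _ => P.coeffs.finite_toSet)
  refine ⟨O, _, B, _, inferInstance, ι, φ, p, x', hι, fun P hP => ?_, hp, hpB, hB, hx', hgen⟩
  have : P ∈ Polynomial.lifts ι := by
    rw [Polynomial.lifts_iff_coeff_lifts]
    intro i
    by_cases hi : P.coeff i = 0
    · exact ⟨0, by simp [hi]⟩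
    · obtain ⟨o, ho⟩ := hO (P.coeff i)
        (Set.mem_biUnion hP (Polynomial.coeff_mem_coeffs hi))
      exact ⟨o, ho⟩
  obtain ⟨o, ho⟩ := (Polynomial.mem_lifts _).mp this
  exact ⟨o, ho⟩


lemma initIdeal_eq_of_le_sup_sq {B : Type u} [CommRing B] [IsLocalRing B]
    (hB : IsNoetherianRing B) {s : ℕ → B} {n : ℕ} (h : initIdeal s n ≤ maximalIdeal B)
    (h' : maximalIdeal B ≤ initIdeal s n ⊔ maximalIdeal B ^ 2) :
    initIdeal s n = maximalIdeal B := by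
  refine le_antisymm h ?_
  refine Submodule.le_of_le_smul_of_le_jacobson_bot (I := maximalIdeal B)
    (IsNoetherian.noetherian _) (IsLocalRing.maximalIdeal_le_jacobson _) ?_
  rwa [smul_eq_mul, ← pow_two]

lemma Approximable.exists_approximate_solution {A : Type u} [CommRing A] [IsLocalRing A]
    [IsAdicComplete (maximalIdeal A) A] {ξ : ℕ → A} {n : ℕ}
    (hξ : initIdeal ξ n = maximalIdeal A) (happ : Approximable ξ n) {N : ℕ}
    (y : Fin N → A⟦X⟧) (𝒢 𝒟 : Finset (MvPolynomial (Fin N) ℤ))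
    (hG : ∀ G ∈ 𝒢, MvPolynomial.evalInt y G = 0) (E : ℕ) (hE : 2 ≤ E)
    (hΔ : (X * ∏ d ∈ 𝒟, MvPolynomial.evalInt y d : A⟦X⟧).map (residue A) ≠ 0) (v : ℕ → Fin N)
    (hv : initIdeal (fun j => y (v j)) (n + 1) = maximalIdeal A⟦X⟧) :
    ∃ (B : Type u) (_ : CommRing B) (_ : HenselianLocalRing B) (p : ℕ) (a : B⟦X⟧)
      (η : Fin N → B⟦X⟧), p.Prime ∧ (p : B) = 0 ∧ RegLoc B n ∧ a ∈ maximalIdeal B⟦X⟧ ∧ a ≠ 0 ∧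
      (∀ G ∈ 𝒢, a ^ E ∣ MvPolynomial.evalInt η G) ∧
      (∀ d ∈ 𝒟, ∃ b, a ^ 2 ∣ a - MvPolynomial.evalInt η d * b) ∧
      initIdeal (fun j => η (v j)) (n + 1) = maximalIdeal B⟦X⟧ := by
  classical
  have hcoe : ∀ (η : Fin N → Polynomial A) (G : MvPolynomial (Fin N) ℤ),
      ((MvPolynomial.evalInt η G : Polynomial A) : A⟦X⟧) =
        MvPolynomial.evalInt (fun i => (η i : A⟦X⟧)) G := fun η G =>
    MvPolynomial.map_evalInt (Polynomial.coeToPowerSeries.ringHom (R := A)) η G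
  have hI : maximalIdeal A ≠ ⊤ := Ideal.IsPrime.ne_top'
  obtain ⟨a, u, hau⟩ := PowerSeries.exists_isWeierstrassFactorization hΔ
  have ha := hau.isDistinguishedAt
  have huX : X * ∏ d ∈ 𝒟, MvPolynomial.evalInt y d = (a : A⟦X⟧) * u := hau.eq_mul
  obtain ⟨u', hu'⟩ := isUnit_iff_exists_inv.mp hau.isUnit
  have hdvd : ∀ d ∈ 𝒟, MvPolynomial.evalInt y d ∣ (a : A⟦X⟧) := fun d hd => by
    have h1 := (Finset.dvd_prod_of_mem (fun d => MvPolynomial.evalInt y d) hd).trans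
      (dvd_mul_left _ (X : A⟦X⟧))
    rw [huX] at h1
    have := h1.mul_right u'
    rwa [mul_assoc, hu', mul_one] at this
  have ha0 : a.coeff 0 ∈ maximalIdeal A := by
    have h1 : constantCoeff ((a : A⟦X⟧) * u) = 0 := by rw [← huX]; simp
    have h2 : a.coeff 0 = constantCoeff ((a : A⟦X⟧) * u * u') := by
      rw [mul_assoc, hu', mul_one]; simp
    rw [h2, map_mul, h1, zero_mul]
    exact Ideal.zero_mem _
  rw [← hξ, mem_initIdeal_iff] at ha0
  obtain ⟨β, hβ⟩ := ha0
  have hη : ∀ i, ∃ r : Polynomial A, (a : A⟦X⟧) ^ E ∣ y i - r := fun i => by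
    obtain ⟨r, hr⟩ := (ha.pow E).exists_dvd_sub (y i)
    exact ⟨r, by rwa [← Polynomial.coe_pow]⟩
  choose η hη1 using hη
  have hdiff : ∀ G : MvPolynomial (Fin N) ℤ, (a : A⟦X⟧) ^ E ∣ MvPolynomial.evalInt y G -
      ((MvPolynomial.evalInt η G : Polynomial A) : A⟦X⟧) := fun G => by
    rw [hcoe]
    exact MvPolynomial.dvd_evalInt_sub hη1 G
  have hGq : ∀ G, ∃ q : Polynomial A, G ∈ 𝒢 → MvPolynomial.evalInt η G = a ^ E * q := fun G => by
    by_cases h : G ∈ 𝒢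
    · have h1 := hdiff G
      rw [hG G h, zero_sub, dvd_neg, ← Polynomial.coe_pow] at h1
      obtain ⟨q, hq⟩ := (ha.pow E).dvd_of_coe_dvd hI h1
      exact ⟨q, fun _ => hq⟩
    · exact ⟨0, fun h' => absurd h' h⟩
  choose q hq using hGq
  have hDq : ∀ d, ∃ b c : Polynomial A, d ∈ 𝒟 → a - MvPolynomial.evalInt η d * b = a ^ 2 * c :=
    fun d => by
    by_cases h : d ∈ 𝒟
    · obtain ⟨s, hs⟩ := hdvd d h
      obtain ⟨b, hb⟩ := (ha.pow 2).exists_dvd_sub s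
      have h1 : ((a ^ 2 : Polynomial A) : A⟦X⟧) ∣
          ((a - MvPolynomial.evalInt η d * b : Polynomial A) : A⟦X⟧) := by
        rw [Polynomial.coe_sub, Polynomial.coe_mul]
        have : (a : A⟦X⟧) - ((MvPolynomial.evalInt η d : Polynomial A) : A⟦X⟧) * b =
            MvPolynomial.evalInt y d * (s - b) + (MvPolynomial.evalInt y d -
              ((MvPolynomial.evalInt η d : Polynomial A) : A⟦X⟧)) * b := by
          nth_rewrite 1 [hs]
          ring
        rw [this]
        refine dvd_add (hb.mul_left _) (Dvd.dvd.mul_right ?_ _)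
        rw [Polynomial.coe_pow]
        exact (pow_dvd_pow _ hE).trans (hdiff d)
      obtain ⟨c, hc⟩ := (ha.pow 2).dvd_of_coe_dvd hI h1
      exact ⟨b, c, fun _ => hc⟩
    · exact ⟨0, 0, fun h' => absurd h' h⟩
  choose b c hbc using hDq
  have haX : (a : A⟦X⟧) ∈ maximalIdeal A⟦X⟧ := by
    rw [PowerSeries.mem_maximalIdeal_iff, Polynomial.constantCoeff_coe, ← hξ, mem_initIdeal_iff]
    exact ⟨β, hβ⟩
  have hγ : ∀ j, ∃ γ : ℕ → A, j < n + 1 →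
      (η (v j)).coeff 0 = ∑ i ∈ Finset.range n, γ i * ξ i := fun j => by
    by_cases h : j < n + 1
    · have h1 : y (v j) ∈ maximalIdeal A⟦X⟧ :=
        hv ▸ mem_initIdeal (x := fun j => y (v j)) h
      have h2 := Ideal.sub_mem _ h1 (Ideal.mem_of_dvd _ ((dvd_pow_self _ (by omega)).trans
        (hη1 (v j))) haX)
      rw [sub_sub_cancel, PowerSeries.mem_maximalIdeal_iff, Polynomial.constantCoeff_coe, ← hξ,
        mem_initIdeal_iff] at h2
      obtain ⟨γ, hγ⟩ := h2
      exact ⟨γ, fun _ => hγ⟩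
    · exact ⟨0, fun h' => absurd h' h⟩
  choose γ hγ using hγ
  set P : ℕ → Polynomial A := fun j => if j < n then Polynomial.C (ξ j) else Polynomial.X with hP
  have hPp : ∀ j, (P j : A⟦X⟧) = PowerSeries.params ξ n j := fun j => by
    by_cases h : j < n <;> simp [hP, params, h]
  have hδ : ∀ j, ∃ (δ : ℕ → Polynomial A) (ε : Polynomial A), j < n + 1 →
      P j - ∑ i ∈ Finset.range (n + 1), δ i * η (v i) = a ^ 2 * ε := fun j => by
    by_cases h : j < n + 1
    · have h1 : (P j : A⟦X⟧) ∈ initIdeal (fun j => y (v j)) (n + 1) := by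
        rw [hv, ← PowerSeries.initIdeal_params hξ, hPp]
        exact mem_initIdeal h
      obtain ⟨s, hs⟩ := mem_initIdeal_iff.mp h1
      choose δ hδ using fun i => (ha.pow 2).exists_dvd_sub (s i)
      have h2 : ((a ^ 2 : Polynomial A) : A⟦X⟧) ∣
          ((P j - ∑ i ∈ Finset.range (n + 1), δ i * η (v i) : Polynomial A) : A⟦X⟧) := by
        have h3 : ((∑ i ∈ Finset.range (n + 1), δ i * η (v i) : Polynomial A) : A⟦X⟧) =
            ∑ i ∈ Finset.range (n + 1), (δ i : A⟦X⟧) * (η (v i) : A⟦X⟧) := by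
          rw [← Polynomial.coeToPowerSeries.ringHom_apply, map_sum]
          simp
        rw [Polynomial.coe_sub, h3, hs, ← Finset.sum_sub_distrib]
        refine Finset.dvd_sum fun i _ => ?_
        have h4 : s i * y (v i) - (δ i : A⟦X⟧) * (η (v i) : A⟦X⟧) =
          (s i - δ i) * y (v i) + δ i * (y (v i) - η (v i)) := by ring
        rw [h4]
        refine dvd_add ((hδ i).mul_right _) (Dvd.dvd.mul_left ?_ _)
        rw [Polynomial.coe_pow]
        exact (pow_dvd_pow _ hE).trans (hη1 (v i))
      obtain ⟨ε, hε⟩ := (ha.pow 2).dvd_of_coe_dvd hI h2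
      exact ⟨δ, ε, fun _ => hε⟩
    · exact ⟨0, 0, fun h' => absurd h' h⟩
  choose δ ε hδε using hδ
  set T : Set (Polynomial A) := {a} ∪ Set.range η ∪ q '' 𝒢 ∪ b '' 𝒟 ∪ c '' 𝒟 ∪
      (fun j => Polynomial.C (β j)) '' (Finset.range n) ∪ ε '' (Finset.range (n + 1)) ∪
      (fun j : ℕ × ℕ => Polynomial.C (γ j.1 j.2)) '' (Finset.range (n + 1) ×ˢ Finset.range n :) ∪
      (fun j : ℕ × ℕ => δ j.1 j.2) '' (Finset.range (n + 1) ×ˢ Finset.range (n + 1) :) with hT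
  have hfin : T.Finite := by
    simp only [hT, Set.finite_union]
    exact ⟨⟨⟨⟨⟨⟨⟨⟨Set.finite_singleton a, Set.finite_range η⟩, 𝒢.finite_toSet.image q⟩,
      𝒟.finite_toSet.image b⟩, 𝒟.finite_toSet.image c⟩, (Finset.finite_toSet _).image _⟩,
      (Finset.finite_toSet _).image _⟩, (Finset.finite_toSet _).image _⟩,
      (Finset.finite_toSet _).image _⟩
  have hηT : ∀ i, η i ∈ T := fun i => by simp [hT]
  have hqT : ∀ G ∈ 𝒢, q G ∈ T := fun G hG => by
    have := Set.mem_image_of_mem q (Finset.mem_coe.mpr hG)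
    simp only [hT, Set.mem_union, this, true_or, or_true]
  have hbT : ∀ d ∈ 𝒟, b d ∈ T := fun d hd => by
    have := Set.mem_image_of_mem b (Finset.mem_coe.mpr hd)
    simp only [hT, Set.mem_union, this, true_or, or_true]
  have hcT : ∀ d ∈ 𝒟, c d ∈ T := fun d hd => by
    have := Set.mem_image_of_mem c (Finset.mem_coe.mpr hd)
    simp only [hT, Set.mem_union, this, true_or, or_true]
  have hβT : ∀ j < n, Polynomial.C (β j) ∈ T := fun j hj => by
    have := Set.mem_image_of_mem (fun j => Polynomial.C (β j))
      (Finset.mem_coe.mpr (Finset.mem_range.mpr hj))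
    simp only [hT, Set.mem_union, this, true_or, or_true]
  have hεT : ∀ j < n + 1, ε j ∈ T := fun j hj => by
    have := Set.mem_image_of_mem ε (Finset.mem_coe.mpr (Finset.mem_range.mpr hj))
    simp only [hT, Set.mem_union, this, true_or, or_true]
  have hγT : ∀ j < n + 1, ∀ i < n, Polynomial.C (γ j i) ∈ T := fun j hj i hi => by
    have := Set.mem_image_of_mem (fun j : ℕ × ℕ => Polynomial.C (γ j.1 j.2))
      (Finset.mem_coe.mpr (show (j, i) ∈ Finset.range (n + 1) ×ˢ Finset.range n by
        simp [hj, hi]))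
    exact Or.inl (Or.inr this)
  have hδT : ∀ j < n + 1, ∀ i < n + 1, δ j i ∈ T := fun j hj i hi => by
    have := Set.mem_image_of_mem (fun j : ℕ × ℕ => δ j.1 j.2)
      (Finset.mem_coe.mpr (show (j, i) ∈ Finset.range (n + 1) ×ˢ Finset.range (n + 1) by
        simp [hj, hi]))
    exact Or.inr this
  obtain ⟨O, _, B, _, _, ι, φ, p, x', hι, hO, hp, hpB, hB, hx', hgen⟩ :=
    happ.exists_polynomial hfin
  have hinj : Function.Injective (Polynomial.mapRingHom ι) := Polynomial.map_injective ι hι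
  have hL : ∀ Q : Polynomial A, ∃ o : Polynomial O, Q ∈ T → o.map ι = Q := fun Q => by
    by_cases h : Q ∈ T
    · obtain ⟨o, ho⟩ := hO Q h
      exact ⟨o, fun _ => ho⟩
    · exact ⟨0, fun h' => absurd h' h⟩
  choose L hL using hL
  have hL0 : ∀ s : A, Polynomial.C s ∈ T → ι ((L (Polynomial.C s)).coeff 0) = s := fun s hs => by
    rw [← Polynomial.coeff_map, hL _ hs, Polynomial.coeff_C_zero]
  have hao : (L a).map ι = a := hL a (by simp [hT])
  set ψ : Polynomial O →+* B⟦X⟧ :=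
    (Polynomial.coeToPowerSeries.ringHom (R := B)).comp (Polynomial.mapRingHom φ) with hψ
  have hψP : ∀ P, ψ P = ((P.map φ : Polynomial B) : B⟦X⟧) := fun P => rfl
  have haev : ∀ G, (MvPolynomial.evalInt (fun i => L (η i)) G : Polynomial O).map ι =
      MvPolynomial.evalInt η G := fun G => by
    have := MvPolynomial.map_evalInt (Polynomial.mapRingHom ι) (fun i => L (η i)) G
    simpa only [Polynomial.coe_mapRingHom, hL _ (hηT _)] using this
  have haom : (L a).Monic := Polynomial.monic_of_injective hι (by rw [hao]; exact ha.monic)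
  have hmem : ∀ (Q : Polynomial O) (κ : ℕ → O), Q.coeff 0 = ∑ j ∈ Finset.range n, κ j * x' j →
      ψ Q ∈ maximalIdeal B⟦X⟧ := fun Q κ hQ => by
    rw [PowerSeries.mem_maximalIdeal_iff, hψP, ← hgen, mem_initIdeal_iff]
    refine ⟨fun j => φ (κ j), ?_⟩
    rw [Polynomial.constantCoeff_coe, Polynomial.coeff_map, hQ, map_sum]
    simp
  have ham : ψ (L a) ∈ maximalIdeal B⟦X⟧ := by
    refine hmem _ (fun j => (L (Polynomial.C (β j))).coeff 0) (hι ?_)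
    rw [← Polynomial.coeff_map, hao, hβ, map_sum]
    refine Finset.sum_congr rfl fun j hj => ?_
    rw [Finset.mem_range] at hj
    rw [map_mul, hL0 _ (hβT j hj), hx' j hj]
  refine ⟨B, _, inferInstance, p, ψ (L a), fun i => ψ (L (η i)), hp, hpB, hB, ham, ?_, ?_, ?_, ?_⟩
  · rw [hψP, Ne, Polynomial.coe_eq_zero_iff]
    exact (haom.map φ).ne_zero
  · intro G hG'
    refine ⟨ψ (L (q G)), ?_⟩
    rw [← map_pow, ← map_mul, ← MvPolynomial.map_evalInt ψ]
    congr 1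
    apply hinj
    simp only [Polynomial.coe_mapRingHom, Polynomial.map_mul, Polynomial.map_pow, haev, hao,
      hL _ (hqT G hG'), hq G hG']
  · intro d hd
    refine ⟨ψ (L (b d)), ψ (L (c d)), ?_⟩
    rw [← map_pow, ← map_mul, ← MvPolynomial.map_evalInt ψ, ← map_mul, ← map_sub]
    congr 1
    apply hinj
    simp only [Polynomial.coe_mapRingHom, Polynomial.map_mul, Polynomial.map_pow,
      Polynomial.map_sub, haev, hao, hL _ (hbT d hd), hL _ (hcT d hd), hbc d hd]
  · have hle : initIdeal (fun j => ψ (L (η (v j)))) (n + 1) ≤ maximalIdeal B⟦X⟧ := by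
      rw [initIdeal_le_iff]
      intro j hj
      refine hmem _ (fun i => (L (Polynomial.C (γ j i))).coeff 0) (hι ?_)
      rw [← Polynomial.coeff_map, hL _ (hηT _), hγ j hj, map_sum]
      refine Finset.sum_congr rfl fun i hi => ?_
      rw [Finset.mem_range] at hi
      rw [map_mul, hL0 _ (hγT j hj i hi), hx' i hi]
    have := hB.noeth
    refine initIdeal_eq_of_le_sup_sq (inferInstance) hle ?_
    rw [← PowerSeries.initIdeal_params hgen, initIdeal_le_iff]
    intro j hj
    set Po : Polynomial O := if j < n then Polynomial.C (x' j) else Polynomial.X with hPo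
    have h1 : ψ Po = PowerSeries.params (fun j => φ (x' j)) n j := by
      by_cases h : j < n <;> simp [hψP, hPo, params, h]
    have h2 : Po = ∑ i ∈ Finset.range (n + 1), L (δ j i) * L (η (v i)) + L a ^ 2 * L (ε j) := by
      apply hinj
      have h3 : Po.map ι = P j := by
        by_cases h : j < n
        · simp [hPo, hP, h, hx']
        · simp [hPo, hP, h]
      simp only [Polynomial.coe_mapRingHom, Polynomial.map_mul, Polynomial.map_pow,
        Polynomial.map_add, Polynomial.map_sum, hao, hL _ (hηT _), h3, hL _ (hεT j hj), ← hδε j hj]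
      rw [Finset.sum_congr rfl fun i hi => by
        rw [hL _ (hδT j hj i (Finset.mem_range.mp hi))], add_sub_cancel]
    rw [← h1, h2, map_add, map_sum, map_mul, map_pow]
    refine Ideal.add_mem _ (Ideal.mem_sup_left ?_) (Ideal.mem_sup_right ?_)
    · rw [mem_initIdeal_iff]
      exact ⟨fun i => ψ (L (δ j i)), by simp⟩
    · refine Ideal.mul_mem_right _ _ (Ideal.pow_mem_pow ?_ 2)
      rwa [PowerSeries.initIdeal_params hgen]

lemma PowerSeries.mem_map_C {A : Type u} [CommRing A] {ξ : ℕ → A} {n : ℕ} {g : A⟦X⟧}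
    (h : ∀ i, coeff i g ∈ initIdeal ξ n) : g ∈ initIdeal (PowerSeries.params ξ n) n := by
  choose a ha using fun i => mem_initIdeal_iff.mp (h i)
  rw [mem_initIdeal_iff]
  refine ⟨fun j => PowerSeries.mk fun i => a i j, ?_⟩
  ext i
  rw [ha i, map_sum]
  refine Finset.sum_congr rfl fun j hj => ?_
  rw [Finset.mem_range] at hj
  simp [params, hj, coeff_mul_C]

theorem IsPowerSeriesRing.approximable {k : Type u} [Field k] [CharZero k] : ∀ {n : ℕ} {A : Type u}
    [CommRing A] [IsLocalRing A] {ι : k →+* A} {ξ : ℕ → A}, IsPowerSeriesRing k n A ι ξ →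
    Approximable ξ n := by
  classical
  intro n
  induction n with
  | zero =>
    intro A _ _ ι ξ h
    have hb : Function.Bijective ι := (isPowerSeriesRing_zero k 0).bijective (f := ι) h.reg
      (by rw [initIdeal_zero, ← h.gen, initIdeal_zero]) h.res
    refine (Approximable.map_equiv (RingEquiv.ofBijective ι hb) (approximable_of_field 0)).congr ?_
    rw [initIdeal_zero, initIdeal_zero]
  | succ n ih =>
    intro R _ _ κ ξR hR
    have := hR.reg.isDomain
    have := hR.reg.noeth
    have := hR.prec
    have : IsAdicComplete (maximalIdeal R) R := {}
    have : CharZero R := charZero_of_injective_ringHom κ.injective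
    intro S hS
    have hTfin : (S ∪ ξR '' Set.Iio (n + 1)).Finite := hS.union ((Set.finite_Iio _).image _)
    set T := hTfin.toFinset with hT
    set N := T.card with hN
    set y : Fin N → R := fun i => (T.equivFin.symm i : R) with hy
    have hyT : ∀ s ∈ T, ∃ i, y i = s := fun s hs => ⟨T.equivFin ⟨s, hs⟩, by simp [hy]⟩
    have hv : ∀ j, ∃ i, j < n + 1 → y i = ξR j := fun j => by
      have h0 : ∀ j < n + 1, ∃ i, y i = ξR j := fun j hj => hyT _ (by
        rw [hT, Set.Finite.mem_toFinset]
        exact Or.inr ⟨j, hj, rfl⟩)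
      by_cases h : j < n + 1
      · obtain ⟨i, hi⟩ := h0 j h
        exact ⟨i, fun _ => hi⟩
      · exact ⟨(h0 0 (Nat.succ_pos n)).choose, fun h' => absurd h' h⟩
    choose v hv using hv
    obtain ⟨𝒢, 𝒟, hG, hD, hlift⟩ := exists_lifting N y
    have hΔ : ∏ d ∈ 𝒟, MvPolynomial.evalInt y d ≠ 0 := Finset.prod_ne_zero_iff.mpr hD
    obtain ⟨z, hz, hΔz⟩ := hR.reg.exists_notMem_initIdeal hΔ
    obtain ⟨A, _, _, ι, ξ, hA⟩ := exists_isPowerSeriesRing k n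
    obtain ⟨f, hfκ, hfz⟩ := hA.succ.lift R κ z (fun j hj => hz ▸ mem_initIdeal hj)
    have hbij : Function.Bijective f := by
      refine hA.succ.bijective hR.reg ?_ ?_
      · rw [← hz]
        exact initIdeal_congr hfz
      · intro r
        obtain ⟨c, hc⟩ := hR.res r
        exact ⟨c, by rwa [hfκ]⟩
    set e := RingEquiv.ofBijective f hbij with he
    have hef : ∀ g, e.symm (f g) = g := fun g => e.symm_apply_apply g
    have := hA.reg.noeth
    have := hA.prec
    have : IsAdicComplete (maximalIdeal A) A := {}
    have hev : ∀ G, (e.symm : R →+* A⟦X⟧) (MvPolynomial.evalInt y G) =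
        MvPolynomial.evalInt (fun i => e.symm (y i)) G := fun G =>
      MvPolynomial.map_evalInt (e.symm : R →+* A⟦X⟧) y G
    have hloc : (maximalIdeal R).map (e.symm : R →+* A⟦X⟧) = maximalIdeal A⟦X⟧ := by
      rw [← hz, initIdeal_map, ← hA.succ.gen]
      refine initIdeal_congr fun j hj => ?_
      rw [← hfz j hj]
      exact hef _
    obtain ⟨B, _, _, p, a, η, hp, hpB, hB, ham, ha0, hGη, hDη, hgen⟩ :=
      ih hA |>.exists_approximate_solution hA.gen (fun i => e.symm (y i)) 𝒢 𝒟
      (fun G hG' => by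
        rw [← hev]
        have h0 : MvPolynomial.evalInt y G = 0 := hG G hG'
        rw [h0, map_zero])
      (2 + 2 * N) (by omega) (by
        rw [map_mul, map_X, Finset.prod_congr rfl fun d _ => (hev d).symm, ← map_prod]
        refine mul_ne_zero PowerSeries.X_ne_zero fun h0 => hΔz ?_
        have h1 : e.symm (∏ d ∈ 𝒟, MvPolynomial.evalInt y d) ∈
            initIdeal (PowerSeries.params ξ n) n := by
          refine PowerSeries.mem_map_C fun i => ?_
          rw [hA.gen, ← residue_eq_zero_iff, ← coeff_map]
          exact (congrArg (coeff i) h0).trans (map_zero _)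
        have h2 := Ideal.mem_map_of_mem f h1
        rw [initIdeal_map, initIdeal_congr (y := z) fun j hj => hfz j (by omega)] at h2
        have h3 : f (e.symm (∏ d ∈ 𝒟, MvPolynomial.evalInt y d)) =
          ∏ d ∈ 𝒟, MvPolynomial.evalInt y d := e.apply_symm_apply _
        rwa [h3] at h2)
      v (by
        rw [← hloc, ← hR.gen, initIdeal_map]
        refine initIdeal_congr fun j hj => ?_
        rw [← hv j hj]
        rfl)
    have := PowerSeries.henselianLocalRing B
    have := hB.powerSeries.isDomain
    have := hB.powerSeries.noeth
    obtain ⟨y', hy'1, hy'2⟩ := hlift B⟦X⟧ a ham ha0 2 le_rfl η hGη hDη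
    set F : MvPolynomial (Fin N) ℤ →+* (MvPolynomial.evalInt y).range :=
      (MvPolynomial.evalInt y).rangeRestrict with hF
    have hFs : Function.Surjective F := RingHom.rangeRestrict_surjective _
    have hker : RingHom.ker F ≤ RingHom.ker (MvPolynomial.evalInt y') := fun P hP => by
      refine hy'2 P ?_
      exact congrArg Subtype.val (hP : F P = 0)
    set φ := F.liftOfSurjective hFs ⟨MvPolynomial.evalInt y', hker⟩ with hφ
    have hφF : ∀ P, φ (F P) = MvPolynomial.evalInt y' P := fun P =>
      RingHom.liftOfRightInverse_comp_apply F _ _ ⟨MvPolynomial.evalInt y', hker⟩ P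
    have hX : ∀ {C : Type u} [CommRing C] (w : Fin N → C) i,
      MvPolynomial.evalInt w (MvPolynomial.X i) = w i := fun w i => MvPolynomial.aeval_X w i
    refine ⟨_, _, B⟦X⟧, _, inferInstance, (MvPolynomial.evalInt y).range.subtype, φ, p,
      fun j => F (MvPolynomial.X (v j)), Subtype.val_injective, ?_, hp, ?_, hB.powerSeries, ?_, ?_⟩
    · intro s hs
      obtain ⟨i, rfl⟩ := hyT s (by
        rw [hT, Set.Finite.mem_toFinset]
        exact Or.inl hs)
      exact ⟨F (MvPolynomial.X i), hX y i⟩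
    · have h1 := congrArg (C (R := B)) hpB
      simpa using h1
    · intro j hj
      rw [← hv j hj]
      exact hX y (v j)
    · have h1 : initIdeal (fun j => φ (F (MvPolynomial.X (v j)))) (n + 1) =
          initIdeal (fun j => y' (v j)) (n + 1) := initIdeal_congr fun j _ => by
        rw [hφF, hX]
      rw [h1]
      have hsub : ∀ j, y' (v j) - η (v j) ∈ maximalIdeal B⟦X⟧ ^ 2 := fun j =>
        Ideal.mem_of_dvd _ (hy'1 (v j)) (Ideal.pow_mem_pow ham 2)
      refine initIdeal_eq_of_le_sup_sq inferInstance ?_ ?_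
      · rw [initIdeal_le_iff]
        intro j hj
        have h2 : η (v j) ∈ maximalIdeal B⟦X⟧ := hgen ▸ mem_initIdeal (x := fun j => η (v j)) hj
        have h3 := Ideal.add_mem _ (Ideal.pow_le_self two_ne_zero (hsub j)) h2
        rwa [sub_add_cancel] at h3
      · conv_lhs => rw [← hgen]
        rw [initIdeal_le_iff]
        intro j hj
        have h2 : η (v j) = y' (v j) - (y' (v j) - η (v j)) := by ring
        rw [h2]
        exact Ideal.sub_mem _ (Ideal.mem_sup_left (mem_initIdeal (x := fun j => y' (v j)) hj))
          (Ideal.mem_sup_right (hsub j))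

end Approximation

section Exchange

/-- The ideal generated by the first `n` terms of `s` except for the `j`-th one. -/
def omitIdeal {A : Type u} [CommRing A] (s : ℕ → A) (n j : ℕ) : Ideal A :=
  Ideal.span (s '' {i | i < n ∧ i ≠ j})

variable {A : Type u} [CommRing A] {n : ℕ} {s t : ℕ → A}

lemma omitIdeal_update (j : ℕ) (a : A) : omitIdeal (Function.update s j a) n j = omitIdeal s n j := by
  refine congrArg Ideal.span (Set.image_congr fun i hi => ?_)
  exact Function.update_of_ne hi.2 _ _

lemma initIdeal_eq_omitIdeal_sup {j : ℕ} (hj : j < n) :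
    initIdeal s n = omitIdeal s n j ⊔ Ideal.span {s j} := by
  rw [omitIdeal, ← Ideal.span_union, initIdeal]
  congr 1
  ext x
  constructor
  · rintro ⟨i, hi, rfl⟩
    by_cases h : i = j
    · exact Or.inr (by rw [h]; rfl)
    · exact Or.inl ⟨i, ⟨hi, h⟩, rfl⟩
  · rintro (⟨i, hi, rfl⟩ | h)
    · exact ⟨i, hi.1, rfl⟩
    · exact ⟨j, hj, h.symm⟩

lemma initIdeal_update_eq {j : ℕ} (hj : j < n) (a : A) :
    initIdeal (Function.update s j a) n = omitIdeal s n j ⊔ Ideal.span {a} := by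
  rw [initIdeal_eq_omitIdeal_sup hj, omitIdeal_update, Function.update_self]

lemma mem_omitIdeal_sup_iff {j : ℕ} {a c : A} :
    c ∈ omitIdeal s n j ⊔ Ideal.span {a} ↔ ∃ t, c - a * t ∈ omitIdeal s n j := by
  constructor
  · intro h
    obtain ⟨l, hl, b, hb, rfl⟩ := Submodule.mem_sup.mp h
    obtain ⟨t, rfl⟩ := Ideal.mem_span_singleton.mp hb
    exact ⟨t, by simpa using hl⟩
  · rintro ⟨t, h⟩
    have : c = (c - a * t) + a * t := by ring
    rw [this]
    exact Ideal.add_mem _ (Ideal.mem_sup_left h)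
      (Ideal.mem_sup_right (Ideal.mem_span_singleton.mpr (dvd_mul_right _ _)))

lemma initIdeal_comp_swap {j m : ℕ} (hj : j ≤ m) :
    initIdeal (s ∘ Equiv.swap j m) m = omitIdeal s (m + 1) j := by
  rw [initIdeal, omitIdeal, Set.image_comp]
  congr 2
  ext i
  constructor
  · rintro ⟨l, hl, rfl⟩
    simp only [Set.mem_ofPred_eq] at hl ⊢
    rw [Equiv.swap_apply_def]
    split_ifs <;> omega
  · intro hi
    refine ⟨Equiv.swap j m i, ?_, Equiv.swap_apply_self _ _ _⟩
    simp only [Set.mem_ofPred_eq] at hi ⊢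
    rw [Equiv.swap_apply_def]
    split_ifs <;> omega

/-- Membership in the ideal of `s` can be tested in the ideal of `t` after multiplication by a fixed
element. -/
def Linked (s t : ℕ → A) (n : ℕ) : Prop := ∃ g, ∀ c, c ∈ initIdeal s n ↔ g * c ∈ initIdeal t n

lemma Linked.trans {r : ℕ → A} (h : Linked s t n) (h' : Linked t r n) : Linked s r n := by
  obtain ⟨g, hg⟩ := h
  obtain ⟨g', hg'⟩ := h'
  exact ⟨g' * g, fun c => by rw [hg, hg', mul_assoc]⟩


/-- The sequence `t` with its first `j` terms replaced by powers. -/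
def powFirst (t : ℕ → A) (e : ℕ → ℕ) (j : ℕ) : ℕ → A := fun i => if i < j then t i ^ (e i + 1) else t i

lemma powFirst_zero (e : ℕ → ℕ) : powFirst t e 0 = t := by
  ext i
  simp [powFirst]

lemma powFirst_apply_self (e : ℕ → ℕ) (j : ℕ) : powFirst t e j j = t j := by simp [powFirst]

lemma powFirst_succ (e : ℕ → ℕ) (j : ℕ) :
    powFirst t e (j + 1) = Function.update (powFirst t e j) j (t j ^ (e j + 1)) := by
  ext i
  rcases lt_trichotomy i j with h | h | h
  · rw [Function.update_of_ne h.ne]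
    simp [powFirst, h, h.trans (Nat.lt_succ_self j)]
  · subst h
    simp [powFirst]
  · rw [Function.update_of_ne h.ne']
    simp [powFirst, h.not_gt, show ¬ i < j + 1 by omega]

lemma initIdeal_powFirst (e : ℕ → ℕ) :
    initIdeal (powFirst t e n) n = initIdeal (fun i => t i ^ (e i + 1)) n :=
  initIdeal_congr fun i hi => by simp [powFirst, hi]

/-- Every nonzero ideal of the quotient by `L` contains the class of `Δ`. -/
def SocleGen (L : Ideal A) (Δ : A) : Prop := ∀ y, y ∉ L → ∃ g, g * y - Δ ∈ L

lemma SocleGen.omitIdeal_pow {j : ℕ} {a Δ : A} (h : SocleGen (omitIdeal s n j ⊔ Ideal.span {a}) Δ)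
    (e : ℕ) : SocleGen (omitIdeal s n j ⊔ Ideal.span {a ^ (e + 1)}) (a ^ e * Δ) := by
  induction e with
  | zero => simpa using h
  | succ e ih =>
    intro y hy
    by_cases hy' : y ∈ omitIdeal s n j ⊔ Ideal.span {a ^ (e + 1)}
    · obtain ⟨t, ht⟩ := mem_omitIdeal_sup_iff.mp hy'
      obtain ⟨g, hg⟩ := h t fun h' => hy <| by
        obtain ⟨u, hu⟩ := mem_omitIdeal_sup_iff.mp h'
        refine mem_omitIdeal_sup_iff.mpr ⟨u, ?_⟩
        have : y - a ^ (e + 1 + 1) * u = (y - a ^ (e + 1) * t) + a ^ (e + 1) * (t - a * u) := by ring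
        rw [this]
        exact Ideal.add_mem _ ht (Ideal.mul_mem_left _ _ hu)
      obtain ⟨u, hu⟩ := mem_omitIdeal_sup_iff.mp hg
      refine ⟨g, mem_omitIdeal_sup_iff.mpr ⟨u, ?_⟩⟩
      have : g * y - a ^ (e + 1) * Δ - a ^ (e + 1 + 1) * u =
          g * (y - a ^ (e + 1) * t) + a ^ (e + 1) * (g * t - Δ - a * u) := by ring
      rw [this]
      exact Ideal.add_mem _ (Ideal.mul_mem_left _ _ ht) (Ideal.mul_mem_left _ _ hu)
    · obtain ⟨g, hg⟩ := ih y hy'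
      obtain ⟨u, hu⟩ := mem_omitIdeal_sup_iff.mp hg
      refine ⟨a * g, mem_omitIdeal_sup_iff.mpr ⟨u, ?_⟩⟩
      have : a * g * y - a ^ (e + 1) * Δ - a ^ (e + 1 + 1) * u =
          a * (g * y - a ^ e * Δ - a ^ (e + 1) * u) := by ring
      rw [this]
      exact Ideal.mul_mem_left _ _ hu

lemma SocleGen.pow {Δ : A} (h : SocleGen (initIdeal t n) Δ) (e : ℕ → ℕ) :
    SocleGen (initIdeal (fun i => t i ^ (e i + 1)) n) ((∏ i ∈ Finset.range n, t i ^ e i) * Δ) := by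
  suffices H : ∀ j ≤ n, SocleGen (initIdeal (powFirst t e j) n)
      ((∏ i ∈ Finset.range j, t i ^ e i) * Δ) by
    rw [← initIdeal_powFirst]
    exact H n le_rfl
  intro j
  induction j with
  | zero => intro _; simpa [powFirst_zero] using h
  | succ j ih =>
    intro hj
    have := ih (by omega)
    rw [initIdeal_eq_omitIdeal_sup (j := j) (by omega), powFirst_apply_self] at this
    rw [powFirst_succ, initIdeal_update_eq (by omega), Finset.prod_range_succ, mul_comm _ (t j ^ e j),
      mul_assoc]
    exact this.omitIdeal_pow (e j)

variable [IsLocalRing A]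

/-- `n` elements of the maximal ideal generating an ideal of height at least `n`. -/
structure IsParam (s : ℕ → A) (n : ℕ) : Prop where
  mem : ∀ j < n, s j ∈ maximalIdeal A
  le_height : (n : ℕ∞) ≤ (initIdeal s n).height

lemma IsParam.comp_swap {m j : ℕ} (hj : j ≤ m) (hs : IsParam s (m + 1)) :
    IsParam (s ∘ Equiv.swap j m) (m + 1) := by
  have hlt : ∀ i < m + 1, Equiv.swap j m i < m + 1 := fun i hi => by
    rw [Equiv.swap_apply_def]
    split_ifs <;> omega
  refine ⟨fun i hi => hs.mem _ (hlt i hi), ?_⟩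
  have h : initIdeal (s ∘ Equiv.swap j m) (m + 1) = initIdeal s (m + 1) := by
    rw [initIdeal_succ, initIdeal_comp_swap hj, initIdeal_eq_omitIdeal_sup (j := j) (by omega)]
    simp
  rw [h]
  exact hs.le_height

lemma IsParam.isSMulRegular (hA : CMLoc A n) (hs : IsParam s n) {j : ℕ} (hj : j < n) {y : A}
    (hy : s j * y ∈ omitIdeal s n j) : y ∈ omitIdeal s n j := by
  obtain ⟨m, rfl⟩ := Nat.exists_eq_add_of_le' (Nat.one_le_of_lt hj)
  have hs' := hs.comp_swap (j := j) (by omega)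
  have h := hA.isWeaklyRegular_of_height hs'.mem hs'.le_height m (by omega)
  rw [initIdeal_comp_swap (by omega)] at h
  have h2 := isSMulRegular_iff_right_eq_zero_of_smul.mp h (Ideal.Quotient.mk _ y)
  rw [← Ideal.Quotient.eq_zero_iff_mem]
  refine h2 ?_
  simpa [Algebra.smul_def, ← map_mul, Ideal.Quotient.eq_zero_iff_mem] using hy

lemma IsParam.le_height_omitIdeal (hA : CMLoc A n) (hs : IsParam s n) {j : ℕ} (hj : j < n) :
    ((n - 1 : ℕ) : ℕ∞) ≤ (omitIdeal s n j).height := by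
  obtain ⟨m, rfl⟩ := Nat.exists_eq_add_of_le' (Nat.one_le_of_lt hj)
  have hs' := hs.comp_swap (j := j) (by omega)
  have := hA.noeth
  rw [← initIdeal_comp_swap (by omega)]
  exact le_height_of_isSMulRegular fun i hi =>
    hA.isWeaklyRegular_of_height hs'.mem hs'.le_height i (by omega)

lemma IsParam.not_le (hA : CMLoc A n) (hs : IsParam s n) {j : ℕ} (hj : j < n) {P : Ideal A}
    (hP : P ∈ (omitIdeal s n j).minimalPrimes) {I : Ideal A} (hI : (n : ℕ∞) ≤ I.height) :
    ¬ I ≤ P := by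
  obtain ⟨m, rfl⟩ := Nat.exists_eq_add_of_le' (Nat.one_le_of_lt hj)
  have := hA.noeth
  rw [← initIdeal_comp_swap (by omega)] at hP
  intro h
  have h1 := (hI.trans (Ideal.height_mono h)).trans (height_le_of_mem_minimalPrimes_initIdeal hP)
  have h2 : m + 1 ≤ m := by exact_mod_cast h1
  omega

lemma IsParam.of_radical (ht : ∀ j < n, t j ∈ maximalIdeal A) (hs : IsParam s n)
    (h : ∀ j < n, ∃ k, s j ^ k ∈ initIdeal t n) : IsParam t n := by
  refine ⟨ht, le_height_iff.mpr fun P hP hle => ?_⟩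
  refine hs.le_height.trans (Ideal.height_mono ?_)
  rw [initIdeal_le_iff]
  intro j hj
  obtain ⟨k, hk⟩ := h j hj
  exact hP.mem_of_pow_mem k (hle hk)

lemma IsParam.linked_update (hA : CMLoc A n) {j : ℕ} (hj : j < n) {b : A}
    (hb : b ∈ initIdeal s n) (hs : IsParam (Function.update s j b) n) :
    Linked s (Function.update s j b) n := by
  rw [initIdeal_eq_omitIdeal_sup hj, mem_omitIdeal_sup_iff] at hb
  obtain ⟨g, hg⟩ := hb
  refine ⟨g, fun c => ?_⟩
  rw [initIdeal_update_eq hj, initIdeal_eq_omitIdeal_sup hj, mem_omitIdeal_sup_iff,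
    mem_omitIdeal_sup_iff]
  constructor
  · rintro ⟨y, hy⟩
    refine ⟨y, ?_⟩
    have : g * c - b * y = g * (c - s j * y) - y * (b - s j * g) := by ring
    rw [this]
    exact Ideal.sub_mem _ (Ideal.mul_mem_left _ _ hy) (Ideal.mul_mem_left _ _ hg)
  · rintro ⟨y, hy⟩
    refine ⟨y, ?_⟩
    have h := hs.isSMulRegular hA hj (y := c - s j * y)
    rw [omitIdeal_update, Function.update_self] at h
    refine h ?_
    have : b * (c - s j * y) = s j * (g * c - b * y) + (c - s j * y + s j * y) * (b - s j * g) := by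
      ring
    rw [this]
    exact Ideal.add_mem _ (Ideal.mul_mem_left _ _ hy) (Ideal.mul_mem_left _ _ hg)

lemma IsParam.exists_common (hA : CMLoc A n) (hs : IsParam s n) (ht : IsParam t n) {j : ℕ}
    (hj : j < n) : ∃ b ∈ initIdeal s n, IsParam (Function.update s j b) n ∧
      IsParam (Function.update t j b) n := by
  have := hA.noeth
  have hfin : ((omitIdeal s n j).minimalPrimes ∪ (omitIdeal t n j).minimalPrimes).Finite :=
    (Ideal.finite_minimalPrimes_of_isNoetherianRing _ _).union
      (Ideal.finite_minimalPrimes_of_isNoetherianRing _ _)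
  have key : ¬ ((initIdeal s n : Set A) ⊆
      ⋃ P ∈ (hfin.toFinset : Set (Ideal A)), ((id P : Ideal A) : Set A)) := by
    rw [Ideal.subset_union_prime ⊥ ⊥]
    · rintro ⟨P, hP, hle⟩
      rcases hfin.mem_toFinset.mp hP with h | h
      · exact hs.not_le hA hj h hs.le_height hle
      · exact ht.not_le hA hj h hs.le_height hle
    · intro P hP _ _
      rcases hfin.mem_toFinset.mp hP with h | h
      · exact h.1.1
      · exact h.1.1
  obtain ⟨b, hb, hb'⟩ := Set.not_subset.mp key
  have hbP : ∀ P ∈ (omitIdeal s n j).minimalPrimes ∪ (omitIdeal t n j).minimalPrimes, b ∉ P :=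
    fun P hP h => hb' (Set.mem_biUnion (hfin.mem_toFinset.mpr hP) h)
  have hsle : initIdeal s n ≤ maximalIdeal A := initIdeal_le_iff.mpr hs.mem
  have aux : ∀ r : ℕ → A, IsParam r n → (∀ P ∈ (omitIdeal r n j).minimalPrimes, b ∉ P) →
      IsParam (Function.update r j b) n := fun r hr hbr => by
    refine ⟨fun i hi => ?_, ?_⟩
    · by_cases h : i = j
      · rw [h, Function.update_self]
        exact hsle hb
      · rw [Function.update_of_ne h]
        exact hr.mem i hi
    · rw [initIdeal_update_eq hj]
      have := add_one_le_height_sup (hr.le_height_omitIdeal hA hj) hbr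
      have hn : ((n - 1 : ℕ) : ℕ∞) + 1 = n := by
        have : n - 1 + 1 = n := by omega
        exact_mod_cast this
      rwa [hn] at this
  exact ⟨b, hb, aux s hs fun P hP => hbP P (Or.inl hP), aux t ht fun P hP => hbP P (Or.inr hP)⟩

lemma IsParam.exists_pow_mem (hA : CMLoc A n) (hs : IsParam s n) {a : A}
    (ha : a ∈ maximalIdeal A) : ∃ k, a ^ (k + 1) ∈ initIdeal s n := by
  obtain ⟨k, hk⟩ := hA.maximalIdeal_le_radical hs.le_height ha
  exact ⟨k, Ideal.mem_of_dvd _ (pow_dvd_pow _ (Nat.le_succ k)) hk⟩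

lemma IsParam.linked_pow (hA : CMLoc A n) (hs : IsParam s n) (ht : IsParam t n) :
    ∃ e : ℕ → ℕ, Linked s (fun i => t i ^ (e i + 1)) n := by
  suffices h : ∀ j ≤ n, ∀ s t : ℕ → A, IsParam s n → IsParam t n → (∀ i, j ≤ i → i < n → s i = t i) →
      ∃ e : ℕ → ℕ, (∀ i, j ≤ i → e i = 0) ∧ Linked s (fun i => t i ^ (e i + 1)) n by
    obtain ⟨e, -, he⟩ := h n le_rfl s t hs ht (fun i h1 h2 => absurd h1 (by omega))
    exact ⟨e, he⟩
  intro j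
  induction j with
  | zero =>
    intro _ s t hs ht hst
    refine ⟨0, fun _ _ => rfl, 1, fun c => ?_⟩
    rw [one_mul, initIdeal_congr (x := s) (y := fun i => t i ^ (0 + 1))]
    · rfl
    · intro i hi
      rw [hst i (Nat.zero_le _) hi, zero_add, pow_one]
  | succ j ih =>
    intro hj s t hs ht hst
    obtain ⟨b, hb, hsb, htb⟩ := hs.exists_common hA ht (j := j) (by omega)
    obtain ⟨e, he0, he⟩ := ih (by omega) _ _ hsb htb (fun i h1 h2 => by
      by_cases h : i = j
      · rw [h, Function.update_self, Function.update_self]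
      · rw [Function.update_of_ne h, Function.update_of_ne h, hst i (by omega) h2])
    set t' : ℕ → A := fun i => Function.update t j b i ^ (e i + 1) with ht'
    have ht'p : IsParam t' n := htb.of_radical
      (fun i hi => Ideal.pow_mem_of_mem _ (htb.mem i hi) _ (Nat.succ_pos _))
      (fun i hi => ⟨e i + 1, mem_initIdeal (x := t') hi⟩)
    obtain ⟨k, hk⟩ := ht'p.exists_pow_mem hA (ht.mem j (by omega))
    have hupd : Function.update t' j (t j ^ (k + 1)) =
        fun i => t i ^ (Function.update e j k i + 1) := by
      ext i
      by_cases h : i = j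
      · subst h; simp
      · simp [Function.update_of_ne h, ht']
    refine ⟨Function.update e j k, fun i hi => ?_, ?_⟩
    · rw [Function.update_of_ne (by omega)]
      exact he0 i (by omega)
    · rw [← hupd]
      refine (IsParam.linked_update hA (by omega) hb hsb).trans (he.trans ?_)
      refine IsParam.linked_update hA (by omega) hk ?_
      rw [hupd]
      exact ht.of_radical
        (fun i hi => Ideal.pow_mem_of_mem _ (ht.mem i hi) _ (Nat.succ_pos _))
        (fun i hi => ⟨_, mem_initIdeal (x := fun i => t i ^ (Function.update e j k i + 1)) hi⟩)

lemma IsParam.powFirst (ht : IsParam t n) (e : ℕ → ℕ) (j : ℕ) : IsParam (powFirst t e j) n := by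
  refine ht.of_radical (fun i hi => ?_) fun i hi => ?_
  · rw [_root_.powFirst]
    split_ifs
    · exact Ideal.pow_mem_of_mem _ (ht.mem i hi) _ (Nat.succ_pos _)
    · exact ht.mem i hi
  · by_cases h : i < j
    · exact ⟨e i + 1, by simpa [_root_.powFirst, h] using mem_initIdeal (x := _root_.powFirst t e j) hi⟩
    · exact ⟨1, by simpa [_root_.powFirst, h] using mem_initIdeal (x := _root_.powFirst t e j) hi⟩

lemma IsParam.pow_mul_mem (hA : CMLoc A n) (hs : IsParam s n) {j : ℕ} (hj : j < n) {y : A} {e : ℕ}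
    (hy : s j ^ e * y ∈ omitIdeal s n j) : y ∈ omitIdeal s n j := by
  induction e with
  | zero => simpa using hy
  | succ e ih =>
    refine ih (hs.isSMulRegular hA hj ?_)
    rwa [← mul_assoc, ← pow_succ']

lemma IsParam.prod_notMem (hA : CMLoc A n) (ht : IsParam t n) (e : ℕ → ℕ) :
    ∏ i ∈ Finset.range n, t i ^ e i ∉ initIdeal (fun i => t i ^ (e i + 1)) n := by
  suffices H : ∀ j ≤ n, ∏ i ∈ Finset.range j, t i ^ e i ∉ initIdeal (_root_.powFirst t e j) n by
    rw [← initIdeal_powFirst]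
    exact H n le_rfl
  intro j
  induction j with
  | zero =>
    intro _ h
    rw [Finset.range_zero, Finset.prod_empty, powFirst_zero, ← Ideal.eq_top_iff_one] at h
    exact (maximalIdeal.isMaximal A).ne_top (top_le_iff.mp (h ▸ initIdeal_le_iff.mpr ht.mem))
  | succ j ih =>
    intro hj h
    refine ih (by omega) ?_
    rw [powFirst_succ, initIdeal_update_eq (by omega), mem_omitIdeal_sup_iff] at h
    obtain ⟨u, hu⟩ := h
    rw [initIdeal_eq_omitIdeal_sup (j := j) (by omega), powFirst_apply_self, mem_omitIdeal_sup_iff]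
    refine ⟨u, (ht.powFirst e j).pow_mul_mem hA (j := j) (e := e j) (by omega) ?_⟩
    rw [powFirst_apply_self]
    convert hu using 1
    rw [Finset.prod_range_succ]
    ring

end Exchange

section Transport

lemma exists_notMem_sup_pow {R : Type u} [CommRing R] [IsLocalRing R] [IsNoetherianRing R]
    {J : Ideal R} {c : R} (hc : c ∉ J) : ∃ N, c ∉ J ⊔ maximalIdeal R ^ N := by
  by_contra! h3
  have hJ : J ≠ ⊤ := fun h => hc (h ▸ Submodule.mem_top)
  have : IsLocalRing (R ⧸ J) := isLocalRing_quotient hJ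
  have hK := Ideal.iInf_pow_eq_bot_of_isLocalRing (maximalIdeal (R ⧸ J))
    (maximalIdeal.isMaximal _).ne_top
  have : Ideal.Quotient.mk J c ∈ (⨅ N, maximalIdeal (R ⧸ J) ^ N : Ideal (R ⧸ J)) := by
    rw [Ideal.mem_iInf]
    intro N
    rw [maximalIdeal_quotient J, ← Ideal.map_pow, Ideal.mem_quotient_iff_mem_sup, sup_comm]
    exact h3 N
  rw [hK, Ideal.mem_bot, Ideal.Quotient.eq_zero_iff_mem] at this
  exact hc this

/-- Membership in a finitely generated ideal descends to subrings containing finitely many given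
elements. -/
lemma exists_finite_mem_initIdeal {R : Type u} [CommRing R] {w : ℕ → R} {h : ℕ} {a : R}
    (ha : a ∈ initIdeal w h) : ∃ S : Set R, S.Finite ∧ ∀ (O : Type u) [CommRing O] (ι : O →+* R),
      Function.Injective ι → (∀ s ∈ S, ∃ o, ι o = s) → ∀ (a' : O) (w' : ℕ → O), ι a' = a →
        (∀ j < h, ι (w' j) = w j) → a' ∈ initIdeal w' h := by
  obtain ⟨b, hb⟩ := mem_initIdeal_iff.mp ha
  refine ⟨b '' Set.Iio h, (Set.finite_Iio h).image _, fun O _ ι hι hS a' w' ha' hw' => ?_⟩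
  have : ∀ j, ∃ o, j < h → ι o = b j := fun j => by
    by_cases hj : j < h
    · obtain ⟨o, ho⟩ := hS (b j) ⟨j, hj, rfl⟩
      exact ⟨o, fun _ => ho⟩
    · exact ⟨0, fun h => absurd h hj⟩
  choose o ho using this
  refine mem_initIdeal_iff.mpr ⟨o, hι ?_⟩
  rw [ha', hb, map_sum]
  refine Finset.sum_congr rfl fun j hj => ?_
  have hj := Finset.mem_range.mp hj
  rw [map_mul, ho j hj, hw' j hj]

/-- A family of finitely many memberships descends simultaneously. -/
lemma exists_finite_mem_initIdeal_forall {R : Type u} [CommRing R] {w : ℕ → R} {h : ℕ}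
    {τ : Type*} [Finite τ] {a : τ → R} (ha : ∀ i, a i ∈ initIdeal w h) :
    ∃ S : Set R, S.Finite ∧ ∀ (O : Type u) [CommRing O] (ι : O →+* R),
      Function.Injective ι → (∀ s ∈ S, ∃ o, ι o = s) → ∀ (a' : τ → O) (w' : ℕ → O),
        (∀ i, ι (a' i) = a i) → (∀ j < h, ι (w' j) = w j) → ∀ i, a' i ∈ initIdeal w' h := by
  choose S hS hS' using fun i => exists_finite_mem_initIdeal (ha i)
  refine ⟨⋃ i, S i, Set.finite_iUnion hS, fun O _ ι hι hO a' w' ha' hw' i => ?_⟩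
  exact hS' i O ι hι (fun s hs => hO s (Set.mem_iUnion.mpr ⟨i, hs⟩)) _ _ (ha' i) hw'

lemma ChaseData.exists_finite_lift {R : Type u} [CommRing R] {r : ℕ} {b : ℕ → ℕ} {t : ℕ}
    (N : ChaseData R r b t) : ∃ S : Set R, S.Finite ∧ ∀ (O : Type u) [CommRing O] (ι : O →+* R),
      Function.Injective ι → (∀ s ∈ S, ∃ o, ι o = s) → ∃ N' : ChaseData O r b t,
        (∀ i ≤ r, ι (N'.x i) = N.x i) ∧ (∀ j, ι (N'.f j) = N.f j) ∧
        ∀ j, ι (Matrix.vecMul N'.e (N'.D 0) j) = Matrix.vecMul N.e (N.D 0) j := by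
  classical
  refine ⟨(⋃ l : Fin (r + 1), Set.range fun q : Fin (b l) × Fin (b (l + 1)) => N.D l q.1 q.2) ∪
    (Set.range fun i : Fin (r + 1) => N.x i) ∪
    (⋃ m : Fin r × Fin (r + 1), Set.range fun q : Fin (b (m.1 + 2)) × Fin (b (m.1 + 1)) =>
      N.H m.1 m.2 q.1 q.2) ∪
    (⋃ m : Fin r × Fin (r + 1), Set.range fun q : Fin (b (m.1 + 1)) × Fin (b m.1) =>
      N.G m.1 m.2 q.1 q.2) ∪ Set.range N.ζ ∪ Set.range N.e ∪ Set.range N.v ∪ Set.range N.f ∪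
    (Set.range fun q : Fin t × Fin (b 0) => N.y q.1 q.2), ?_, ?_⟩
  · refine .union (.union (.union (.union (.union (.union (.union (.union ?_ ?_) ?_) ?_) ?_) ?_) ?_)
      ?_) ?_
    all_goals first
      | exact Set.finite_range _
      | exact Set.finite_iUnion fun _ => Set.finite_range _
  · intro O _ ι hι hS
    have hlift : ∀ a, ∃ o, (∃ o, ι o = a) → ι o = a := fun a => by
      by_cases h : ∃ o, ι o = a
      · exact ⟨h.choose, fun _ => h.choose_spec⟩
      · exact ⟨0, fun h' => absurd h' h⟩
    choose L hL' using hlift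
    have hL := fun a ha => hL' a (hS a ha)
    have hD : ∀ l ≤ r, ((N.D l).map L).map ι = N.D l := fun l hl => by
      ext i j
      refine hL _ ?_
      iterate 8 left
      exact Set.mem_iUnion.mpr ⟨⟨l, by omega⟩, ⟨i, j⟩, rfl⟩
    have hx : ∀ i ≤ r, ι (L (N.x i)) = N.x i := fun i hi => by
      refine hL _ ?_
      iterate 7 left
      exact Or.inr ⟨⟨i, by omega⟩, rfl⟩
    have hH : ∀ m < r, ∀ i ≤ m + 1, ((N.H m i).map L).map ι = N.H m i := fun m hm i hi => by
      ext j k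
      refine hL _ ?_
      iterate 6 left
      exact Or.inr (Set.mem_iUnion.mpr ⟨⟨⟨m, hm⟩, ⟨i, by omega⟩⟩, ⟨j, k⟩, rfl⟩)
    have hG : ∀ m < r, ∀ i ≤ m + 1, ((N.G m i).map L).map ι = N.G m i := fun m hm i hi => by
      ext j k
      refine hL _ ?_
      iterate 5 left
      exact Or.inr (Set.mem_iUnion.mpr ⟨⟨⟨m, hm⟩, ⟨i, by omega⟩⟩, ⟨j, k⟩, rfl⟩)
    have hζ : ∀ i, ι (L (N.ζ i)) = N.ζ i := fun i => by
      refine hL _ ?_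
      iterate 4 left
      exact Or.inr ⟨i, rfl⟩
    have he : ∀ i, ι (L (N.e i)) = N.e i := fun i => by
      refine hL _ ?_
      iterate 3 left
      exact Or.inr ⟨i, rfl⟩
    have hv : ∀ i, ι (L (N.v i)) = N.v i := fun i => by
      refine hL _ ?_
      iterate 2 left
      exact Or.inr ⟨i, rfl⟩
    have hf : ∀ i, ι (L (N.f i)) = N.f i := fun i => hL _ (Or.inl (Or.inr ⟨i, rfl⟩))
    have hy : ∀ j i, ι (L (N.y j i)) = N.y j i := fun j i => hL _ (Or.inr ⟨⟨j, i⟩, rfl⟩)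
    refine ⟨
      { D := fun l => (N.D l).map L
        x := fun i => if i = r then 1 else L (N.x i)
        H := fun m i => (N.H m i).map L
        G := fun m i => (N.G m i).map L
        ζ := fun i => L (N.ζ i)
        e := fun i => L (N.e i)
        v := fun i => L (N.v i)
        f := fun i => L (N.f i)
        y := fun j i => L (N.y j i)
        dd := fun l hl => ?_
        xr := if_pos rfl
        hom := fun m hm i hi => ?_
        rel := ?_
        eζ := ?_ }, ?_, hf, ?_⟩
    · refine Matrix.map_injective hι ?_
      beta_reduce
      rw [Matrix.map_mul, hD l hl.le, hD (l + 1) hl, N.dd l hl, Matrix.map_zero _ (map_zero ι)]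
    · have hxi : ι (if i = r then 1 else L (N.x i)) = N.x i := by
        split_ifs with h
        · rw [h, N.xr, map_one]
        · exact hx i (by omega)
      refine Matrix.map_injective hι ?_
      beta_reduce
      rw [Matrix.map_add _ (map_add ι), Matrix.map_mul, Matrix.map_mul, hD m hm.le, hD (m + 1) hm,
        hH m hm i hi, hG m hm i hi, ← N.hom m hm i hi]
      ext j k
      simp only [Matrix.map_apply, Matrix.smul_apply, smul_eq_mul, map_mul, Matrix.one_apply, hxi]
      by_cases hjk : j = k
      · simp only [if_pos hjk, map_one]
      · simp only [if_neg hjk, map_zero]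
    · have hx0 : ι (if 0 = r then 1 else L (N.x 0)) = N.x 0 := by
        split_ifs with h
        · rw [h, N.xr, map_one]
        · exact hx 0 (by omega)
      ext i
      refine hι ?_
      have h1 := congrFun N.rel i
      have h2 : ∀ j, ι (L (N.D 0 i j)) = N.D 0 i j := fun j => congrFun (congrFun (hD 0 (Nat.zero_le r)) i) j
      simp only [Pi.smul_apply, smul_eq_mul, Pi.add_apply, Matrix.mulVec, dotProduct,
        Finset.sum_apply, map_mul, map_add, map_sum, Matrix.map_apply, hx0, hζ, hv, hf, hy, h2] at h1 ⊢
      exact h1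
    · refine hι ?_
      have h1 := N.eζ
      simp only [dotProduct, map_sum, map_mul, he, hζ, map_one] at h1 ⊢
      exact h1
    · intro i hi
      change ι (if i = r then 1 else L (N.x i)) = N.x i
      split_ifs with h
      · rw [h, N.xr, map_one]
      · exact hx i hi
    · intro j
      have h2 : ∀ i, ι (L (N.D 0 i j)) = N.D 0 i j := fun i => congrFun (congrFun (hD 0 (Nat.zero_le r)) i) j
      simp only [Matrix.vecMul, dotProduct, map_sum, map_mul, Matrix.map_apply, he, h2]

lemma RegLoc.isParam {A : Type u} [CommRing A] [IsLocalRing A] {n : ℕ} (hA : RegLoc A n) {s : ℕ → A}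
    (hsm : ∀ j < n, s j ∈ maximalIdeal A) (hrad : maximalIdeal A ≤ (initIdeal s n).radical) :
    IsParam s n := by
  refine ⟨hsm, le_height_iff.mpr fun P hP hle => ?_⟩
  rw [← hA.cmLoc.height]
  exact Ideal.height_mono (hrad.trans (hP.radical_le_iff.mpr hle))

theorem ChaseData.mem_initIdeal_of_approximable {A : Type u} [CommRing A] [IsLocalRing A] {n : ℕ}
    (hA : RegLoc A n) {ξ : ℕ → A} (hξ : initIdeal ξ n = maximalIdeal A) (hap : Approximable ξ n)
    {h r : ℕ} {b : ℕ → ℕ} {t : ℕ} (hn : h + r = n) {s : ℕ → A} (hsm : ∀ j < n, s j ∈ maximalIdeal A)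
    (hrad : maximalIdeal A ≤ (initIdeal s n).radical) (N : ChaseData A r b t)
    (hx : ∀ i < r, N.x i = s (h + i)) {c : A} (hcf : ∀ j, c * N.f j ∈ initIdeal s h)
    (heD : ∀ j, Matrix.vecMul N.e (N.D 0) j ∈ maximalIdeal A) : c ∈ initIdeal s h := by
  have := hA.noeth
  by_contra hc
  obtain ⟨M, hM⟩ := exists_notMem_sup_pow hc
  have hs := hA.isParam hsm hrad
  have hξp : IsParam ξ n := hA.isParam (fun j hj => hξ ▸ _root_.mem_initIdeal hj)
    (hξ ▸ Ideal.le_radical)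
  set q : ℕ → A := fun j => if j < h then s j else s j ^ (M + 1) with hq
  have hqs : ∀ j < h, q j = s j := fun j hj => if_pos hj
  have hqp : IsParam q n := hs.of_radical
    (fun j hj => by
      simp only [hq]
      split_ifs
      · exact hsm j hj
      · exact Ideal.pow_mem_of_mem _ (hsm j hj) _ (Nat.succ_pos _))
    (fun j hj => by
      have h1 : q j ∈ initIdeal q n := _root_.mem_initIdeal hj
      simp only [hq] at h1
      split_ifs at h1
      · exact ⟨1, by rwa [pow_one]⟩
      · exact ⟨M + 1, h1⟩)
  have hcq : c ∉ initIdeal q n := fun h1 => hM <| by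
    refine (initIdeal_le_iff.mpr fun j hj => ?_ : initIdeal q n ≤ _) h1
    simp only [hq]
    split_ifs with hjh
    · exact Ideal.mem_sup_left (_root_.mem_initIdeal hjh)
    · exact Ideal.mem_sup_right
        (Ideal.pow_le_pow_right (Nat.le_succ M) (Ideal.pow_mem_pow (hsm j hj) _))
  obtain ⟨e, g, hg⟩ := hqp.linked_pow hA.cmLoc hξp
  have hsoc : SocleGen (initIdeal ξ n) (1 : A) := fun y hy => by
    rw [hξ, mem_maximalIdeal, mem_nonunits_iff, not_not] at hy
    obtain ⟨z, hz⟩ := hy.exists_left_inv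
    exact ⟨z, by rw [hz, sub_self]; exact zero_mem _⟩
  obtain ⟨g', hg'⟩ := hsoc.pow e (g * c) (fun h1 => hcq ((hg c).mpr h1))
  rw [mul_one, ← mul_assoc] at hg'
  have hμ : ∀ i : Fin h, g' * g * s i ∈ initIdeal (fun i => ξ i ^ (e i + 1)) n := fun i => by
    rw [mul_assoc]
    refine Ideal.mul_mem_left _ _ ((hg _).mp ?_)
    rw [← hqs i i.2]
    exact _root_.mem_initIdeal (by omega)
  have hpow : ∃ T : ℕ, ∀ j : Fin n, ξ j ^ T ∈ initIdeal s n := by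
    obtain ⟨T, hT⟩ := Ideal.exists_radical_pow_le_of_fg (initIdeal s n)
      (IsNoetherian.noetherian _)
    refine ⟨T, fun j => hT (Ideal.pow_mem_pow (hrad ?_) _)⟩
    rw [← hξ]
    exact _root_.mem_initIdeal j.2
  obtain ⟨T, hT⟩ := hpow
  rw [← hξ] at heD
  obtain ⟨S1, hS1, lift1⟩ := N.exists_finite_lift
  obtain ⟨S2, hS2, lift2⟩ := exists_finite_mem_initIdeal_forall hcf
  obtain ⟨S3, hS3, lift3⟩ := exists_finite_mem_initIdeal_forall heD
  obtain ⟨S4, hS4, lift4⟩ := exists_finite_mem_initIdeal_forall hμ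
  obtain ⟨S5, hS5, lift5⟩ := exists_finite_mem_initIdeal_forall hT
  obtain ⟨S6, hS6, lift6⟩ := exists_finite_mem_initIdeal_forall (τ := Fin n) (w := ξ) (h := n)
    (a := fun j => s j) fun j => hξ ▸ hsm j j.2
  obtain ⟨S7, hS7, lift7⟩ := exists_finite_mem_initIdeal hg'
  obtain ⟨O, _, B, _, _, ι, φ, p, ξ', hι, hO, hp, hpB, hB, hξ', hgen⟩ :=
    hap ({c, g' * g} ∪ s '' Set.Iio n ∪ S1 ∪ S2 ∪ S3 ∪ S4 ∪ S5 ∪ S6 ∪ S7)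
      ((((((((((Set.toFinite _).union ((Set.finite_Iio n).image s)).union hS1).union hS2).union
        hS3).union hS4).union hS5).union hS6).union hS7))
  obtain ⟨N', hNx, hNf, hNe⟩ := lift1 O ι hι fun a ha => hO a (by simp [ha])
  obtain ⟨c', hc'⟩ := hO c (by simp)
  obtain ⟨μ, hμ'⟩ := hO (g' * g) (by simp)
  have : ∀ j, ∃ o, j < n → ι o = s j := fun j => by
    by_cases hj : j < n
    · obtain ⟨o, ho⟩ := hO (s j) (by
        iterate 7 left
        exact Or.inr ⟨j, hj, rfl⟩)
      exact ⟨o, fun _ => ho⟩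
    · exact ⟨0, fun h => absurd h hj⟩
  choose s' hs' using this
  have hξpow : ∀ j < n, ι (ξ' j ^ (e j + 1)) = ξ j ^ (e j + 1) := fun j hj => by
    rw [map_pow, hξ' j hj]
  have m2 := lift2 O ι hι (fun a ha => hO a (by simp [ha])) (fun j => c' * N'.f j) s'
    (fun j => by rw [map_mul, hc', hNf]) (fun j hj => hs' j (by omega))
  have m3 := lift3 O ι hι (fun a ha => hO a (by simp [ha])) _ ξ' hNe hξ'
  have m4 := lift4 O ι hι (fun a ha => hO a (by simp [ha])) (fun i => μ * s' i)
    (fun j => ξ' j ^ (e j + 1)) (fun i => by rw [map_mul, hμ', hs' i (by omega)]) hξpow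
  have m5 := lift5 O ι hι (fun a ha => hO a (by simp [ha])) (fun j => ξ' j ^ T) s'
    (fun j => by rw [map_pow, hξ' j j.2]) hs'
  have m6 := lift6 O ι hι (fun a ha => hO a (by simp [ha])) (fun j => s' j) ξ'
    (fun j => hs' j j.2) hξ'
  have m7 := lift7 O ι hι (fun a ha => hO a (by simp [ha]))
    (μ * c' - ∏ i ∈ Finset.range n, ξ' i ^ e i) (fun j => ξ' j ^ (e j + 1))
    (by
      rw [map_sub, map_mul, hμ', hc', map_prod, Finset.prod_congr rfl fun i hi => ?_]
      rw [map_pow, hξ' i (Finset.mem_range.mp hi)]) hξpow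
  have down : ∀ {a : O} {w : ℕ → O} {h : ℕ}, a ∈ initIdeal w h →
      φ a ∈ initIdeal (fun j => φ (w j)) h := fun {a w h} ha => by
    have := Ideal.mem_map_of_mem φ ha
    rwa [initIdeal_map] at this
  have hsB : ∀ j < n, φ (s' j) ∈ maximalIdeal B := fun j hj => hgen ▸ down (m6 ⟨j, hj⟩)
  have hradB : maximalIdeal B ≤ (initIdeal (fun j => φ (s' j)) n).radical := by
    rw [← hgen, initIdeal_le_iff]
    intro j hj
    exact ⟨T, by simpa using down (m5 ⟨j, hj⟩)⟩
  have hcB : φ c' ∈ initIdeal (fun j => φ (s' j)) h := by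
    refine (N'.map φ).mem_initIdeal hn hB.cmLoc hsB hradB p hp (by rw [hpB]; exact zero_mem _)
      (fun i hi => ?_) (fun j => ?_) (fun j => ?_)
    · rw [map_x]
      congr 1
      refine hι ?_
      rw [hNx i hi.le, hx i hi, hs' _ (by omega)]
    · simpa using down (m2 j)
    · rw [vecMul_map, ← hgen]
      exact down (m3 j)
  have hξB : IsParam (fun j => φ (ξ' j)) n := hB.isParam
    (fun j hj => hgen ▸ _root_.mem_initIdeal (x := fun j => φ (ξ' j)) hj) (hgen ▸ Ideal.le_radical)
  refine hξB.prod_notMem hB.cmLoc e ?_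
  have h1 : φ μ * φ c' ∈ initIdeal (fun i => φ (ξ' i) ^ (e i + 1)) n := by
    have h2 : initIdeal (fun j => φ (s' j)) h ≤
        Submodule.comap (LinearMap.mulLeft B (φ μ)) (initIdeal (fun i => φ (ξ' i) ^ (e i + 1)) n) := by
      refine Ideal.span_le.mpr ?_
      rintro _ ⟨j, hj, rfl⟩
      have := down (m4 ⟨j, hj⟩)
      simpa using this
    exact h2 hcB
  have h3 := down m7
  simp only [map_sub, map_mul, map_prod, map_pow] at h3
  have := Ideal.sub_mem _ h1 h3
  rwa [sub_sub_cancel] at this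

/-- The residue characteristic free form of `ChaseData.mem_initIdeal`. -/
theorem ChaseData.mem_initIdeal_of_isUnit {R : Type u} [CommRing R] [IsLocalRing R] {n : ℕ}
    (hR : RegLoc R n) (hchar : ∀ p : ℕ, p.Prime → IsUnit (p : R))
    {h r : ℕ} {b : ℕ → ℕ} {t : ℕ} (hn : h + r = n) {s : ℕ → R} (hsm : ∀ j < n, s j ∈ maximalIdeal R)
    (hrad : maximalIdeal R ≤ (initIdeal s n).radical) (N : ChaseData R r b t)
    (hx : ∀ i < r, N.x i = s (h + i)) {c : R} (hcf : ∀ j, c * N.f j ∈ initIdeal s h)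
    (heD : ∀ j, Matrix.vecMul N.e (N.D 0) j ∈ maximalIdeal R) : c ∈ initIdeal s h := by
  obtain ⟨x, hxm⟩ := hR.gen
  obtain ⟨k, _, A, _, _, κ, ξ, g, hA, hgx, hdesc⟩ := hR.exists_completion hchar hxm
  have hgm : (maximalIdeal R).map g = maximalIdeal A := by
    rw [← hxm, initIdeal_map, ← hA.gen]
    exact initIdeal_congr hgx
  have hmem : ∀ a ∈ maximalIdeal R, g a ∈ maximalIdeal A := fun a ha =>
    hgm ▸ Ideal.mem_map_of_mem g ha
  have : CharZero k := by
    have : ∀ p : ℕ, p.Prime → (p : k) ≠ 0 := fun p hp h0 => by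
      have h1 := (hchar p hp).map g
      rw [map_natCast, ← map_natCast κ, h0, map_zero, isUnit_zero_iff] at h1
      exact zero_ne_one h1
    obtain ⟨p, hp⟩ := CharP.exists k
    rcases CharP.char_is_prime_or_zero k p with h1 | h1
    · exact absurd (CharP.cast_eq_zero k p) (this p h1)
    · subst h1
      exact CharP.charP_to_charZero k
  refine hdesc _ _ ?_
  rw [initIdeal_map]
  refine ChaseData.mem_initIdeal_of_approximable hA.reg hA.gen hA.approximable hn
    (fun j hj => hmem _ (hsm j hj)) ?_ (N.map g) (fun i hi => ?_) (fun j => ?_) (fun j => ?_)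
  · rw [← hgm, Ideal.map_le_iff_le_comap, ← initIdeal_map]
    exact hrad.trans (Ideal.le_comap_map.trans (Ideal.comap_mono (Ideal.map_radical_le g)))
  · rw [map_x, hx i hi]
  · have := Ideal.mem_map_of_mem g (hcf j)
    rwa [initIdeal_map, map_mul] at this
  · rw [vecMul_map]
    exact hmem _ (heD j)

end Transport

section Resolution

variable {A B : Type u} [CommRing A] [CommRing B] {b : ℕ → ℕ}

/-- An exact sequence of finite free modules, given by matrices. -/
structure MatRes (A : Type u) [CommRing A] (b : ℕ → ℕ) where
  D : ∀ l, Matrix (Fin (b l)) (Fin (b (l + 1))) A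
  dd : ∀ l, D l * D (l + 1) = 0
  exact : ∀ l v, (D l).mulVec v = 0 → ∃ w, v = (D (l + 1)).mulVec w

lemma Matrix.mulVec_mem_ideal {m n : ℕ} (M : Matrix (Fin m) (Fin n) A) {v : Fin n → A} {I : Ideal A}
    (hv : ∀ k, v k ∈ I) (i : Fin m) : M.mulVec v i ∈ I := by
  simp only [Matrix.mulVec, dotProduct]
  exact I.sum_mem fun k _ => I.mul_mem_left _ (hv k)

lemma exists_matrix_of_forall_mulVec {m n p : ℕ} {M : Matrix (Fin m) (Fin n) A}
    {N : Matrix (Fin m) (Fin p) A} (h : ∀ v, ∃ w, N.mulVec v = M.mulVec w) :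
    ∃ X : Matrix (Fin n) (Fin p) A, N = M * X := by
  choose w hw using fun j : Fin p => h (Pi.single j 1)
  refine ⟨Matrix.of fun i j => w j i, ?_⟩
  ext i j
  have := congrFun (hw j) i
  rw [Matrix.mulVec_single_one] at this
  simpa [Matrix.mul_apply, Matrix.mulVec, dotProduct] using this

lemma exists_exact_next [IsNoetherianRing A] {m n : ℕ} (M : Matrix (Fin m) (Fin n) A) :
    ∃ (k : ℕ) (M' : Matrix (Fin n) (Fin k) A), M * M' = 0 ∧
      ∀ v, M.mulVec v = 0 → ∃ w, v = M'.mulVec w := by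
  obtain ⟨k, f, hf⟩ := Module.Finite.exists_fin' A (LinearMap.ker M.mulVecLin)
  let g : (Fin k → A) →ₗ[A] (Fin n → A) := (LinearMap.ker M.mulVecLin).subtype ∘ₗ f
  have hg : ∀ w, (LinearMap.toMatrix' g).mulVec w = g w := fun w => by
    rw [LinearMap.toMatrix'_mulVec]
  refine ⟨k, LinearMap.toMatrix' g, ?_, fun v hv => ?_⟩
  · apply Matrix.toLin'.injective
    ext w i
    simp only [Matrix.toLin'_mul, Matrix.toLin'_toMatrix', map_zero, LinearMap.comp_apply]
    have h2 : M.mulVec (f (Pi.single w 1) : Fin n → A) = 0 := (f (Pi.single w 1)).2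
    simpa [g] using congrFun h2 i
  · obtain ⟨w, hw⟩ := hf ⟨v, by simpa using hv⟩
    refine ⟨w, ?_⟩
    rw [hg]
    simp [g, hw]

lemma MatRes.exists_of [IsNoetherianRing A] {m n : ℕ} (M : Matrix (Fin m) (Fin n) A) :
    ∃ (b : ℕ → ℕ) (N : MatRes A b) (h0 : b 0 = m) (h1 : b 1 = n),
      N.D 0 = M.reindex (finCongr h0.symm) (finCongr h1.symm) := by
  choose k M' hM' using fun (T : Σ m n : ℕ, Matrix (Fin m) (Fin n) A) => exists_exact_next T.2.2
  let T : ℕ → Σ m n : ℕ, Matrix (Fin m) (Fin n) A := fun l =>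
    Nat.rec ⟨m, n, M⟩ (fun _ S => ⟨S.2.1, k S, M' S⟩) l
  exact ⟨fun l => (T l).1, ⟨fun l => (T l).2.2, fun l => (hM' (T l)).1, fun l => (hM' (T l)).2⟩,
    rfl, rfl, rfl⟩

lemma MatRes.exists_ideal [IsNoetherianRing A] (I : Ideal A) :
    ∃ (b : ℕ → ℕ) (N : MatRes A b) (i₀ : Fin (b 0)), (∀ k, k = i₀) ∧
      ∀ a, a ∈ I ↔ ∃ v, (N.D 0).mulVec v i₀ = a := by
  obtain ⟨n, f, hf⟩ := Module.Finite.exists_fin' A I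
  obtain ⟨b, N, h0, h1, hN⟩ := MatRes.exists_of
    (Matrix.of fun (_ : Fin 1) j => (f (Pi.single j 1) : A))
  refine ⟨b, N, finCongr h0.symm 0, fun k => ?_, fun a => ?_⟩
  · rw [← (finCongr h0).injective.eq_iff]
    exact Subsingleton.elim _ _
  · have key : ∀ w : Fin n → A, (f w : A) = ∑ j, w j * (f (Pi.single j 1) : A) := fun w => by
      conv_lhs => rw [← Finset.univ_sum_single w, map_sum]
      rw [AddSubmonoidClass.coe_finsetSum]
      refine Finset.sum_congr rfl fun j _ => ?_
      rw [← smul_eq_mul, ← Submodule.coe_smul, ← map_smul, ← Pi.single_smul, smul_eq_mul, mul_one]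
    have key2 : ∀ v : Fin (b 1) → A, (N.D 0).mulVec v (finCongr h0.symm 0) =
        f (fun j => v (finCongr h1.symm j)) := fun v => by
      rw [key, hN]
      simp only [Matrix.mulVec, dotProduct, Matrix.reindex_apply, Matrix.submatrix_apply,
        Matrix.of_apply]
      rw [← (finCongr h1.symm).sum_comp]
      exact Finset.sum_congr rfl fun j _ => by simp [mul_comm]
    simp only [key2]
    constructor
    · intro ha
      obtain ⟨w, hw⟩ := hf ⟨a, ha⟩
      exact ⟨fun j => w (finCongr h1 j), by simp [hw]⟩
    · rintro ⟨v, rfl⟩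
      exact (f _).2

/-- Split exactness at the image of the `s`-th differential. -/
def MatRes.Split (N : MatRes A b) (s : ℕ) : Prop := ∃ g : Matrix (Fin (b (s + 1))) (Fin (b s)) A, N.D s * g * N.D s = N.D s

lemma exists_mul_mul_self_of_field {k : Type u} [Field k] {m n : ℕ} (M : Matrix (Fin m) (Fin n) k) :
    ∃ g : Matrix (Fin n) (Fin m) k, M * g * M = M := by
  obtain ⟨σ, hσ⟩ := M.mulVecLin.rangeRestrict.exists_rightInverse_of_surjective
    (LinearMap.range_rangeRestrict _)
  obtain ⟨g, hg⟩ := LinearMap.exists_extend σ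
  refine ⟨LinearMap.toMatrix' g, ?_⟩
  apply Matrix.toLin'.injective
  rw [Matrix.toLin'_mul, Matrix.toLin'_mul, Matrix.toLin'_toMatrix']
  refine LinearMap.ext fun v => ?_
  have h1 := LinearMap.congr_fun hg (M.mulVecLin.rangeRestrict v)
  have h2 := congrArg Subtype.val (LinearMap.congr_fun hσ (M.mulVecLin.rangeRestrict v))
  simp only [LinearMap.comp_apply, Submodule.subtype_apply, LinearMap.codRestrict_apply,
    LinearMap.id_apply] at h1 h2
  simp only [LinearMap.comp_apply, Matrix.toLin'_apply]
  have h3 : g (M.mulVec v) = σ (M.mulVecLin.rangeRestrict v) := h1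
  rw [h3]
  exact h2

lemma exists_mul_mul_self_of_isUnit_det {m n : ℕ} {M : Matrix (Fin m) (Fin n) A}
    {g : Matrix (Fin n) (Fin m) A} {U : Matrix (Fin n) (Fin n) A} (hU : IsUnit U.det)
    (h : M * g * M = M * U) : ∃ g' : Matrix (Fin n) (Fin m) A, M * g' * M = M := by
  have hp : ∀ q : Polynomial A, Polynomial.aeval (M * g) q * M = M * Polynomial.aeval U q := by
    intro q
    induction q using Polynomial.induction_on with
    | C a => simp [Algebra.algebraMap_eq_smul_one]
    | add p q hp hq => simp only [map_add, Matrix.add_mul, Matrix.mul_add, hp, hq]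
    | monomial l a ih =>
      rw [pow_succ, ← mul_assoc, map_mul, Polynomial.aeval_X, map_mul _ _ Polynomial.X,
        Polynomial.aeval_X, Matrix.mul_assoc _ _ M, h, ← Matrix.mul_assoc, ih, Matrix.mul_assoc]
  have hc := U.aeval_self_charpoly
  rw [← Polynomial.X_mul_divX_add U.charpoly] at hc
  simp only [map_add, map_mul, Polynomial.aeval_X, Polynomial.aeval_C] at hc
  set q := U.charpoly.divX with hq
  have hu : IsUnit (U.charpoly.coeff 0) := by
    have := U.det_eq_sign_charpoly_coeff
    rw [this] at hU
    exact isUnit_of_mul_isUnit_right hU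
  obtain ⟨w, hw⟩ := hu.exists_left_inv
  have hcomm : M * (g * Polynomial.aeval (M * g) q) * M = -(U.charpoly.coeff 0 • M) := by
    rw [← Matrix.mul_assoc, Matrix.mul_assoc, hp, ← Matrix.mul_assoc, h, Matrix.mul_assoc,
      eq_neg_of_add_eq_zero_left hc]
    simp [Algebra.algebraMap_eq_smul_one]
  refine ⟨-(w • (g * Polynomial.aeval (M * g) q)), ?_⟩
  rw [Matrix.mul_neg, Matrix.neg_mul, Matrix.mul_smul, Matrix.smul_mul, hcomm, smul_neg, neg_neg,
    smul_smul, hw, one_smul]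

lemma MatRes.split_of_residue [IsLocalRing A] (N : MatRes A b) {s : ℕ}
    (h : ∀ v, (∀ k, (N.D s).mulVec v k ∈ maximalIdeal A) →
      ∃ w, ∀ k, (v - (N.D (s + 1)).mulVec w) k ∈ maximalIdeal A) : N.Split s := by
  obtain ⟨γ, hγ⟩ := exists_mul_mul_self_of_field ((N.D s).map (residue A))
  choose ρ hρ using (residue_surjective (R := A))
  let g : Matrix (Fin (b (s + 1))) (Fin (b s)) A := γ.map ρ
  have hg : g.map (residue A) = γ := by ext i j; simp [g, hρ]
  have h1 : ∀ v, ∃ w : Fin (b (s + 1)) → A, (∀ k, w k ∈ maximalIdeal A) ∧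
      (N.D s).mulVec w = (N.D s).mulVec (v - g.mulVec ((N.D s).mulVec v)) := by
    intro v
    obtain ⟨w, hw⟩ := h (v - g.mulVec ((N.D s).mulVec v)) fun k => by
      rw [← residue_eq_zero_iff, Matrix.mulVec_sub, Pi.sub_apply, map_sub, sub_eq_zero,
        Matrix.mulVec_mulVec, Matrix.mulVec_mulVec, RingHom.map_mulVec, RingHom.map_mulVec,
        Matrix.map_mul, Matrix.map_mul, hg, hγ]
    refine ⟨_, hw, ?_⟩
    rw [Matrix.mulVec_sub _ (_ - _), Matrix.mulVec_mulVec _ (N.D s), N.dd, Matrix.zero_mulVec,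
      sub_zero]
  choose w hw hw2 using fun j : Fin (b (s + 1)) => h1 (Pi.single j 1)
  let W : Matrix (Fin (b (s + 1))) (Fin (b (s + 1))) A := Matrix.of fun i j => w j i
  have hW : N.D s * W = N.D s - N.D s * g * N.D s := by
    ext i j
    have := congrFun (hw2 j) i
    rw [Matrix.mulVec_sub, Pi.sub_apply, Matrix.mulVec_mulVec, Matrix.mulVec_mulVec,
      Matrix.mulVec_single_one, Matrix.mulVec_single_one] at this
    rw [Matrix.sub_apply, Matrix.mul_assoc, ← Matrix.mul_assoc]
    simpa [Matrix.mul_apply, Matrix.mulVec, dotProduct, W, ← Matrix.mul_assoc] using this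
  refine exists_mul_mul_self_of_isUnit_det (g := g) (U := 1 - W) ?_ ?_
  · have : residue A (1 - W).det = 1 := by
      rw [RingHom.map_det]
      have : (residue A).mapMatrix (1 - W) = 1 := by
        rw [map_sub, map_one, sub_eq_self]
        ext i j
        simpa [W] using (hw j i)
      rw [this, Matrix.det_one]
    by_contra hn
    rw [← mem_nonunits_iff, ← mem_maximalIdeal, ← residue_eq_zero_iff, this] at hn
    exact one_ne_zero hn
  · rw [Matrix.mul_sub, hW, Matrix.mul_one, sub_sub_cancel]

end Resolution

section Acyclic

variable {A B : Type u} [CommRing A] [CommRing B] {b : ℕ → ℕ}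

lemma MatRes.mulVec_mulVec_succ (N : MatRes A b) (l : ℕ) (w) :
    (N.D l).mulVec ((N.D (l + 1)).mulVec w) = 0 := by
  rw [Matrix.mulVec_mulVec, N.dd, Matrix.zero_mulVec]

/-- Exactness in degree `l + 1` modulo the first `i` elements of `y`. -/
def MatRes.ExactMod (N : MatRes A b) (y : ℕ → A) (i l : ℕ) : Prop :=
  ∀ v, (∀ k, (N.D l).mulVec v k ∈ initIdeal y i) →
    ∃ w, ∀ k, (v - (N.D (l + 1)).mulVec w) k ∈ initIdeal y i

lemma isSMulRegular_quotient_iff {I : Ideal A} {a : A} :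
    IsSMulRegular (A ⧸ I) a ↔ ∀ b, a * b ∈ I → b ∈ I := by
  rw [isSMulRegular_iff_right_eq_zero_of_smul]
  constructor
  · intro h b hb
    rw [← Ideal.Quotient.eq_zero_iff_mem] at hb ⊢
    exact h _ (by rw [← hb, map_mul]; rfl)
  · intro h x hx
    obtain ⟨b, rfl⟩ := Ideal.Quotient.mk_surjective x
    rw [Ideal.Quotient.eq_zero_iff_mem]
    exact h b (by rw [← Ideal.Quotient.eq_zero_iff_mem, map_mul]; exact hx)

lemma exists_eq_smul_add_of_mem_initIdeal_succ {m i : ℕ} {y : ℕ → A} {v : Fin m → A}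
    (h : ∀ k, v k ∈ initIdeal y (i + 1)) :
    ∃ u : Fin m → A, ∀ k, (v - y i • u) k ∈ initIdeal y i := by
  have : ∀ k, ∃ c, v k - y i * c ∈ initIdeal y i := fun k => by
    have hk := h k
    rw [initIdeal_succ, Submodule.mem_sup] at hk
    obtain ⟨a, ha, c, hc, hac⟩ := hk
    obtain ⟨e, rfl⟩ := Ideal.mem_span_singleton.1 hc
    exact ⟨e, by rwa [← hac, add_sub_cancel_right]⟩
  choose u hu using this
  exact ⟨u, hu⟩

lemma MatRes.ExactMod.step (N : MatRes A b) {y : ℕ → A} {i l : ℕ} (h : N.ExactMod y i l)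
    (hu : ∀ u : Fin (b l) → A, (∃ v, ∀ k, ((N.D l).mulVec v - y i • u) k ∈ initIdeal y i) →
      ∃ w, ∀ k, (u - (N.D l).mulVec w) k ∈ initIdeal y i) : N.ExactMod y (i + 1) l := by
  intro v hv
  obtain ⟨u, hu1⟩ := exists_eq_smul_add_of_mem_initIdeal_succ hv
  obtain ⟨w, hw⟩ := hu u ⟨v, hu1⟩
  obtain ⟨x, hx⟩ := h (v - y i • w) fun k => by
    have := (initIdeal y i).add_mem (hu1 k) ((initIdeal y i).mul_mem_left (y i) (hw k))
    convert this using 1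
    simp only [Matrix.mulVec_sub, Matrix.mulVec_smul, Pi.sub_apply, Pi.smul_apply, smul_eq_mul]
    ring
  refine ⟨x, fun k => ?_⟩
  have h1 := initIdeal_mono y (Nat.le_succ i) (hx k)
  have h2 := (initIdeal y (i + 1)).mul_mem_right (w k) (mem_initIdeal (x := y) (Nat.lt_succ_self i))
  convert (initIdeal y (i + 1)).add_mem h1 h2 using 1
  simp only [Pi.sub_apply, Pi.smul_apply, smul_eq_mul]
  ring

lemma MatRes.exactMod (N : MatRes A b) {y : ℕ → A} {n t : ℕ}
    (hy : ∀ i < n, IsSMulRegular (A ⧸ initIdeal y i) (y i))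
    (ht : ∀ i < t, ∀ u : Fin (b 0) → A,
      (∃ v, ∀ k, ((N.D 0).mulVec v - y i • u) k ∈ initIdeal y i) →
        ∃ w, ∀ k, (u - (N.D 0).mulVec w) k ∈ initIdeal y i) :
    ∀ i ≤ n, ∀ l, i ≤ l + t → N.ExactMod y i l := by
  intro i
  induction i with
  | zero =>
    intro _ l _ v hv
    simp only [initIdeal_zero, Ideal.mem_bot] at hv
    obtain ⟨w, hw⟩ := N.exact l v (funext hv)
    exact ⟨w, fun k => by rw [← hw]; simp⟩
  | succ i ih =>
    intro hi l hl
    refine (ih (by omega) l (by omega)).step N ?_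
    cases l with
    | zero => exact ht i (by omega)
    | succ l =>
      rintro u ⟨v, hv⟩
      refine ih (by omega) l (by omega) u fun k => ?_
      refine isSMulRegular_quotient_iff.1 (hy i (by omega)) _ ?_
      have := Matrix.mulVec_mem_ideal (N.D l) hv k
      rw [Matrix.mulVec_sub, N.mulVec_mulVec_succ, zero_sub, Pi.neg_apply, neg_mem_iff,
        Matrix.mulVec_smul] at this
      simpa using this

lemma MatRes.split_of_regLoc [IsLocalRing A] {n s : ℕ} (hA : RegLoc A n) (N : MatRes A b)
    (hs : n ≤ s) : N.Split s := by
  obtain ⟨y, hy⟩ := hA.gen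
  refine N.split_of_residue fun v hv => ?_
  have := N.exactMod (t := 0) (fun i hi => hA.isSMulRegular hy hi) (by simp) n le_rfl s (by omega) v
  rw [hy] at this
  exact this hv

lemma MatRes.split_of_succ [IsLocalRing A] {n s : ℕ} (N : MatRes A b) {y : ℕ → A} {τ : A}
    (hτ : τ ∉ initIdeal y n) (hmτ : ∀ a ∈ maximalIdeal A, τ * a ∈ initIdeal y n)
    (hex : N.ExactMod y n s) (hs : N.Split (s + 1)) : N.Split s := by
  obtain ⟨g, hg⟩ := hs
  refine N.split_of_residue fun v hv => ⟨g.mulVec v, fun k => ?_⟩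
  obtain ⟨w, hw⟩ := hex (τ • v) fun k => by
    rw [Matrix.mulVec_smul]
    exact hmτ _ (hv k)
  have h1 := Matrix.mulVec_mem_ideal (1 - N.D (s + 1) * g) hw k
  have h2 : (1 - N.D (s + 1) * g) * N.D (s + 1) = 0 := by
    rw [Matrix.sub_mul, hg, Matrix.one_mul, sub_self]
  rw [Matrix.mulVec_sub, Matrix.mulVec_mulVec, h2, Matrix.zero_mulVec, sub_zero,
    Matrix.mulVec_smul, Pi.smul_apply, smul_eq_mul, Matrix.sub_mulVec, Matrix.one_mulVec,
    ← Matrix.mulVec_mulVec] at h1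
  by_contra hn
  rw [mem_maximalIdeal, mem_nonunits_iff, not_not] at hn
  exact hτ ((Ideal.mul_unit_mem_iff_mem _ hn).1 h1)

/-- The ideal of elements `a` such that `a` times the `s`-th differential splits. -/
def MatRes.splitIdeal (N : MatRes A b) (s : ℕ) : Ideal A where
  carrier := {a | ∃ g : Matrix (Fin (b (s + 1))) (Fin (b s)) A, N.D s * g * N.D s = a • N.D s}
  add_mem' := by
    rintro a a' ⟨g, hg⟩ ⟨g', hg'⟩
    exact ⟨g + g', by rw [Matrix.mul_add, Matrix.add_mul, hg, hg', add_smul]⟩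
  zero_mem' := ⟨0, by simp⟩
  smul_mem' := by
    rintro c a ⟨g, hg⟩
    exact ⟨c • g, by rw [Matrix.mul_smul, Matrix.smul_mul, hg, smul_smul, smul_eq_mul]⟩

lemma MatRes.exists_homotopy {N : MatRes A b} {s : ℕ} {a : A} (ha : a ∈ N.splitIdeal s) :
    ∃ (h : Matrix (Fin (b (s + 2))) (Fin (b (s + 1))) A) (g : Matrix (Fin (b (s + 1))) (Fin (b s)) A),
      a • (1 : Matrix (Fin (b (s + 1))) (Fin (b (s + 1))) A) = N.D (s + 1) * h + g * N.D s := by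
  obtain ⟨g, hg⟩ := ha
  obtain ⟨h, hh⟩ := exists_matrix_of_forall_mulVec (M := N.D (s + 1))
    (N := a • (1 : Matrix (Fin (b (s + 1))) (Fin (b (s + 1))) A) - g * N.D s) fun v => by
      refine N.exact s _ ?_
      rw [Matrix.mulVec_mulVec, Matrix.mul_sub, ← Matrix.mul_assoc, hg]
      simp
  exact ⟨h, g, by rw [← hh, sub_add_cancel]⟩

lemma MatRes.splitIdeal_mono_succ (N : MatRes A b) (s : ℕ) : N.splitIdeal s ≤ N.splitIdeal (s + 1) := by
  intro a ha
  obtain ⟨h, g, hh⟩ := MatRes.exists_homotopy ha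
  refine ⟨h, ?_⟩
  have := congrArg (· * N.D (s + 1)) hh
  simp only [Matrix.add_mul, Matrix.mul_assoc g, N.dd, Matrix.mul_zero, add_zero,
    Matrix.smul_mul, Matrix.one_mul] at this
  exact this.symm

lemma MatRes.splitIdeal_mono (N : MatRes A b) : Monotone N.splitIdeal :=
  monotone_nat_of_le_succ N.splitIdeal_mono_succ

lemma MatRes.le_splitIdeal {N : MatRes A b} {i₀ : Fin (b 0)} (hi : ∀ k, k = i₀) {I : Ideal A}
    (hI : ∀ a, a ∈ I ↔ ∃ v, (N.D 0).mulVec v i₀ = a) (s : ℕ) : I ≤ N.splitIdeal s := by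
  refine le_trans (fun a ha => ?_) (N.splitIdeal_mono (Nat.zero_le s))
  obtain ⟨v, hv⟩ := (hI a).1 ha
  refine ⟨Matrix.of fun i _ => v i, ?_⟩
  have : N.D 0 * (Matrix.of fun i _ => v i) = a • (1 : Matrix (Fin (b 0)) (Fin (b 0)) A) := by
    ext i j
    rw [hi i, hi j]
    simp only [Matrix.mul_apply, Matrix.of_apply, Matrix.smul_apply, Matrix.one_apply_eq,
      smul_eq_mul, mul_one, ← hv]
    rfl
  rw [this, Matrix.smul_mul, Matrix.one_mul]

/-- Localization of an exact sequence of matrices. -/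
def MatRes.localize (N : MatRes A b) (S : Submonoid A) (B : Type u) [CommRing B] [Algebra A B]
    [IsLocalization S B] : MatRes B b where
  D l := (N.D l).map (algebraMap A B)
  dd l := by
    rw [← Matrix.map_mul, N.dd]
    exact Matrix.map_zero _ (map_zero _)
  exact l v hv := by
    obtain ⟨c, hc⟩ := IsLocalization.exist_integer_multiples_of_finite S v
    choose v₀ hv₀ using hc
    have h1 : (fun k => algebraMap A B (v₀ k)) = algebraMap A B c • v := by
      ext k
      rw [hv₀, Pi.smul_apply, algebraMap_smul]
    have h2 : ∀ k, ∃ s : S, (s : A) * (N.D l).mulVec v₀ k = 0 := fun k => by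
      rw [← IsLocalization.map_eq_zero_iff S B]
      have := congrFun (congrArg (((N.D l).map (algebraMap A B)).mulVec ·) h1) k
      simp only [Matrix.mulVec_smul, hv, smul_zero, Pi.zero_apply] at this
      rw [RingHom.map_mulVec]
      exact this
    choose s hs using h2
    obtain ⟨w, hw⟩ := N.exact l ((∏ k, s k : S) • v₀) (by
      ext k
      rw [Submonoid.smul_def, Matrix.mulVec_smul, Pi.smul_apply, smul_eq_mul, Pi.zero_apply,
        ← Finset.prod_erase_mul _ _ (Finset.mem_univ k), Submonoid.coe_mul, mul_assoc, hs,
        mul_zero])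
    have hu : IsUnit (algebraMap A B ((∏ k, s k : S) * c : S)) := IsLocalization.map_units B _
    obtain ⟨e, he⟩ := hu.exists_left_inv
    refine ⟨e • (algebraMap A B ∘ w), ?_⟩
    have h3 : algebraMap A B ((∏ k, s k : S) * c : S) • v =
        ((N.D (l + 1)).map (algebraMap A B)).mulVec (algebraMap A B ∘ w) := by
      ext k
      have := congrArg (algebraMap A B) (congrFun hw k)
      rw [RingHom.map_mulVec] at this
      rw [← this, Submonoid.coe_mul, map_mul, mul_smul, ← h1]
      simp [Submonoid.smul_def]
    rw [Matrix.mulVec_smul, ← h3, smul_smul, he, one_smul]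

lemma MatRes.Split.localize {N : MatRes A b} {s : ℕ} (h : N.Split s) (S : Submonoid A) (B : Type u)
    [CommRing B] [Algebra A B] [IsLocalization S B] : (N.localize S B).Split s := by
  obtain ⟨g, hg⟩ := h
  refine ⟨g.map (algebraMap A B), ?_⟩
  simp only [MatRes.localize, ← Matrix.map_mul, hg]

lemma MatRes.exists_mem_splitIdeal {N : MatRes A b} {s : ℕ} (S : Submonoid A) {B : Type u}
    [CommRing B] [Algebra A B] [IsLocalization S B] (h : (N.localize S B).Split s) :
    ∃ a ∈ S, a ∈ N.splitIdeal s := by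
  obtain ⟨g, hg⟩ := h
  obtain ⟨c, hc⟩ := IsLocalization.exist_integer_multiples_of_finite S
    (fun p : Fin (b (s + 1)) × Fin (b s) => g p.1 p.2)
  choose g₀ hg₀ using hc
  have hg1 : (Matrix.of fun i j => g₀ (i, j)).map (algebraMap A B) = algebraMap A B c • g := by
    ext i j
    rw [Matrix.map_apply, Matrix.of_apply, hg₀, Matrix.smul_apply, algebraMap_smul]
  set G : Matrix (Fin (b (s + 1))) (Fin (b s)) A := Matrix.of fun i j => g₀ (i, j)
  have h2 : ∀ p : Fin (b s) × Fin (b (s + 1)), ∃ e : S, (e : A) * (N.D s * G * N.D s) p.1 p.2 =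
      e * ((c : A) • N.D s) p.1 p.2 := fun p => by
    rw [← IsLocalization.eq_iff_exists S B]
    have h3 : (N.D s * G * N.D s).map (algebraMap A B) = ((c : A) • N.D s).map (algebraMap A B) := by
      rw [Matrix.map_mul, Matrix.map_mul, hg1, Matrix.mul_smul, Matrix.smul_mul]
      have : (N.D s).map (algebraMap A B) * g * (N.D s).map (algebraMap A B) =
        (N.D s).map (algebraMap A B) := hg
      rw [this]
      ext i j
      simp
    exact congrFun (congrFun h3 p.1) p.2
  choose e he using h2
  refine ⟨((∏ p, e p : S) * c : S), SetLike.coe_mem _, ((∏ p, e p : S) : A) • G, ?_⟩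
  ext i j
  rw [Matrix.mul_smul, Matrix.smul_mul, Submonoid.coe_mul, mul_smul]
  simp only [Matrix.smul_apply, smul_eq_mul]
  rw [← Finset.prod_erase_mul _ _ (Finset.mem_univ (i, j)), Submonoid.coe_mul, mul_assoc,
    he (i, j), mul_assoc]
  simp

end Acyclic

section Parameters

open RingTheory.Sequence

open scoped Pointwise

variable {A : Type u} [CommRing A]

/-- `(A/K)/x = A/(K + x)`. -/
noncomputable def quotSMulTopQuotientEquiv (K : Ideal A) (x : A) :
    QuotSMulTop x (A ⧸ K) ≃ₗ[A] A ⧸ (K ⊔ Ideal.span {x}) :=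
  (Submodule.quotEquivOfEq _ _ (by
      rw [← Submodule.ideal_span_singleton_smul]
      have : (⊤ : Submodule A (A ⧸ K)) = Submodule.map K.mkQ ⊤ := by
        simp
      rw [this, ← Submodule.map_smul'', Submodule.map_sup]
      simp)).trans
    (Submodule.quotientQuotientEquivQuotient K (K ⊔ Ideal.span {x}) le_sup_left)

variable [IsLocalRing A]

lemma exists_regular_and_height {n j t : ℕ} (hA : CMLoc A n) (hj : j < n) {w : ℕ → A}
    (hw : (j : ℕ∞) ≤ (initIdeal w j).height) {K : Ideal A} (hd : DepthGE A (t + 1) (A ⧸ K)) :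
    ∃ x ∈ maximalIdeal A, IsSMulRegular (A ⧸ K) x ∧
      ((j + 1 : ℕ) : ℕ∞) ≤ (initIdeal w j ⊔ Ideal.span {x}).height := by
  have := hA.noeth
  have hf1 : (initIdeal w j).minimalPrimes.Finite := Ideal.finite_minimalPrimes_of_isNoetherianRing A _
  have hf2 : (associatedPrimes A (A ⧸ K)).Finite := associatedPrimes.finite A _
  obtain ⟨x₀, hx₀, hr₀, -⟩ := depthGE_succ_iff.1 hd
  obtain ⟨x, hx, hxP⟩ : ∃ x ∈ maximalIdeal A,
      ∀ P ∈ (initIdeal w j).minimalPrimes ∪ associatedPrimes A (A ⧸ K), x ∉ P := by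
    by_contra! hcon
    obtain ⟨P, hP, hle⟩ := (Ideal.subset_union_prime (s := (hf1.union hf2).toFinset) (f := id) ⊥ ⊥
      (fun P hP _ _ => by
        rcases ((Set.Finite.mem_toFinset _).mp hP) with h | h
        exacts [h.1.1, (assP_iff.2 h).1]) (I := maximalIdeal A)).mp fun b hb => by
        obtain ⟨P, hP, hbP⟩ := hcon b hb
        exact Set.mem_biUnion (by simpa using hP) hbP
    rcases ((Set.Finite.mem_toFinset _).mp hP) with h | h
    · have h1 := (Ideal.height_mono hle).trans (height_le_of_mem_minimalPrimes_initIdeal h)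
      rw [hA.height] at h1
      have : n ≤ j := by exact_mod_cast h1
      omega
    · exact (assP_iff.2 h).notMem hr₀ (hle hx₀)
  refine ⟨x, hx, isSMulRegular_of_forall_assP fun P hP => hxP P (Or.inr (assP_iff.1 hP)), ?_⟩
  exact_mod_cast add_one_le_height_sup hw fun P hP => hxP P (Or.inl hP)

lemma DepthGE.sup_span {t : ℕ} [IsNoetherianRing A] {K : Ideal A} (hK : K ≤ maximalIdeal A)
    (hd : DepthGE A (t + 1) (A ⧸ K)) {x : A} (hx : x ∈ maximalIdeal A)
    (hr : IsSMulRegular (A ⧸ K) x) : DepthGE A t (A ⧸ (K ⊔ Ideal.span {x})) := by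
  have : Nontrivial (A ⧸ K) := Ideal.Quotient.nontrivial_iff.2
    (ne_top_of_le_ne_top (maximalIdeal.isMaximal A).ne_top hK)
  exact (hd.quotSMulTop hx hr).congr (quotSMulTopQuotientEquiv K x)

lemma exists_parameters_of_depthGE {n t : ℕ} (hA : CMLoc A n) {K : Ideal A}
    (hK : K ≤ maximalIdeal A) (htn : t ≤ n) (hd : DepthGE A t (A ⧸ K)) :
    ∃ y : ℕ → A, (∀ j < n, y j ∈ maximalIdeal A) ∧ maximalIdeal A ≤ (initIdeal y n).radical ∧
      ∀ j < t, IsSMulRegular (A ⧸ (K ⊔ initIdeal y j)) (y j) := by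
  have := hA.noeth
  have key : ∀ j ≤ t, ∃ y : ℕ → A, (∀ i < j, y i ∈ maximalIdeal A) ∧
      (j : ℕ∞) ≤ (initIdeal y j).height ∧ DepthGE A (t - j) (A ⧸ (K ⊔ initIdeal y j)) ∧
      ∀ i < j, IsSMulRegular (A ⧸ (K ⊔ initIdeal y i)) (y i) := by
    intro j
    induction j with
    | zero => exact fun _ => ⟨0, by simp, by simp, by rw [initIdeal_zero, sup_bot_eq]; exact hd, by simp⟩
    | succ j ih =>
      intro hj
      obtain ⟨y, h1, h2, h3, h4⟩ := ih (by omega)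
      obtain ⟨s, hs⟩ : ∃ s, t - j = s + 1 := ⟨t - j - 1, by omega⟩
      rw [hs] at h3
      obtain ⟨x, hx, hr, hh⟩ := exists_regular_and_height hA (by omega) h2 h3
      let y' : ℕ → A := Function.update y j x
      have hy : ∀ i < j, y' i = y i := fun i hi => Function.update_of_ne (by omega) _ _
      have hyj : y' j = x := Function.update_self _ _ _
      have hI : ∀ i ≤ j, initIdeal y' i = initIdeal y i := fun i hi =>
        initIdeal_congr fun k hk => hy k (by omega)
      have hIs : initIdeal y' (j + 1) = initIdeal y j ⊔ Ideal.span {x} := by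
        rw [initIdeal_succ, hI j le_rfl, hyj]
      refine ⟨y', fun i hi => ?_, hIs ▸ hh, ?_, fun i hi => ?_⟩
      · rcases Nat.lt_succ_iff_lt_or_eq.1 hi with h | rfl
        exacts [hy i h ▸ h1 i h, hyj ▸ hx]
      · rw [show t - (j + 1) = s by omega, hIs, ← sup_assoc]
        refine h3.sup_span (sup_le hK ?_) hx hr
        exact initIdeal_le_iff.2 h1
      · rcases Nat.lt_succ_iff_lt_or_eq.1 hi with h | rfl
        · rw [hy i h, hI i h.le]
          exact h4 i h
        · rw [hyj, hI i le_rfl]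
          exact hr
  obtain ⟨y, h1, h2, -, h4⟩ := key t le_rfl
  obtain ⟨y', h5, h6, h7⟩ := hA.exists_full htn h1 h2
  refine ⟨y', h6, h7, fun j hj => ?_⟩
  rw [h5 j hj, initIdeal_congr fun i hi => h5 i (by omega)]
  exact h4 j hj

lemma exists_socle {I : Ideal A} [IsNoetherianRing A] (hI : I ≤ maximalIdeal A)
    (h : maximalIdeal A ≤ I.radical) : ∃ τ, τ ∉ I ∧ ∀ a ∈ maximalIdeal A, τ * a ∈ I := by
  have hne : I ≠ ⊤ := ne_top_of_le_ne_top (maximalIdeal.isMaximal A).ne_top hI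
  have : Nontrivial (A ⧸ I) := Ideal.Quotient.nontrivial_iff.2 hne
  obtain ⟨v, hv⟩ := exists_ne (0 : A ⧸ I)
  obtain ⟨P, hP, -⟩ := exists_assP (A := A) hv
  have hmP : maximalIdeal A ≤ P := h.trans (hP.1.radical_le_iff.2 (mem_of_assP_quotient hP))
  obtain ⟨hPp, v, hv⟩ := hP
  obtain ⟨τ, rfl⟩ := Ideal.Quotient.mk_surjective v
  refine ⟨τ, fun hτ => ?_, fun a ha => ?_⟩
  · rw [Ideal.Quotient.eq_zero_iff_mem.2 hτ] at hv
    exact hPp.ne_top ((Ideal.eq_top_iff_one P).2 ((hv 1).2 (smul_zero _)))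
  · rw [← Ideal.Quotient.eq_zero_iff_mem, mul_comm, map_mul]
    exact (hv a).1 (hmP ha)

variable {b : ℕ → ℕ}

lemma MatRes.split_of_depthGE {n t : ℕ} (hA : CMLoc A n) (N : MatRes A b) {i₀ : Fin (b 0)}
    (hi : ∀ k, k = i₀) {K : Ideal A} (hI : ∀ a, a ∈ K ↔ ∃ v, (N.D 0).mulVec v i₀ = a)
    (hK : K ≤ maximalIdeal A) (htn : t ≤ n) (hd : DepthGE A t (A ⧸ K)) {s : ℕ} (hs : n ≤ s + t)
    (hsp : N.Split (s + 1)) : N.Split s := by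
  have := hA.noeth
  obtain ⟨y, hy, hrad, hreg⟩ := exists_parameters_of_depthGE hA hK htn hd
  obtain ⟨τ, hτ, hmτ⟩ := exists_socle (initIdeal_le_iff.2 hy) hrad
  refine N.split_of_succ hτ hmτ ?_ hsp
  refine N.exactMod (isWeaklyRegular_range_iff.1 (hA.isWeaklyRegular hy hrad)) ?_ n le_rfl s hs
  intro i hit u ⟨v, hv⟩
  have h1 : y i * u i₀ ∈ K ⊔ initIdeal y i := by
    have h2 := (K ⊔ initIdeal y i).sub_mem (Ideal.mem_sup_left ((hI _).2 ⟨v, rfl⟩))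
      (Ideal.mem_sup_right (hv i₀))
    simpa using h2
  obtain ⟨a, ha, c, hc, hac⟩ := Submodule.mem_sup.1 (isSMulRegular_quotient_iff.1 (hreg i hit) _ h1)
  obtain ⟨w, hw⟩ := (hI a).1 ha
  refine ⟨w, fun k => ?_⟩
  rw [hi k, Pi.sub_apply, hw, ← hac, add_sub_cancel_left]
  exact hc

end Parameters

section SerreTwo

open RingTheory.Sequence

variable {R : Type u} [CommRing R]

lemma SerreS.depthGE {I : Ideal R} {m : ℕ} (hS : SerreS (R ⧸ I) m) (𝔮 : Ideal R) [h𝔮 : 𝔮.IsPrime]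
    (hI : I ≤ 𝔮) {j : ℕ} (hj : j ≤ m)
    (hdim : (j : WithBot ℕ∞) ≤ ringKrullDim (Localization.AtPrime 𝔮 ⧸
      I.map (algebraMap R (Localization.AtPrime 𝔮)))) :
    DepthGE (Localization.AtPrime 𝔮) j (Localization.AtPrime 𝔮 ⧸
      I.map (algebraMap R (Localization.AtPrime 𝔮))) := by
  have hp : (𝔮.map (Ideal.Quotient.mk I)).IsPrime :=
    Ideal.map_isPrime_of_surjective Ideal.Quotient.mk_surjective (by simpa using hI)
  have hcomap : ∀ r, Ideal.Quotient.mk I r ∈ 𝔮.map (Ideal.Quotient.mk I) ↔ r ∈ 𝔮 := fun r => by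
    rw [Ideal.mem_quotient_iff_mem_sup, sup_eq_left.2 hI]
  have hsub : Algebra.algebraMapSubmonoid (R ⧸ I) 𝔮.primeCompl =
      (𝔮.map (Ideal.Quotient.mk I)).primeCompl := by
    ext x
    constructor
    · rintro ⟨r, hr, rfl⟩
      exact fun h => hr ((hcomap r).1 h)
    · intro hx
      obtain ⟨r, rfl⟩ := Ideal.Quotient.mk_surjective x
      exact ⟨r, fun h => hx ((hcomap r).2 h), rfl⟩
  have hloc : IsLocalization (𝔮.map (Ideal.Quotient.mk I)).primeCompl (Localization.AtPrime 𝔮 ⧸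
      I.map (algebraMap R (Localization.AtPrime 𝔮))) := by
    rw [← hsub]
    infer_instance
  let e := IsLocalization.algEquiv (𝔮.map (Ideal.Quotient.mk I)).primeCompl
    (Localization.AtPrime (𝔮.map (Ideal.Quotient.mk I))) (Localization.AtPrime 𝔮 ⧸
      I.map (algebraMap R (Localization.AtPrime 𝔮)))
  rw [← ringKrullDim_eq_of_ringEquiv e.toRingEquiv] at hdim
  obtain ⟨rs, h1, h2, h3⟩ := hS _ hp j hj hdim
  choose σ hσ using (Ideal.Quotient.mk_surjective
    (I := I.map (algebraMap R (Localization.AtPrime 𝔮))))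
  refine ⟨rs.map fun r => σ (e r), by simpa using h1, ?_, ?_⟩
  · intro b hb
    obtain ⟨r, hr, rfl⟩ := List.mem_map.1 hb
    have h4 := h2 r hr
    rw [mem_maximalIdeal, mem_nonunits_iff] at h4 ⊢
    intro hu
    have h5 := hu.map (Ideal.Quotient.mk (I.map (algebraMap R (Localization.AtPrime 𝔮))))
    rw [hσ] at h5
    exact h4 ((MulEquiv.isUnit_map e).1 h5)
  · refine (AddEquiv.isWeaklyRegular_congr (e := e.toRingEquiv.toAddEquiv) ?_).1 h3
    rw [List.forall₂_map_right_iff, List.forall₂_same]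
    intro r _ x
    change e (r * x) = σ (e r) • e x
    rw [map_mul, ← hσ (e x), ← hσ (e r), ← map_mul, hσ (e r)]
    rfl

lemma map_le_maximalIdeal_atPrime {I 𝔮 : Ideal R} [𝔮.IsPrime] (hI : I ≤ 𝔮) :
    I.map (algebraMap R (Localization.AtPrime 𝔮)) ≤ maximalIdeal _ := by
  rw [← Localization.AtPrime.map_eq_maximalIdeal]
  exact Ideal.map_mono hI

variable [IsLocalRing R]

lemma CMLoc.le_dim_quotient_map {n d h : ℕ} (hR : CMLoc R n) {I P 𝔮 : Ideal R} (hP : P.IsPrime)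
    [h𝔮 : 𝔮.IsPrime] (hIP : I ≤ P) (hPq : P ≤ 𝔮) (hd : P.height = d) (hh : 𝔮.height = h) :
    ((h - d : ℕ) : WithBot ℕ∞) ≤ ringKrullDim (Localization.AtPrime 𝔮 ⧸
      I.map (algebraMap R (Localization.AtPrime 𝔮))) := by
  have hB := hR.localization 𝔮 hh
  have hdis : Disjoint (𝔮.primeCompl : Set R) (P : Set R) :=
    Set.disjoint_left.2 fun x hx hxP => hx (hPq hxP)
  have hp := IsLocalization.isPrime_of_isPrime_disjoint 𝔮.primeCompl (Localization.AtPrime 𝔮) P hP hdis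
  have hht : (P.map (algebraMap R (Localization.AtPrime 𝔮))).height = d := by
    rw [← IsLocalization.height_under 𝔮.primeCompl,
      IsLocalization.under_map_of_isPrime_disjoint 𝔮.primeCompl _ hP hdis, hd]
  refine (hB.le_dim_quotient hp hht).trans (ringKrullDim_le_of_surjective
    (Ideal.Quotient.factor (Ideal.map_mono hIP)) (Ideal.Quotient.factor_surjective _))

lemma le_or_le_of_isSMulRegular {K 𝔞₁ 𝔞₂ : Ideal R} (h12 : 𝔞₁ * 𝔞₂ ≤ K) {a b : R}
    (ha : a ∈ 𝔞₁ ⊔ 𝔞₂) (hb : b ∈ 𝔞₁ ⊔ 𝔞₂) (hra : IsSMulRegular (R ⧸ K) a)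
    (hrb : IsSMulRegular (R ⧸ (K ⊔ Ideal.span {a})) b) : 𝔞₁ ≤ K ∨ 𝔞₂ ≤ K := by
  rw [isSMulRegular_quotient_iff] at hra hrb
  obtain ⟨u, hu, v, hv, rfl⟩ := Submodule.mem_sup.1 ha
  obtain ⟨u', hu', v', hv', rfl⟩ := Submodule.mem_sup.1 hb
  have hmul : ∀ {x y}, x ∈ 𝔞₁ → y ∈ 𝔞₂ → x * y ∈ K := fun hx hy => h12 (Ideal.mul_mem_mul hx hy)
  have h1 : u ∈ K ⊔ Ideal.span {u + v} := by
    apply hrb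
    have h2 : (u' + v') * u = (u * v' - u' * v) + u' * (u + v) := by ring
    rw [h2]
    exact Submodule.add_mem_sup (K.sub_mem (hmul hu hv') (hmul hu' hv))
      (Ideal.mul_mem_left _ _ (Ideal.mem_span_singleton_self _))
  obtain ⟨κ, hκ, c, hc, hkc⟩ := Submodule.mem_sup.1 h1
  obtain ⟨w, rfl⟩ := Ideal.mem_span_singleton.1 hc
  have h3 : w * (1 - w) ∈ K := by
    apply hra
    apply hra
    have h4 : (u + v) * ((u + v) * (w * (1 - w))) =
        u * v - κ * (u + v) + 2 * (κ * u) - κ * κ := by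
      linear_combination (u + v - u + κ - (u + v) * w) * hkc
    rw [h4]
    exact K.sub_mem (K.add_mem (K.sub_mem (hmul hu hv) (K.mul_mem_right _ hκ))
      (K.mul_mem_left _ (K.mul_mem_right _ hκ))) (K.mul_mem_right _ hκ)
  rcases IsLocalRing.isUnit_or_isUnit_one_sub_self w with hw | hw
  · right
    have h5 : 1 - w ∈ K := (Ideal.unit_mul_mem_iff_mem _ hw).1 h3
    intro c hc
    apply hra
    have h6 : (u + v) * c = u * c + (u + v) * (1 - w) * c - κ * c := by
      linear_combination c * hkc
    rw [h6]
    exact K.sub_mem (K.add_mem (hmul hu hc) (K.mul_mem_right _ (K.mul_mem_left _ h5)))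
      (K.mul_mem_right _ hκ)
  · left
    have h5 : w ∈ K := (Ideal.mul_unit_mem_iff_mem _ hw).1 h3
    intro c hc
    apply hra
    have h6 : (u + v) * c = κ * c + (u + v) * w * c + c * v := by
      linear_combination -c * hkc
    rw [h6]
    exact K.add_mem (K.add_mem (K.mul_mem_right _ hκ) (K.mul_mem_right _ (K.mul_mem_left _ h5)))
      (hmul hc hv)

lemma le_or_le_of_depthGE_two [IsNoetherianRing R] {K 𝔞₁ 𝔞₂ : Ideal R} (hK : K ≤ maximalIdeal R)
    (hd : DepthGE R 2 (R ⧸ K)) (h12 : 𝔞₁ * 𝔞₂ ≤ K) (hle : 𝔞₁ ⊔ 𝔞₂ ≤ maximalIdeal R)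
    (hrad : maximalIdeal R ≤ (𝔞₁ ⊔ 𝔞₂).radical) : 𝔞₁ ≤ K ∨ 𝔞₂ ≤ K := by
  obtain ⟨a, ha, hra, -⟩ := depthGE_succ_iff.1 hd
  obtain ⟨k, hk⟩ := hrad ha
  have hra' := hra.pow k
  have hd1 := hd.sup_span hK (hle hk) hra'
  obtain ⟨b, hb, hrb, -⟩ := depthGE_succ_iff.1 hd1
  obtain ⟨l, hl⟩ := hrad hb
  exact le_or_le_of_isSMulRegular h12 hk hl hra' (hrb.pow l)

end SerreTwo

section Equidimensional

open RingTheory.Sequence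

variable {R : Type u} [CommRing R] [IsLocalRing R]

lemma exists_nat_height [IsNoetherianRing R] (P : Ideal R) [P.IsPrime] : ∃ h : ℕ, P.height = h := by
  have := Ideal.height_ne_top (I := P) Ideal.IsPrime.ne_top'
  exact ⟨P.height.toNat, (ENat.natCast_toNat this).symm⟩

lemma mem_map_atPrime_le {P 𝔮 : Ideal R} (hP : P.IsPrime) [𝔮.IsPrime] (hPq : P ≤ 𝔮) {a : Ideal R}
    (h : a.map (algebraMap R (Localization.AtPrime 𝔮)) ≤ P.map (algebraMap R (Localization.AtPrime 𝔮))) :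
    a ≤ P := by
  have hdis : Disjoint (𝔮.primeCompl : Set R) (P : Set R) :=
    Set.disjoint_left.2 fun x hx hxP => hx (hPq hxP)
  rw [← IsLocalization.under_map_of_isPrime_disjoint 𝔮.primeCompl (Localization.AtPrime 𝔮) hP hdis]
  exact Ideal.le_comap_of_map_le h

lemma le_of_pow_inf_le {s : Finset (Ideal R)} {N : ℕ} {P : Ideal R} (hP : P.IsPrime)
    (h : (s.inf id) ^ N ≤ P) : ∃ Q ∈ s, Q ≤ P :=
  hP.inf_le'.1 (hP.le_of_pow_le h)

lemma maximalIdeal_le_radical_map {J 𝔮 : Ideal R} [h𝔮 : 𝔮.IsPrime] (h : 𝔮 ∈ J.minimalPrimes) :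
    maximalIdeal (Localization.AtPrime 𝔮) ≤
      (J.map (algebraMap R (Localization.AtPrime 𝔮))).radical := by
  rw [Ideal.radical_eq_sInf]
  refine le_sInf fun Q ⟨hle, hQ⟩ => ?_
  rw [← Localization.AtPrime.map_eq_maximalIdeal, Ideal.map_le_iff_le_comap]
  refine h.2 ⟨hQ.comap _, Ideal.le_comap_of_map_le hle⟩ ?_
  exact (Ideal.comap_mono (le_maximalIdeal hQ.ne_top)).trans
    (IsLocalization.AtPrime.under_maximalIdeal (Localization.AtPrime 𝔮) 𝔮 inferInstance).le

lemma CMLoc.height_eq_of_mem_minimalPrimes {n d : ℕ} (hR : CMLoc R n) {I : Ideal R}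
    (hS : SerreS (R ⧸ I) 2) (hge : (d : ℕ∞) ≤ I.height) {P₀ : Ideal R} (hP₀ : P₀.IsPrime)
    (hIP₀ : I ≤ P₀) (hd : P₀.height = d) {P : Ideal R} (hP : P ∈ I.minimalPrimes) :
    P.height = d := by
  classical
  have := hR.noeth
  have hge' : ∀ Q ∈ I.minimalPrimes, (d : ℕ∞) ≤ Q.height := fun Q hQ =>
    hge.trans (Ideal.height_mono hQ.1.2)
  obtain ⟨P₁, hP₁, hP₁le⟩ := Ideal.exists_minimalPrimes_le hIP₀
  have hP₁d : P₁.height = d := le_antisymm (hd ▸ Ideal.height_mono hP₁le) (hge' P₁ hP₁)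
  by_contra hne
  have hfin : I.minimalPrimes.Finite := Ideal.finite_minimalPrimes_of_isNoetherianRing R _
  let U : Finset (Ideal R) := hfin.toFinset.filter fun Q => Q.height = d
  let W : Finset (Ideal R) := hfin.toFinset.filter fun Q => Q.height ≠ d
  have hU : ∀ Q, Q ∈ U ↔ Q ∈ I.minimalPrimes ∧ Q.height = d := fun Q => by simp [U]
  have hW : ∀ Q, Q ∈ W ↔ Q ∈ I.minimalPrimes ∧ Q.height ≠ d := fun Q => by simp [W]
  have hUW : ∀ Q ∈ U, ∀ Q' ∈ W, ¬ Q ≤ Q' ∧ ¬ Q' ≤ Q := by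
    intro Q hQ Q' hQ'
    rw [hU] at hQ
    rw [hW] at hQ'
    constructor
    · intro h
      exact hQ'.2 ((h.antisymm (hQ'.1.2 hQ.1.1 h)) ▸ hQ.2)
    · intro h
      exact hQ'.2 ((h.antisymm (hQ.1.2 hQ'.1.1 h)) ▸ hQ.2)
  have hrad : U.inf id * W.inf id ≤ I.radical := by
    rw [← Ideal.sInf_minimalPrimes]
    refine le_sInf fun Q hQ => ?_
    by_cases h : Q.height = d
    · exact Ideal.mul_le_left.trans (Finset.inf_le (f := id) ((hU Q).2 ⟨hQ, h⟩))
    · exact Ideal.mul_le_right.trans (Finset.inf_le (f := id) ((hW Q).2 ⟨hQ, h⟩))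
  obtain ⟨N, hN⟩ := Ideal.exists_pow_le_of_le_radical_of_fg hrad (IsNoetherian.noetherian _)
  have h12 : (U.inf id) ^ (N + 1) * (W.inf id) ^ (N + 1) ≤ I := by
    rw [← mul_pow]
    exact (Ideal.pow_le_pow_right (Nat.le_succ N)).trans hN
  have hm : (U.inf id) ^ (N + 1) ⊔ (W.inf id) ^ (N + 1) ≤ maximalIdeal R :=
    sup_le ((Ideal.pow_le_self (Nat.succ_ne_zero N)).trans
      ((Finset.inf_le (f := id) ((hU P₁).2 ⟨hP₁, hP₁d⟩)).trans (le_maximalIdeal hP₁.1.1.ne_top)))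
      ((Ideal.pow_le_self (Nat.succ_ne_zero N)).trans
      ((Finset.inf_le (f := id) ((hW P).2 ⟨hP, hne⟩)).trans (le_maximalIdeal hP.1.1.ne_top)))
  obtain ⟨𝔮, h𝔮, -⟩ := Ideal.exists_minimalPrimes_le hm
  have h𝔮p : 𝔮.IsPrime := h𝔮.1.1
  obtain ⟨Pa, hPa, hPaq⟩ := le_of_pow_inf_le h𝔮p (le_sup_left.trans h𝔮.1.2)
  obtain ⟨Pb, hPb, hPbq⟩ := le_of_pow_inf_le h𝔮p (le_sup_right.trans h𝔮.1.2)
  have hPa' := (hU Pa).1 hPa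
  have hPb' := (hW Pb).1 hPb
  have hIq : I ≤ 𝔮 := hPa'.1.1.2.trans hPaq
  obtain ⟨h, hh⟩ := exists_nat_height 𝔮
  have hPbp : Pb.IsPrime := hPb'.1.1.1
  have hlt : Pb < 𝔮 := lt_of_le_of_ne hPbq fun h => (hUW Pa hPa Pb hPb).1 (h ▸ hPaq)
  have h2 : d + 2 ≤ h := by
    have h3 : (d : ℕ∞) < Pb.height := lt_of_le_of_ne (hge' Pb hPb'.1) (Ne.symm hPb'.2)
    have h4 := (add_le_add_left (Order.add_one_le_of_lt h3) 1).trans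
      (Ideal.height_add_one_le_of_lt_of_isPrime hlt)
    rw [hh] at h4
    have : d + 1 + 1 ≤ h := by exact_mod_cast h4
    omega
  have hdim := hR.le_dim_quotient_map hPa'.1.1.1 hPa'.1.1.2 hPaq hPa'.2 hh
  have hdep := hS.depthGE 𝔮 hIq le_rfl (le_trans (by exact_mod_cast (by omega : 2 ≤ h - d)) hdim)
  have hB := (hR.localization 𝔮 hh).noeth
  rcases le_or_le_of_depthGE_two (map_le_maximalIdeal_atPrime hIq) hdep
    (𝔞₁ := ((U.inf id) ^ (N + 1)).map (algebraMap R (Localization.AtPrime 𝔮)))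
    (𝔞₂ := ((W.inf id) ^ (N + 1)).map (algebraMap R (Localization.AtPrime 𝔮)))
    (by rw [← Ideal.map_mul]; exact Ideal.map_mono h12)
    (by rw [← Ideal.map_sup]; exact map_le_maximalIdeal_atPrime h𝔮.1.2)
    (by rw [← Ideal.map_sup]; exact maximalIdeal_le_radical_map h𝔮) with h5 | h5
  · obtain ⟨Q, hQ, hQle⟩ := le_of_pow_inf_le hPbp
      (mem_map_atPrime_le hPbp hPbq (h5.trans (Ideal.map_mono hPb'.1.1.2)))
    exact (hUW Q hQ Pb hPb).1 hQle
  · obtain ⟨Q, hQ, hQle⟩ := le_of_pow_inf_le hPa'.1.1.1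
      (mem_map_atPrime_le hPa'.1.1.1 hPaq (h5.trans (Ideal.map_mono hPa'.1.1.2)))
    exact (hUW Pa hPa Q hQ).2 hQle

lemma CMLoc.depthGE_quotient_map {n d h j : ℕ} (hR : CMLoc R n) {I : Ideal R}
    (hS : SerreS (R ⧸ I) 2) (hmin : ∀ P ∈ I.minimalPrimes, P.height = d) {𝔮 : Ideal R} [𝔮.IsPrime]
    (hI : I ≤ 𝔮) (hh : 𝔮.height = h) (hj : j ≤ 2) (hjh : j ≤ h - d) :
    DepthGE (Localization.AtPrime 𝔮) j (Localization.AtPrime 𝔮 ⧸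
      I.map (algebraMap R (Localization.AtPrime 𝔮))) := by
  obtain ⟨P, hP, hPq⟩ := Ideal.exists_minimalPrimes_le hI
  exact hS.depthGE 𝔮 hI hj (le_trans (by exact_mod_cast hjh)
    (hR.le_dim_quotient_map hP.1.1 hP.1.2 hPq (hmin P hP) hh))

variable {b : ℕ → ℕ}

lemma MatRes.mem_map_iff {I : Ideal R} {N : MatRes R b} {i₀ : Fin (b 0)}
    (hI : ∀ a, a ∈ I ↔ ∃ v, (N.D 0).mulVec v i₀ = a) (S : Submonoid R) (B : Type u) [CommRing B]
    [Algebra R B] [IsLocalization S B] (x : B) : x ∈ I.map (algebraMap R B) ↔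
      ∃ v, ((N.localize S B).D 0).mulVec v i₀ = x := by
  constructor
  · intro hx
    induction hx using Submodule.span_induction with
    | mem x h =>
      obtain ⟨a, ha, rfl⟩ := h
      obtain ⟨v, rfl⟩ := (hI a).1 ha
      exact ⟨algebraMap R B ∘ v, (RingHom.map_mulVec _ _ _ _).symm⟩
    | zero => exact ⟨0, by simp⟩
    | add x y _ _ h1 h2 =>
      obtain ⟨v, rfl⟩ := h1
      obtain ⟨w, rfl⟩ := h2
      exact ⟨v + w, by rw [Matrix.mulVec_add, Pi.add_apply]⟩
    | smul a x _ h1 =>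
      obtain ⟨v, rfl⟩ := h1
      exact ⟨a • v, by rw [Matrix.mulVec_smul, Pi.smul_apply]⟩
  · rintro ⟨v, rfl⟩
    simp only [Matrix.mulVec, dotProduct]
    refine Ideal.sum_mem _ fun k _ => (I.map (algebraMap R B)).mul_mem_right _ ?_
    refine Ideal.mem_map_of_mem _ ((hI _).2 ⟨Pi.single k 1, ?_⟩)
    rw [Matrix.mulVec_single_one]
    rfl

/-- Heights of the splitting ideals. -/
lemma MatRes.le_height_of_splitIdeal_le {n d : ℕ} (hR : RegLoc R n) {I : Ideal R}
    (hS : SerreS (R ⧸ I) 2) (hmin : ∀ P ∈ I.minimalPrimes, P.height = d) {N : MatRes R b}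
    {i₀ : Fin (b 0)} (hi : ∀ k, k = i₀) (hI : ∀ a, a ∈ I ↔ ∃ v, (N.D 0).mulVec v i₀ = a)
    {j : ℕ} {𝔮 : Ideal R} (h𝔮 : 𝔮.IsPrime) (hle : N.splitIdeal (d + j) ≤ 𝔮) :
    ((d + j + 3 : ℕ) : ℕ∞) ≤ 𝔮.height := by
  have := hR.noeth
  have hC := hR.cmLoc
  obtain ⟨h, hh⟩ := exists_nat_height 𝔮
  have hIq : I ≤ 𝔮 := (MatRes.le_splitIdeal hi hI _).trans hle
  have hdh : d ≤ h := by
    obtain ⟨P, hP, hPq⟩ := Ideal.exists_minimalPrimes_le hIq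
    have := Ideal.height_mono hPq
    rw [hmin P hP, hh] at this
    exact_mod_cast this
  rw [hh]
  by_contra hcon
  have hlt : h ≤ d + j + 2 := by
    have : ¬ (d + j + 3 ≤ h) := fun h' => hcon (by exact_mod_cast h')
    omega
  have hd := hC.depthGE_quotient_map hS hmin hIq hh (min_le_left 2 (h - d)) (min_le_right 2 (h - d))
  have hB := hC.localization 𝔮 hh
  have key : ∀ k s, s + k = n + d + j → d + j ≤ s →
      (N.localize 𝔮.primeCompl (Localization.AtPrime 𝔮)).Split s := by
    intro k
    induction k with
    | zero =>
      intro s hs _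
      exact (N.split_of_regLoc hR (by omega)).localize _ _
    | succ k ih =>
      intro s hs hjs
      refine MatRes.split_of_depthGE hB _ hi (N.mem_map_iff hI _ _) (map_le_maximalIdeal_atPrime hIq)
        (by omega) hd (by omega) (ih (s + 1) (by omega) (by omega))
  obtain ⟨a, ha, ha'⟩ := MatRes.exists_mem_splitIdeal _ (key n (d + j) (by omega) le_rfl)
  exact ha (hle ha')

end Equidimensional

section PrimeChoice

variable {R : Type u} [CommRing R]

lemma exists_assP_colon [IsNoetherianRing R] {J I : Ideal R} (hlt : ¬ I ≤ J) :
    ∃ c ∈ I, ∃ P, AssP P (R ⧸ J) ∧ ∀ a, a ∈ P ↔ a * c ∈ J := by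
  obtain ⟨x, hxI, hxJ⟩ := Set.not_subset.1 hlt
  have hmk : ∀ x, Ideal.Quotient.mk J x = 0 ↔ x ∈ J := fun x => Ideal.Quotient.eq_zero_iff_mem
  let M : Submodule R (R ⧸ J) := Submodule.map (Submodule.mkQ J) I
  have hx : (⟨Submodule.mkQ J x, x, hxI, rfl⟩ : M) ≠ 0 := fun h =>
    hxJ ((hmk x).1 (congrArg Subtype.val h))
  obtain ⟨P, ⟨hP, ⟨_, c, hcI, rfl⟩, hc⟩, -⟩ := exists_assP (A := R) (M := M) hx
  have key : ∀ a, a ∈ P ↔ a * c ∈ J := fun a => by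
    rw [hc, ← hmk]
    exact Subtype.ext_iff
  exact ⟨c, hcI, P, ⟨hP, Ideal.Quotient.mk J c, fun a => by rw [key, ← hmk]; rfl⟩, key⟩

variable [IsLocalRing R]

lemma CMLoc.height_le_add_one_of_mem_minimalPrimes {n d : ℕ} (hR : CMLoc R n) {P Q : Ideal R}
    (hP : P.IsPrime) (hd : P.height = d) {a : R} (hQ : Q ∈ (P ⊔ Ideal.span {a}).minimalPrimes) :
    Q.height ≤ (d + 1 : ℕ) := by
  have := hR.noeth
  have hQp : Q.IsPrime := hQ.1.1
  obtain ⟨h, hh⟩ := exists_nat_height Q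
  have hPQ : P ≤ Q := le_sup_left.trans hQ.1.2
  have hB := (hR.localization Q hh).noeth
  have hdim := hR.le_dim_quotient_map hP le_rfl hPQ hd hh
  have hle := map_le_maximalIdeal_atPrime hPQ
  have hloc := isLocalRing_quotient (ne_top_of_le_ne_top (maximalIdeal.isMaximal _).ne_top hle)
  have h1 : maximalIdeal (Localization.AtPrime Q) ∈
      (P.map (algebraMap R (Localization.AtPrime Q)) ⊔
        Ideal.span {algebraMap R (Localization.AtPrime Q) a}).minimalPrimes := by
    have h2 := maximalIdeal_le_radical_map hQ
    have h3 := map_le_maximalIdeal_atPrime hQ.1.2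
    rw [Ideal.map_sup, Ideal.map_span, Set.image_singleton] at h2 h3
    refine ⟨⟨inferInstance, h3⟩, fun K hK _ => h2.trans ?_⟩
    exact hK.1.radical_le_iff.2 hK.2
  have h4 := Ideal.map_height_le_one_of_mem_minimalPrimes h1
  rw [← maximalIdeal_quotient] at h4
  rw [← IsLocalRing.maximalIdeal_height_eq_ringKrullDim] at hdim
  have h5 := (WithBot.coe_le_coe.1 hdim).trans h4
  rw [hh]
  have : h - d ≤ 1 := by exact_mod_cast h5
  exact_mod_cast (by omega : h ≤ d + 1)

lemma RegLoc.exists_prime_of_char {n d : ℕ} (hR : RegLoc R n) {P : Ideal R} (hP : P.IsPrime)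
    (hd : P.height = d) : ∃ (Q : Ideal R) (h : ℕ) (w : ℕ → R), Q.IsPrime ∧ P ≤ Q ∧ h ≤ d + 1 ∧
      Q.height = h ∧ (∀ j < h, w j ∈ Q) ∧ (h : ℕ∞) ≤ (initIdeal w h).height ∧
      ((∀ p : ℕ, p.Prime → IsUnit (p : R)) ∨ ∃ p : ℕ, p.Prime ∧ (p : R) ∈ initIdeal w h) := by
  have := hR.noeth
  by_cases hu : ∀ p : ℕ, p.Prime → IsUnit (p : R)
  · obtain ⟨w, hw, hwh⟩ := exists_le_height hd.ge
    exact ⟨P, d, w, hP, le_rfl, by omega, hd, hw, hwh, Or.inl hu⟩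
  push Not at hu
  obtain ⟨p, hp, hpu⟩ := hu
  by_cases h0 : (p : R) = 0
  · obtain ⟨w, hw, hwh⟩ := exists_le_height hd.ge
    exact ⟨P, d, w, hP, le_rfl, by omega, hd, hw, hwh, Or.inr ⟨p, hp, h0 ▸ zero_mem _⟩⟩
  have hle : P ⊔ Ideal.span {(p : R)} ≤ maximalIdeal R :=
    sup_le (le_maximalIdeal hP.ne_top)
      (by rw [Ideal.span_singleton_le_iff_mem, mem_maximalIdeal]; exact hpu)
  obtain ⟨Q, hQ, -⟩ := Ideal.exists_minimalPrimes_le hle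
  have hQp : Q.IsPrime := hQ.1.1
  have hQd := hR.cmLoc.height_le_add_one_of_mem_minimalPrimes hP hd hQ
  obtain ⟨h, hh⟩ := exists_nat_height Q
  have hpQ : (p : R) ∈ Q := hQ.1.2 (Ideal.mem_sup_right (Ideal.mem_span_singleton_self _))
  have hw0 : ((1 : ℕ) : ℕ∞) ≤ (initIdeal (fun _ => (p : R)) 1).height := by
    have := hR.isDomain
    have h1 := add_one_le_height_sup (I := (⊥ : Ideal R)) (h := 0) bot_le (b := (p : R))
      (fun K hK => by
        rw [Ideal.minimalPrimes_eq_subsingleton_self, Set.mem_singleton_iff] at hK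
        rw [hK]
        exact h0)
    rw [bot_sup_eq] at h1
    rw [initIdeal_succ, initIdeal_zero, bot_sup_eq]
    simpa using h1
  have h1h : 1 ≤ h := by
    have h2 := hw0.trans (Ideal.height_mono (J := Q)
      (initIdeal_le_iff.2 fun j _ => hpQ))
    rw [hh] at h2
    exact_mod_cast h2
  obtain ⟨w, hw1, hw2, hw3⟩ := exists_extend_le_height h1h hh.ge hw0
  refine ⟨Q, h, w, hQp, le_sup_left.trans hQ.1.2, by rw [hh] at hQd; exact_mod_cast hQd, hh, ?_,
    hw3, Or.inr ⟨p, hp, hw1 0 one_pos ▸ mem_initIdeal h1h⟩⟩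
  intro j hj
  rcases Nat.eq_zero_or_pos j with rfl | hj0
  · exact hw1 0 one_pos ▸ hpQ
  · exact hw2 j hj0 hj

lemma exists_param_sequence {n h : ℕ} (hR : CMLoc R n) {w : ℕ → R}
    (hw : ∀ j < h, w j ∈ maximalIdeal R) (hwh : (h : ℕ∞) ≤ (initIdeal w h).height)
    {B : ℕ → Ideal R} (hB : ∀ i, ((h + i + 1 : ℕ) : ℕ∞) ≤ (B i).height) :
    ∀ k, h + k ≤ n → ∃ s : ℕ → R, (∀ j < h, s j = w j) ∧ (∀ i < k, s (h + i) ∈ B i) ∧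
      (∀ j < h + k, s j ∈ maximalIdeal R) ∧ ((h + k : ℕ) : ℕ∞) ≤ (initIdeal s (h + k)).height := by
  have := hR.noeth
  intro k
  induction k with
  | zero => exact fun _ => ⟨w, fun _ _ => rfl, by simp, hw, hwh⟩
  | succ k ih =>
    intro hk
    obtain ⟨s, hs1, hs2, hs3, hs4⟩ := ih (by omega)
    have hBm : ((h + k + 1 : ℕ) : ℕ∞) ≤ (B k ⊓ maximalIdeal R).height := by
      rw [le_height_iff]
      intro P hP hle
      rcases hP.inf_le.1 hle with h1 | h1
      · exact (hB k).trans (Ideal.height_mono h1)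
      · refine le_trans ?_ (Ideal.height_mono h1)
        rw [hR.height]
        exact_mod_cast hk
    obtain ⟨b, hb, hb'⟩ := exists_add_one_le_height hs4 hBm
    have hne : ∀ j < h + k, Function.update s (h + k) b j = s j := fun j hj =>
      Function.update_of_ne (by omega) _ _
    refine ⟨Function.update s (h + k) b, fun j hj => (hne j (by omega)).trans (hs1 j hj), ?_, ?_,
      hb' _ hne (Function.update_self _ _ _)⟩
    · intro i hi
      rcases Nat.lt_succ_iff_lt_or_eq.1 hi with h1 | rfl
      · rw [hne _ (by omega)]; exact hs2 i h1
      · rw [Function.update_self]; exact hb.1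
    · intro j hj
      obtain h1 | rfl : j < h + k ∨ j = h + k := by omega
      · rw [hne _ h1]; exact hs3 j h1
      · rw [Function.update_self]; exact hb.2

end PrimeChoice

section Core

variable {R : Type u} [CommRing R] {b : ℕ → ℕ}

/-- The multipliers bringing `ζ` into the image of `M` modulo `P`. -/
def liftIdeal {p q : ℕ} (M : Matrix (Fin p) (Fin q) R) (P : Ideal R) (ζ : Fin p → R) : Ideal R where
  carrier := {a | ∃ v, ∀ k, (a • ζ - M.mulVec v) k ∈ P}
  zero_mem' := ⟨0, fun k => by simp⟩
  add_mem' := by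
    rintro a a' ⟨v, hv⟩ ⟨w, hw⟩
    refine ⟨v + w, fun k => ?_⟩
    have : (a + a') • ζ - M.mulVec (v + w) = (a • ζ - M.mulVec v) + (a' • ζ - M.mulVec w) := by
      rw [Matrix.mulVec_add, add_smul]
      abel
    rw [this]
    exact P.add_mem (hv k) (hw k)
  smul_mem' := by
    rintro a a' ⟨v, hv⟩
    refine ⟨a • v, fun k => ?_⟩
    rw [Matrix.mulVec_smul, smul_assoc, ← smul_sub]
    exact P.mul_mem_left a (hv k)

lemma MatRes.mem_liftIdeal_of_mem_splitIdeal {N : MatRes R b} {d : ℕ} {J P : Ideal R} {c a : R}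
    (hc : c ∈ N.splitIdeal d) (hcP : ∀ u, u * c ∈ J → u ∈ P) {ζ : Fin (b (d + 1)) → R}
    (hζ : ∀ k, (N.D d).mulVec ζ k ∈ J) (ha : a ∈ N.splitIdeal (d + 1)) :
    a ∈ liftIdeal (N.D (d + 1)) P ζ := by
  obtain ⟨g, hg⟩ := ha
  obtain ⟨h, g', hh⟩ := MatRes.exists_homotopy hc
  refine ⟨g.mulVec ζ, fun k => hcP _ ?_⟩
  have h1 : c • ζ = (N.D (d + 1)).mulVec (h.mulVec ζ) + g'.mulVec ((N.D d).mulVec ζ) := by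
    have := congrArg (·.mulVec ζ) hh
    simpa [Matrix.smul_mulVec, Matrix.add_mulVec] using this
  let p : Matrix (Fin (b (d + 1))) (Fin (b (d + 1))) R := a • 1 - N.D (d + 1) * g
  have hp : ∀ v, p.mulVec v = a • v - (N.D (d + 1)).mulVec (g.mulVec v) := fun v => by
    simp [p, Matrix.sub_mulVec, Matrix.smul_mulVec]
  have hpD : ∀ v, p.mulVec ((N.D (d + 1)).mulVec v) = 0 := fun v => by
    rw [hp, Matrix.mulVec_mulVec, Matrix.mulVec_mulVec, hg, Matrix.smul_mulVec,
      sub_self]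
  have h2 : c • p.mulVec ζ = p.mulVec (g'.mulVec ((N.D d).mulVec ζ)) := by
    rw [← Matrix.mulVec_smul, h1, Matrix.mulVec_add, hpD, zero_add]
  rw [← hp, mul_comm]
  have h3 := congrFun h2 k
  rw [Pi.smul_apply, smul_eq_mul] at h3
  rw [h3]
  exact Matrix.mulVec_mem_ideal _ (fun j => Matrix.mulVec_mem_ideal _ hζ j) k

/-- No functional splitting off `ζ` vanishes modulo the maximal ideal on the boundaries. -/
theorem MatRes.dotProduct_ne_one [IsLocalRing R] {n d : ℕ} (hR : RegLoc R n) {I J : Ideal R}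
    (hS : SerreS (R ⧸ I) 2) (hmin : ∀ P ∈ I.minimalPrimes, P.height = (d + 1 : ℕ)) {N : MatRes R b}
    {i₀ : Fin (b 0)} (hi : ∀ k, k = i₀) (hI : ∀ a, a ∈ I ↔ ∃ v, (N.D 0).mulVec v i₀ = a)
    (hIJ : ¬ I ≤ J) (hJ : ∀ P : Ideal R, AssP P (R ⧸ J) → P.height = (d + 1 : ℕ))
    {ζ e : Fin (b (d + 1)) → R} (hζ : ∀ k, (N.D d).mulVec ζ k ∈ J)
    (heD : ∀ j, Matrix.vecMul e (N.D (d + 1)) j ∈ maximalIdeal R) : e ⬝ᵥ ζ ≠ 1 := by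
  intro heζ
  have := hR.noeth
  have hC := hR.cmLoc
  obtain ⟨c₀, hc₀, P₀, hP₀, hcP₀⟩ := exists_assP_colon hIJ
  obtain ⟨P, h, w, hP, hP₀P, hhd, hh, hwP, hwh, hchar⟩ :=
    hR.exists_prime_of_char hP₀.1 (hJ _ hP₀)
  have hwm : ∀ j < h, w j ∈ maximalIdeal R := fun j hj => le_maximalIdeal hP.ne_top (hwP j hj)
  have hhn : h ≤ n := hC.le_of_le_height hP.ne_top hh.ge
  have hPw : P ∈ (initIdeal w h).minimalPrimes :=
    Ideal.mem_minimalPrimes_of_height_le (initIdeal_le_iff.2 hwP) (hh.le.trans hwh)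
  obtain ⟨-, c', hc'⟩ := assP_of_mem_minimalPrimes hPw
  obtain ⟨c, rfl⟩ := Ideal.Quotient.mk_surjective c'
  have hc : ∀ a, a ∈ P ↔ a * c ∈ initIdeal w h := fun a => by
    rw [hc', ← Ideal.Quotient.eq_zero_iff_mem, map_mul]
    rfl
  let B : ℕ → Ideal R := fun i => N.splitIdeal (d + 1 + (i - 1))
  have hB : ∀ i, ((h + i + 1 : ℕ) : ℕ∞) ≤ (B i).height := fun i => le_height_iff.2
    fun 𝔮 h𝔮 hle => le_trans (by exact_mod_cast (by omega : h + i + 1 ≤ d + 1 + (i - 1) + 3))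
      (MatRes.le_height_of_splitIdeal_le hR hS hmin hi hI h𝔮 hle)
  obtain ⟨s, hs1, hs2, hs3, hs4⟩ := exists_param_sequence hC hwm hwh hB (n - h) (by omega)
  rw [Nat.add_sub_cancel' hhn] at hs3 hs4
  let x : ℕ → R := fun i => if i < n - h then s (h + i) else 1
  have hx : ∀ i ≤ n - h, x i ∈ B i := by
    intro i hi
    by_cases h1 : i < n - h
    · simp only [x, if_pos h1]
      exact hs2 i h1
    · have : B i = ⊤ := by
        by_contra hne
        have := hC.le_of_le_height hne (hB i)
        omega
      rw [this]
      trivial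
  have hhom : ∀ m i, ∃ (H : Matrix (Fin (b (d + 1 + m + 2))) (Fin (b (d + 1 + m + 1))) R)
      (G : Matrix (Fin (b (d + 1 + m + 1))) (Fin (b (d + 1 + m))) R), m < n - h → i ≤ m + 1 →
      x i • (1 : Matrix (Fin (b (d + 1 + m + 1))) (Fin (b (d + 1 + m + 1))) R) =
        N.D (d + 1 + m + 1) * H + G * N.D (d + 1 + m) := by
    intro m i
    by_cases h1 : m < n - h ∧ i ≤ m + 1
    · obtain ⟨H, G, hHG⟩ := MatRes.exists_homotopy
        (N.splitIdeal_mono (by omega : d + 1 + (i - 1) ≤ d + 1 + m) (hx i (by omega)))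
      exact ⟨H, G, fun _ _ => hHG⟩
    · exact ⟨0, 0, fun h2 h3 => absurd ⟨h2, h3⟩ h1⟩
  choose H G hHG using hhom
  have hx0 : x 0 ∈ N.splitIdeal (d + 1) := hx 0 (Nat.zero_le _)
  obtain ⟨v, hv⟩ := MatRes.mem_liftIdeal_of_mem_splitIdeal (P := P)
    (MatRes.le_splitIdeal hi hI d hc₀) (fun u hu => hP₀P ((hcP₀ u).2 hu)) hζ hx0
  let Q : ChaseData R (n - h) (fun l => b (d + 1 + l)) (b (d + 1)) :=
    { D := fun l => N.D (d + 1 + l)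
      x := x
      H := H
      G := G
      ζ := ζ
      e := e
      v := v
      f := fun k => (x 0 • ζ - (N.D (d + 1)).mulVec v) k
      y := fun k => Pi.single k 1
      dd := fun l _ => N.dd _
      xr := by simp [x]
      hom := fun m hm i hi => hHG m i hm hi
      rel := by
        rw [← pi_eq_sum_univ']
        exact (add_sub_cancel _ _).symm
      eζ := heζ }
  have hinit : initIdeal s h = initIdeal w h := initIdeal_congr hs1
  have hcf : ∀ k, c * Q.f k ∈ initIdeal s h := fun k => by
    rw [hinit, mul_comm, ← hc]
    exact hv k
  have hxs : ∀ i < n - h, Q.x i = s (h + i) := fun i hi => if_pos hi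
  have hrad := hC.maximalIdeal_le_radical hs4
  have hcmem : c ∈ initIdeal s h := by
    rcases hchar with hu | ⟨p, hp, hpw⟩
    · exact Q.mem_initIdeal_of_isUnit hR hu (by omega) hs3 hrad hxs hcf heD
    · exact Q.mem_initIdeal (by omega) hC hs3 hrad p hp (hinit ▸ hpw) hxs hcf heD
  exact hP.ne_top ((Ideal.eq_top_iff_one _).2 ((hc 1).2 (by rwa [one_mul, ← hinit])))

end Core

section Lifting

variable {R : Type u} [CommRing R]

lemma exists_comp_eq_of_forall {A B C : Type u} [AddCommGroup A] [Module R A] [AddCommGroup B]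
    [Module R B] [AddCommGroup C] [Module R C] [Module.Projective R C] (f : A →ₗ[R] B)
    (g : C →ₗ[R] B) (h : ∀ x, ∃ y, f y = g x) : ∃ k : C →ₗ[R] A, f.comp k = g := by
  obtain ⟨k, hk⟩ := Module.projective_lifting_property f.rangeRestrict (g.codRestrict f.range h)
    f.surjective_rangeRestrict
  refine ⟨k, LinearMap.ext fun x => ?_⟩
  exact congrArg Subtype.val (LinearMap.congr_fun hk x)

variable {C E : ℕ → Type u} [∀ n, AddCommGroup (C n)] [∀ n, Module R (C n)]
  [∀ n, AddCommGroup (E n)] [∀ n, Module R (E n)] [∀ n, Module.Projective R (C n)]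
  {M : Type u} [AddCommGroup M] [Module R M]

/-- Comparison of a complex of projective modules with an exact complex. -/
lemma exists_chainMap {dC : ∀ n, C (n + 1) →ₗ[R] C n} (hdC : ∀ n x, dC n (dC (n + 1) x) = 0)
    {dE : ∀ n, E (n + 1) →ₗ[R] E n} (hE : ∀ n x, dE n x = 0 → ∃ y, dE (n + 1) y = x)
    {εC : C 0 →ₗ[R] M} (hεC : ∀ x, εC (dC 0 x) = 0) {εE : E 0 →ₗ[R] M}
    (hεE : ∀ x, εE x = 0 → ∃ y, dE 0 y = x) (hsurj : Function.Surjective εE) (n : ℕ) :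
    ∃ φ : ∀ k, C k →ₗ[R] E k, (∀ x, εE (φ 0 x) = εC x) ∧
      ∀ k < n, ∀ x, φ k (dC k x) = dE k (φ (k + 1) x) := by
  induction n with
  | zero =>
    obtain ⟨f, hf⟩ := exists_comp_eq_of_forall εE εC fun x => hsurj _
    refine ⟨Function.update (fun _ => 0) 0 f, fun x => ?_, by simp⟩
    rw [Function.update_self]
    exact LinearMap.congr_fun hf x
  | succ n ih =>
    obtain ⟨φ, h0, hφ⟩ := ih
    have hex : ∀ x, ∃ y, dE n y = (φ n).comp (dC n) x := by
      intro x
      cases n with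
      | zero => exact hεE _ (by rw [LinearMap.comp_apply, h0, hεC])
      | succ n =>
        exact hE n _ (by rw [LinearMap.comp_apply, ← hφ n (Nat.lt_succ_self n), hdC, map_zero])
    obtain ⟨f, hf⟩ := exists_comp_eq_of_forall (dE n) ((φ n).comp (dC n)) hex
    have hne : ∀ k ≤ n, Function.update φ (n + 1) f k = φ k := fun k hk =>
      Function.update_of_ne (by omega) _ _
    refine ⟨Function.update φ (n + 1) f, fun x => by rw [hne 0 (Nat.zero_le _), h0], ?_⟩
    intro k hk x
    rw [hne k (by omega)]
    rcases Nat.lt_succ_iff_lt_or_eq.1 hk with h1 | rfl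
    · rw [hne (k + 1) h1, hφ k h1]
    · rw [Function.update_self]
      exact (LinearMap.congr_fun hf x).symm

/-- A chain map lifting zero is null-homotopic. -/
lemma exists_homotopy_zero {dC : ∀ n, C (n + 1) →ₗ[R] C n} (hdC : ∀ n x, dC n (dC (n + 1) x) = 0)
    {dE : ∀ n, E (n + 1) →ₗ[R] E n} (hE : ∀ n x, dE n x = 0 → ∃ y, dE (n + 1) y = x)
    {εE : E 0 →ₗ[R] M} (hεE : ∀ x, εE x = 0 → ∃ y, dE 0 y = x) (φ : ∀ k, C k →ₗ[R] E k)
    (h0 : ∀ x, εE (φ 0 x) = 0) (n : ℕ) (hφ : ∀ k < n, ∀ x, φ k (dC k x) = dE k (φ (k + 1) x)) :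
    ∃ s : ∀ k, C k →ₗ[R] E (k + 1), (∀ x, φ 0 x = dE 0 (s 0 x)) ∧
      ∀ k < n, ∀ x, φ (k + 1) x = dE (k + 1) (s (k + 1) x) + s k (dC k x) := by
  induction n with
  | zero =>
    obtain ⟨f, hf⟩ := exists_comp_eq_of_forall (dE 0) (φ 0) fun x => hεE _ (h0 x)
    refine ⟨Function.update (fun _ => 0) 0 f, fun x => ?_, by simp⟩
    rw [Function.update_self]
    exact (LinearMap.congr_fun hf x).symm
  | succ n ih =>
    obtain ⟨s, hs0, hs⟩ := ih fun k hk => hφ k (by omega)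
    have hex : ∀ x, ∃ y, dE (n + 1) y = (φ (n + 1) - (s n).comp (dC n)) x := by
      intro x
      refine hE n _ ?_
      rw [LinearMap.sub_apply, map_sub, ← hφ n (Nat.lt_succ_self n), LinearMap.comp_apply]
      cases n with
      | zero => rw [hs0, sub_self]
      | succ n => rw [hs n (Nat.lt_succ_self n), hdC, map_zero, add_zero, sub_self]
    obtain ⟨f, hf⟩ := exists_comp_eq_of_forall (dE (n + 1)) _ hex
    have hne : ∀ k ≤ n, Function.update s (n + 1) f k = s k := fun k hk =>
      Function.update_of_ne (by omega) _ _
    refine ⟨Function.update s (n + 1) f, fun x => by rw [hne 0 (Nat.zero_le _), hs0], ?_⟩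
    intro k hk x
    rw [hne k (by omega)]
    rcases Nat.lt_succ_iff_lt_or_eq.1 hk with h1 | rfl
    · rw [hne (k + 1) h1, hs k h1]
    · rw [Function.update_self]
      have := LinearMap.congr_fun hf x
      rw [LinearMap.comp_apply] at this
      rw [this, LinearMap.sub_apply, LinearMap.comp_apply, sub_add_cancel]

lemma LinearMap.map_mem_smul_top {A B : Type u} [AddCommGroup A] [Module R A] [AddCommGroup B]
    [Module R B] (f : A →ₗ[R] B) {I : Ideal R} {x : A} (hx : x ∈ I • (⊤ : Submodule R A)) :
    f x ∈ I • (⊤ : Submodule R B) := by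
  have h := Submodule.mem_map_of_mem (f := f) hx
  rw [Submodule.map_smul''] at h
  exact Submodule.smul_mono le_rfl le_top h

lemma mem_smul_top_pi_iff {m : ℕ} {I : Ideal R} {x : Fin m → R} :
    x ∈ I • (⊤ : Submodule R (Fin m → R)) ↔ ∀ k, x k ∈ I := by
  constructor
  · intro hx k
    simpa using LinearMap.map_mem_smul_top (LinearMap.proj (R := R) (φ := fun _ : Fin m => R) k) hx
  · intro hx
    rw [pi_eq_sum_univ' x]
    exact Submodule.sum_mem _ fun k _ => Submodule.smul_mem_smul (hx k) trivial

lemma exists_dotProduct_eq_one [IsLocalRing R] {p q : ℕ} (M : Matrix (Fin p) (Fin q) R)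
    {ζ : Fin p → R} (h : ¬ ∃ w, ∀ k, (ζ - M.mulVec w) k ∈ maximalIdeal R) :
    ∃ e : Fin p → R, e ⬝ᵥ ζ = 1 ∧ ∀ j, Matrix.vecMul e M j ∈ maximalIdeal R := by
  have hres : ∀ a, residue R a = 0 ↔ a ∈ maximalIdeal R := fun a => residue_eq_zero_iff a
  have hζ : residue R ∘ ζ ∉ LinearMap.range (M.map (residue R)).mulVecLin := by
    rintro ⟨w, hw⟩
    choose w' hw' using fun k => residue_surjective (R := R) (w k)
    refine h ⟨w', fun k => ?_⟩
    obtain rfl : residue R ∘ w' = w := funext hw'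
    rw [← hres, Pi.sub_apply, map_sub, RingHom.map_mulVec, sub_eq_zero]
    exact (congrFun hw k).symm
  obtain ⟨f, hf, hf'⟩ := Submodule.exists_le_ker_of_notMem hζ
  choose e he using fun k => residue_surjective (R := R) (f (Pi.single k 1))
  have hfe : ∀ v : Fin p → R, f (residue R ∘ v) = residue R (e ⬝ᵥ v) := by
    intro v
    rw [pi_eq_sum_univ' (residue R ∘ v), map_sum]
    simp only [dotProduct, map_sum, map_mul, map_smul, he, smul_eq_mul, Function.comp_apply]
    exact Finset.sum_congr rfl fun k _ => mul_comm _ _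
  have hu : IsUnit (e ⬝ᵥ ζ) := by
    rw [← residue_ne_zero_iff_isUnit, ← hfe]
    exact hf
  obtain ⟨u, hu⟩ := hu
  refine ⟨(↑u⁻¹ : R) • e, by rw [smul_dotProduct, ← hu, smul_eq_mul, Units.inv_mul], fun j => ?_⟩
  rw [Matrix.smul_vecMul]
  refine Ideal.mul_mem_left _ _ ((hres _).1 ?_)
  have h1 := hf' ⟨Pi.single j 1, rfl⟩
  rw [Matrix.mulVecLin_apply, Matrix.mulVec_single_one] at h1
  exact (hfe fun i => M i j).symm.trans h1

end Lifting

section Comparison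

variable {R : Type u} [CommRing R]

lemma koszulD_mem_smul_top {s : ℕ} (x : Fin s → R) (n : ℕ) (v : KMod R s (n + 1)) :
    koszulD R x n v ∈ Ideal.span (Set.range x) • (⊤ : Submodule R (KMod R s n)) := by
  rw [koszulD, Finsupp.lsum_apply]
  refine Submodule.sum_mem _ fun T _ => ?_
  beta_reduce
  rw [LinearMap.toSpanSingleton_apply]
  refine Submodule.smul_mem _ _ (Submodule.sum_mem _ fun j _ => Submodule.smul_mem_smul ?_ trivial)
  exact Ideal.mul_mem_left _ _ (Ideal.subset_span ⟨j, rfl⟩)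

lemma ProjRes.d_d {M : Type u} [AddCommGroup M] [Module R M] (P : ProjRes R M) (n : ℕ)
    (x : P.F (n + 1 + 1)) : P.d n (P.d (n + 1) x) = 0 := by
  have : P.d (n + 1) x ∈ LinearMap.ker (P.d n) := P.exact n ▸ ⟨x, rfl⟩
  exact this

lemma ProjRes.exists_of_d_eq_zero {M : Type u} [AddCommGroup M] [Module R M] (P : ProjRes R M)
    (n : ℕ) (x : P.F (n + 1)) (hx : P.d n x = 0) : ∃ y, P.d (n + 1) y = x := by
  have : x ∈ LinearMap.range (P.d (n + 1)) := P.exact n ▸ hx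
  exact this

lemma ProjRes.ε_d {M : Type u} [AddCommGroup M] [Module R M] (P : ProjRes R M)
    (x : P.F (0 + 1)) : P.ε (P.d 0 x) = 0 := by
  have : P.d 0 x ∈ LinearMap.ker P.ε := P.exact0 ▸ ⟨x, rfl⟩
  exact this

lemma ProjRes.exists_of_ε_eq_zero {M : Type u} [AddCommGroup M] [Module R M] (P : ProjRes R M)
    (x : P.F 0) (hx : P.ε x = 0) : ∃ y, P.d 0 y = x := by
  have : x ∈ LinearMap.range (P.d 0) := P.exact0 ▸ hx
  exact this

theorem MatRes.koszulTorMapZero [IsLocalRing R] {d s : ℕ} {b : ℕ → ℕ} {I : Ideal R}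
    {N : MatRes R b} {i₀ : Fin (b 0)} (hi : ∀ k, k = i₀)
    (hI : ∀ a, a ∈ I ↔ ∃ v, (N.D 0).mulVec v i₀ = a) {z : Fin s → R}
    (hz : Ideal.span (Set.range z) ≤ maximalIdeal R)
    (h : ∀ ζ e : Fin (b (d + 1)) → R, (∀ k, (N.D d).mulVec ζ k ∈ Ideal.span (Set.range z)) →
      (∀ j, Matrix.vecMul e (N.D (d + 1)) j ∈ maximalIdeal R) → e ⬝ᵥ ζ ≠ 1) :
    KoszulTorMapZero R z I (d + 1) := by
  intro P L v
  have hproj := P.projective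
  let D : ∀ l, (Fin (b (l + 1)) → R) →ₗ[R] (Fin (b l) → R) := fun l => (N.D l).mulVecLin
  have hDD : ∀ l x, D l (D (l + 1) x) = 0 := fun l x => N.mulVec_mulVec_succ l x
  have hDE : ∀ l x, D l x = 0 → ∃ y, D (l + 1) y = x := fun l x hx => by
    obtain ⟨w, rfl⟩ := N.exact l x hx
    exact ⟨w, rfl⟩
  let ε : (Fin (b 0) → R) →ₗ[R] R ⧸ I := (Submodule.mkQ I).comp (LinearMap.proj i₀)
  have hε : ∀ x, ε x = 0 ↔ x i₀ ∈ I := fun x => Submodule.Quotient.mk_eq_zero I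
  have hεD : ∀ x, ε (D 0 x) = 0 := fun x => (hε _).2 ((hI _).2 ⟨x, rfl⟩)
  have hεE : ∀ x, ε x = 0 → ∃ y, D 0 y = x := fun x hx => by
    obtain ⟨w, hw⟩ := (hI _).1 ((hε x).1 hx)
    refine ⟨w, funext fun k => ?_⟩
    rw [hi k]
    exact hw
  have hsurj : Function.Surjective ε := fun y => by
    obtain ⟨a, rfl⟩ := Submodule.mkQ_surjective I y
    exact ⟨fun _ => a, rfl⟩
  obtain ⟨β, hβ0, hβ⟩ := exists_chainMap (C := fun n => P.F n) (E := fun l => Fin (b l) → R)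
    P.d_d hDE P.ε_d hεE hsurj (d + 2)
  obtain ⟨α, hα0, hα⟩ := exists_chainMap (C := fun l => Fin (b l) → R) (E := fun n => P.F n)
    hDD P.exists_of_d_eq_zero hεD P.exists_of_ε_eq_zero P.surj (d + 2)
  obtain ⟨σ, -, hσ⟩ := exists_homotopy_zero (C := fun n => P.F n) (E := fun n => P.F n) P.d_d
    P.exists_of_d_eq_zero P.exists_of_ε_eq_zero (fun k => (α k).comp (β k) - LinearMap.id)
    (fun x => by
      rw [LinearMap.sub_apply, map_sub, LinearMap.comp_apply, hα0, hβ0, LinearMap.id_apply, sub_self])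
    (d + 1) (fun k hk x => by
      rw [LinearMap.sub_apply, LinearMap.sub_apply, LinearMap.comp_apply, LinearMap.comp_apply,
        hβ k (by omega), hα k (by omega), map_sub]
      rfl)
  have hdψ : P.d d (L.ψ (d + 1) v) ∈ Ideal.span (Set.range z) • (⊤ : Submodule R (P.F d)) := by
    rw [← LinearMap.comp_apply, ← L.comm, LinearMap.comp_apply]
    exact LinearMap.map_mem_smul_top _ (koszulD_mem_smul_top z d v)
  have hζ : ∀ k, (N.D d).mulVec (β (d + 1) (L.ψ (d + 1) v)) k ∈ Ideal.span (Set.range z) := by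
    refine mem_smul_top_pi_iff.1 ?_
    have := LinearMap.map_mem_smul_top (β d) hdψ
    rwa [hβ d (by omega)] at this
  have hex : ∃ w, ∀ k, (β (d + 1) (L.ψ (d + 1) v) - (N.D (d + 1)).mulVec w) k ∈ maximalIdeal R := by
    by_contra hcon
    obtain ⟨e, he, heD⟩ := exists_dotProduct_eq_one _ hcon
    exact h _ e hζ heD he
  obtain ⟨w, hw⟩ := hex
  have h1 := LinearMap.map_mem_smul_top (α (d + 1)) (mem_smul_top_pi_iff.2 hw)
  have h2 : α (d + 1) ((N.D (d + 1)).mulVec w) = P.d (d + 1) (α (d + 1 + 1) w) :=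
    hα (d + 1) (by omega) w
  rw [map_sub, h2] at h1
  have h3 := LinearMap.map_mem_smul_top (σ d) hdψ
  have h4 := hσ d (Nat.lt_succ_self d) (L.ψ (d + 1) v)
  rw [LinearMap.sub_apply, LinearMap.comp_apply, LinearMap.id_apply, sub_eq_iff_eq_add] at h4
  have h5 : L.ψ (d + 1) v = P.d (d + 1) (α (d + 1 + 1) w - σ (d + 1) (L.ψ (d + 1) v)) +
      ((α (d + 1) (β (d + 1) (L.ψ (d + 1) v)) - P.d (d + 1) (α (d + 1 + 1) w)) -
        σ d (P.d d (L.ψ (d + 1) v))) := by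
    rw [map_sub, h4]
    abel
  rw [h5]
  exact Submodule.add_mem_sup ⟨_, rfl⟩ (Submodule.sub_mem _ h1 (Submodule.smul_mono hz le_rfl h3))

/-- A finite sequence extended by zero. -/
def extendZero {n : ℕ} (x : Fin n → R) (j : ℕ) : R := if h : j < n then x ⟨j, h⟩ else 0

lemma extendZero_apply {n : ℕ} (x : Fin n → R) (j : Fin n) : extendZero x j = x j := dif_pos j.2

lemma initIdeal_extendZero {n : ℕ} (x : Fin n → R) :
    initIdeal (extendZero x) n = Ideal.span (Set.range x) := by
  refine congrArg Ideal.span (Set.ext fun a => ⟨?_, ?_⟩)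
  · rintro ⟨j, hj, rfl⟩
    exact ⟨⟨j, hj⟩, (extendZero_apply x ⟨j, hj⟩).symm⟩
  · rintro ⟨j, rfl⟩
    exact ⟨j, j.2, extendZero_apply x j⟩

lemma range_map_extendZero {n : ℕ} (x : Fin n → R) :
    (List.range n).map (extendZero x) = List.ofFn x := by
  refine List.ext_getElem (by simp) fun j h1 h2 => ?_
  rw [List.getElem_map, List.getElem_range, List.getElem_ofFn]
  exact extendZero_apply x ⟨j, by simpa using h1⟩

lemma IsRegularLocal.exists_regLoc [IsLocalRing R] (h : IsRegularLocal R) : ∃ n, RegLoc R n := by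
  obtain ⟨hN, n, x, hx, hdim⟩ := h
  exact ⟨n, hN, ⟨extendZero x, (initIdeal_extendZero x).trans hx⟩, hdim⟩

end Comparison

/-- Let `(R,m,k)` be a regular local ring, let `I` be an ideal
of height `d` such that `R/I` satisfies Serre's condition `S_2`, and let
`z₁,…,z_d ∈ I` be an `R`-regular sequence with `(z₁,…,z_d) ≠ I`.  Then the
natural map `K_d(z;R) ⊗_R k → Tor_d^R(R/I, k)`, induced by a chain map from the
Koszul complex `K_•(z;R)` to a projective resolution of `R/I` lifting the
natural surjection `R/(z₁,…,z_d) → R/I`, is the zero map. -/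
theorem statement10
    (R : Type u) [CommRing R] [IsLocalRing R] (hreg : IsRegularLocal R)
    (I : Ideal R) (d : ℕ) (hht : HeightEq R I d)
    (hS2 : SerreS (R ⧸ I) 2)
    (z : Fin d → R) (hzI : ∀ j, z j ∈ I)
    (hzreg : RingTheory.Sequence.IsRegular R (List.ofFn z))
    (hne : Ideal.span (Set.range z) ≠ I) :
    KoszulTorMapZero R z I d := by
  obtain ⟨n, hR⟩ := hreg.exists_regLoc
  have := hR.noeth
  have hJI : Ideal.span (Set.range z) ≤ I := Ideal.span_le.2 (Set.range_subset_iff.2 hzI)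
  have hIJ : ¬ I ≤ Ideal.span (Set.range z) := fun h => hne (hJI.antisymm h)
  obtain ⟨⟨P₀, hP₀, hIP₀, hP₀d⟩, hge⟩ := hht
  have hkey : ∀ (P : Ideal R) (hP : P.IsPrime),
      ringKrullDim (@Localization.AtPrime R _ P hP) = P.height := fun P hP =>
    IsLocalization.AtPrime.ringKrullDim_eq_height P _
  rw [hkey] at hP₀d
  have hP₀h : P₀.height = d := by exact_mod_cast hP₀d
  have hge' : (d : ℕ∞) ≤ I.height := le_height_iff.2 fun P hP hIP => by
    have := hge P hP hIP
    rw [hkey] at this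
    exact_mod_cast this
  cases d with
  | zero =>
    have := hR.isDomain
    have h0 : P₀ ∈ minimalPrimes R := (Ideal.height_eq_zero_iff (I := P₀)).1 (by simpa using hP₀h)
    rw [IsDomain.minimalPrimes_eq_singleton_bot, Set.mem_singleton_iff] at h0
    exact absurd (hIP₀.trans (h0.le.trans bot_le)) hIJ
  | succ d =>
    obtain ⟨b, N, i₀, hi, hI⟩ := MatRes.exists_ideal I
    have hIm : I ≤ maximalIdeal R := hIP₀.trans (le_maximalIdeal hP₀.ne_top)
    have hzm : ∀ j < d + 1, extendZero z j ∈ maximalIdeal R := fun j hj =>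
      extendZero_apply z ⟨j, hj⟩ ▸ hIm (hzI ⟨j, hj⟩)
    have hzr := hzreg.toIsWeaklyRegular
    rw [← range_map_extendZero, isWeaklyRegular_range_iff] at hzr
    have hzh := le_height_of_isSMulRegular hzr
    refine MatRes.koszulTorMapZero hi hI (hJI.trans hIm) fun ζ e hζ heD =>
      MatRes.dotProduct_ne_one hR hS2
        (fun P hP => hR.cmLoc.height_eq_of_mem_minimalPrimes hS2 hge' hP₀ hIP₀ hP₀h hP)
        hi hI hIJ (fun P hP => ?_) hζ heD
    rw [← initIdeal_extendZero] at hP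
    exact (hR.cmLoc.assP_of_height hzm hzh hP).1
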